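/- Let (A,𝔫) be a regular local ring, let x₁,…,x_c be an A-regular sequence of elements of 𝔫, and let R = A/(x₁,…,x_c). Assume that R is an integral domain and that for every prime ideal P of R of height at most 3 the localization R_P is a unique factorization domain. Then R is a unique factorization domain. -/

import Mathlib

namespace GrothUFD
open Finset

section CN
variable {T Ω : Type*} [CommRing T] [AddCommGroup Ω] [Module T Ω]

/-- `B` is closed under convergent sums `∑ x^i b_i`. -/
def SumCl (x : T) (B : Set Ω) : Prop :=
  ∀ b : ℕ → Ω, (∀ n, b n ∈ B) → ∃ s ∈ B, ∀ n, ∃ u : Ω, s = ∑ i ∈ range n, x ^ i • b i + x ^ n • u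

/-- `Ω` is `x`-adically separated. -/
def Haus (Ω : Type*) [AddCommGroup Ω] [Module T Ω] (x : T) : Prop :=
  ∀ w : Ω, (∀ n : ℕ, ∃ u, w = x ^ n • u) → w = 0

theorem CN (D : Subring T) (x : T) (hD : SumCl x (D : Set T)) (hΩ : Haus Ω x)
    {α : Type*} [Fintype α] (m : α → Ω) (B : AddSubgroup Ω) (hB : SumCl x (B : Set Ω)) (Z : Set Ω)
    (h : ∀ y ∈ Z, ∃ c : α → T, (∀ a, c a ∈ D) ∧ ∃ b ∈ B, ∃ y' ∈ Z,
      y = ∑ a, c a • m a + b + x • y') :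
    ∀ y ∈ Z, ∃ c : α → T, (∀ a, c a ∈ D) ∧ ∃ b ∈ B, y = ∑ a, c a • m a + b := by
  choose! c hc b hb y' hy' hyy using h
  intro y hy
  have hit : ∀ n, (y'^[n] y) ∈ Z := by
    intro n
    induction n with
    | zero => simpa using hy
    | succ n ih => rw [Function.iterate_succ_apply']; exact hy' _ ih
  have hsum : ∀ n : ℕ, y = ∑ i ∈ range n, x ^ i • (∑ a, c (y'^[i] y) a • m a + b (y'^[i] y))
      + x ^ n • (y'^[n] y) := by
    intro n
    induction n with
    | zero => simp
    | succ n ih =>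
      rw [sum_range_succ, Function.iterate_succ_apply']
      conv_lhs => rw [ih]
      conv_lhs => rw [hyy _ (hit n)]
      simp only [smul_add, pow_succ, mul_smul]
      abel
  choose C hC hCC using fun a => hD (fun n => c (y'^[n] y) a) (fun n => hc _ (hit n) a)
  obtain ⟨β, hβ, hββ⟩ := hB (fun n => b (y'^[n] y)) (fun n => hb _ (hit n))
  refine ⟨C, hC, β, hβ, ?_⟩
  rw [← sub_eq_zero]
  apply hΩ
  intro n
  obtain ⟨u, hu⟩ := hββ n
  choose w hw using fun a => hCC a n
  refine ⟨(y'^[n] y) - ∑ a, w a • m a - u, ?_⟩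
  conv_lhs => rw [hsum n, hu]
  have : ∑ a, C a • m a = ∑ i ∈ range n, x ^ i • (∑ a, c (y'^[i] y) a • m a)
      + x ^ n • ∑ a, w a • m a := by
    have : ∀ a, C a • m a = ∑ i ∈ range n, x ^ i • (c (y'^[i] y) a • m a) + x ^ n • (w a • m a) := by
      intro a
      conv_lhs => rw [hw a]
      simp [add_smul, sum_smul, mul_smul]
    rw [sum_congr rfl (fun a _ => this a), sum_add_distrib, sum_comm]
    simp [smul_sum]
  rw [this]
  simp only [smul_add, smul_sub, sum_add_distrib]
  abel
end CN

/-- `t` is a unit of the subring `S`. -/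
def UnitIn {T : Type*} [CommRing T] (S : Subring T) (t : T) : Prop := t ∈ S ∧ ∃ u ∈ S, t * u = 1

theorem UnitIn.mul {T : Type*} [CommRing T] {S : Subring T} {a b : T} (ha : UnitIn S a)
    (hb : UnitIn S b) : UnitIn S (a * b) := by
  obtain ⟨ha, u, hu, hau⟩ := ha
  obtain ⟨hb, w, hw, hbw⟩ := hb
  exact ⟨S.mul_mem ha hb, u * w, S.mul_mem hu hw, by linear_combination hau * b * w + hbw⟩

theorem UnitIn.pow {T : Type*} [CommRing T] {S : Subring T} {a : T} (ha : UnitIn S a) (n : ℕ) :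
    UnitIn S (a ^ n) := by
  induction n with
  | zero => exact ⟨by simp, 1, S.one_mem, by simp⟩
  | succ n ih => rw [pow_succ]; exact ih.mul ha

theorem UnitIn.mono {T : Type*} [CommRing T] {S S' : Subring T} (h : S ≤ S') {a : T}
    (ha : UnitIn S a) : UnitIn S' a := by
  obtain ⟨ha, u, hu, hau⟩ := ha
  exact ⟨h ha, u, h hu, hau⟩

theorem UnitIn.map {T T₂ : Type*} [CommRing T] [CommRing T₂] (π : T →+* T₂) {S : Subring T} {a : T}
    (ha : UnitIn S a) : UnitIn (S.map π) (π a) := by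
  obtain ⟨ha, u, hu, hau⟩ := ha
  exact ⟨⟨a, ha, rfl⟩, π u, ⟨u, hu, rfl⟩, by rw [← map_mul, hau, map_one]⟩

section defs
variable {ι : Type*} [Fintype ι] [DecidableEq ι]
variable {T : Type*} [CommRing T] (S : Finset ι → Subring T) (v : ι → Tˣ)

/-- vanishing of the second Čech cohomology of the structure sheaf. -/
def P2 : Prop := ∀ ε : ι → ι → T, (∀ i j k, ε i j + ε j k - ε i k ∈ S {i, j, k}) →
  ∃ r : ι → T, ∀ i j, ε i j - r i + r j ∈ S {i, j}

/-- sections of the line bundle. -/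
def secM (hS : Monotone S) : Submodule (S ∅) T where
  carrier := {t | ∀ i, (v i)⁻¹ * t ∈ S {i}}
  add_mem' := fun {a b} ha hb i => by
    show (v i)⁻¹ * (a + b) ∈ S {i}
    rw [mul_add]; exact (S {i}).add_mem (ha i) (hb i)
  zero_mem' := fun i => by simp
  smul_mem' := fun c t ht i => by
    show (v i)⁻¹ * ((c : T) * t) ∈ S {i}
    rw [mul_left_comm]
    exact (S {i}).mul_mem (hS (Finset.empty_subset _) c.2) (ht i)

/-- 1-cocycles (as torsors in `T`). -/
def cocZ (hS : Monotone S) : Submodule (S ∅) (ι → T) where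
  carrier := {r | ∀ i j, (v i)⁻¹ * (r i - r j) ∈ S {i, j}}
  add_mem' := fun {a b} ha hb i j => by
    have := (S {i, j}).add_mem (ha i j) (hb i j)
    simp only [Pi.add_apply]
    convert this using 1; ring
  zero_mem' := fun i => by simp
  smul_mem' := fun c t ht i j => by
    show (v i)⁻¹ * ((c : T) * t i - (c : T) * t j) ∈ S {i, j}
    have := (S {i, j}).mul_mem (hS (Finset.empty_subset _) c.2) (ht i j)
    convert this using 1; ring

/-- 1-coboundaries. -/
def cobB (hS : Monotone S) : Submodule (S ∅) (ι → T) where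
  carrier := {r | ∃ t, ∀ i, (v i)⁻¹ * (r i - t) ∈ S {i}}
  add_mem' := by
    rintro a b ⟨t, ht⟩ ⟨t', ht'⟩
    refine ⟨t + t', fun i => ?_⟩
    have := (S {i}).add_mem (ht i) (ht' i)
    simp only [Pi.add_apply]
    convert this using 1; ring
  zero_mem' := ⟨0, fun i => by simp⟩
  smul_mem' := by
    rintro c a ⟨t, ht⟩
    refine ⟨c * t, fun i => ?_⟩
    show (v i)⁻¹ * ((c : T) * a i - (c : T) * t) ∈ S {i}
    have := (S {i}).mul_mem (hS (Finset.empty_subset _) c.2) (ht i)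
    convert this using 1; ring

/-- the induction invariant. -/
structure Inv (hS : Monotone S) : Prop where
  noeth : IsNoetherianRing (S ∅)
  dom : IsDomain T
  coc : ∀ i j, (v i : T) * ((v j)⁻¹ : Tˣ) ∈ S {i, j}
  p2 : P2 S
  mfg : (secM S v hS).FG
  zfg : ∃ F : Submodule (S ∅) (ι → T), F.FG ∧ F ≤ cocZ S v hS ∧ cocZ S v hS ≤ F ⊔ cobB S v hS
  kill : ∀ i, ∃ ψ : S ∅, UnitIn (S {i}) (ψ : T) ∧ ∀ r ∈ cocZ S v hS, ψ • r ∈ cobB S v hS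
  gen : ∀ i, ∃ n ∈ secM S v hS, ∃ φ : S ∅, UnitIn (S {i}) (φ : T) ∧ UnitIn (S {i}) ((v i)⁻¹ * n) ∧
    ∀ y ∈ secM S v hS, ∃ b : S ∅, φ • y = b • n

/-- triviality of the line bundle. -/
def Triv : Prop := ∃ e : Tˣ, ∀ i, UnitIn (S {i}) ((v i : T) * ((e⁻¹ : Tˣ) : T))

end defs

/-- One step of the tower. -/
structure Step {ι : Type*} {T' T : Type*} [CommRing T'] [CommRing T]
    (π : T' →+* T) (x : T') (S' : Finset ι → Subring T') (S : Finset ι → Subring T) : Prop where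
  surj : Function.Surjective π
  ker : ∀ t, π t = 0 → ∃ u, t = x * u
  pix : π x = 0
  reg : ∀ t, x * t = 0 → t = 0
  haus : Haus T' x
  sum : SumCl x (Set.univ : Set T')
  mono : Monotone S'
  map : ∀ σ, S σ = (S' σ).map π
  sat : ∀ σ t, x * t ∈ S' σ → t ∈ S' σ
  scl : ∀ σ, SumCl x (S' σ : Set T')
  xmem : x ∈ S' ∅
end GrothUFD

namespace GrothUFD
open Finset

section geom
variable {T : Type*} [CommRing T]

theorem unitIn_geom {x : T} (hh : Haus T x) (E : Subring T) (hE : SumCl x (E : Set T)) (hx : x ∈ E)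
    {w : T} (hw : w ∈ E) : UnitIn E (1 + x * w) := by
  obtain ⟨s, hs, hss⟩ := hE (fun n => (-w) ^ n) (fun n => E.pow_mem (E.neg_mem hw) n)
  refine ⟨E.add_mem E.one_mem (E.mul_mem hx hw), s, hs, ?_⟩
  rw [← sub_eq_zero]
  apply hh
  intro n
  obtain ⟨u, hu⟩ := hss n
  have h1 : (1 + x * w) * ∑ i ∈ range n, x ^ i • (-w) ^ i = 1 - (-(x * w)) ^ n := by
    have := mul_neg_geom_sum (-(x * w)) n
    rw [← this, sub_neg_eq_add]
    congr 1
    apply sum_congr rfl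
    intro i _
    simp only [smul_eq_mul]; rw [← mul_pow]; congr 1; ring
  refine ⟨(1 + x * w) * u - (-w) ^ n, ?_⟩
  rw [hu, mul_add, h1]
  simp only [smul_eq_mul]
  have : (-(x*w)) ^ n = x ^ n * (-w) ^ n := by rw [← mul_pow]; congr 1; ring
  rw [this]; ring
end geom

theorem det_kill {D Q : Type*} [CommRing D] [AddCommGroup Q] [Module D Q] [Module.Finite D Q]
    (x ψ : D) (h : ∀ q : Q, ∃ q' : Q, ψ • q = x • q') :
    ∃ (n : ℕ) (d : D), ∀ q : Q, (ψ ^ n + x * d) • q = 0 := by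
  obtain ⟨p, hp, -, hc, hz⟩ := LinearMap.exists_monic_and_natDegree_eq_and_coeff_mem_pow_and_aeval_eq_zero
    D (LinearMap.lsmul D Q ψ) (Ideal.span {x}) (by
      rintro _ ⟨q, rfl⟩
      obtain ⟨q', hq'⟩ := h q
      simp only [LinearMap.lsmul_apply, hq']
      exact Submodule.smul_mem_smul (Ideal.mem_span_singleton_self x) trivial)
  have h1 : ∃ d, p.eval ψ = ψ ^ p.natDegree + x * d := by
    rw [Polynomial.eval_eq_sum_range, sum_range_succ, hp.coeff_natDegree, one_mul]
    have : x ∣ ∑ i ∈ range p.natDegree, p.coeff i * ψ ^ i := by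
      apply Finset.dvd_sum
      intro i hi
      apply Dvd.dvd.mul_right
      have := hc i
      rw [Ideal.span_singleton_pow, Ideal.mem_span_singleton] at this
      exact (dvd_pow_self x (by have := mem_range.1 hi; omega)).trans this
    obtain ⟨d, hd⟩ := this
    exact ⟨d, by rw [hd]; ring⟩
  obtain ⟨d, hd⟩ := h1
  refine ⟨p.natDegree, d, fun q => ?_⟩
  rw [← hd]
  have h2 := LinearMap.congr_fun hz q
  have h3 : Polynomial.aeval (LinearMap.lsmul D Q ψ) p = LinearMap.lsmul D Q (p.eval ψ) := by
    have e : LinearMap.lsmul D Q ψ = algebraMap D (Module.End D Q) ψ := by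
      ext; simp
    rw [e, Polynomial.aeval_algebraMap_apply]
    ext; simp
  rw [h3] at h2
  simpa using h2

theorem fg_lift {T' T Ω' Ω : Type*} [CommRing T'] [CommRing T] [AddCommGroup Ω'] [Module T' Ω']
    [AddCommGroup Ω] [Module T Ω] (π : T' →+* T) (D' : Subring T') (D : Subring T)
    (hD : D = D'.map π) (hn : IsNoetherianRing D) (Pm : Ω' →+ Ω) (hPm : ∀ t w, Pm (t • w) = π t • Pm w)
    (N' : Submodule D' Ω') (F B : Submodule D Ω) (hF : F.FG) (h : ∀ y ∈ N', Pm y ∈ F ⊔ B) :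
    ∃ (k : ℕ) (m : Fin k → Ω'), (∀ a, m a ∈ N') ∧ ∀ y ∈ N', ∃ c : Fin k → T', (∀ a, c a ∈ D') ∧
      Pm (y - ∑ a, c a • m a) ∈ B := by
  let X : Submodule D Ω :=
    { carrier := {w | ∃ y ∈ N', Pm y = w}
      add_mem' := by
        rintro _ _ ⟨a, ha, rfl⟩ ⟨b, hb, rfl⟩
        exact ⟨a + b, N'.add_mem ha hb, map_add _ _ _⟩
      zero_mem' := ⟨0, N'.zero_mem, map_zero _⟩
      smul_mem' := by
        rintro ⟨c, hc⟩ _ ⟨a, ha, rfl⟩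
        rw [hD] at hc
        obtain ⟨c', hc', rfl⟩ := hc
        exact ⟨c' • a, N'.smul_mem ⟨c', hc'⟩ ha, hPm _ _⟩ }
  have hle : X.map B.mkQ ≤ F.map B.mkQ := by
    rintro _ ⟨_, ⟨y, hy, rfl⟩, rfl⟩
    obtain ⟨f, hf, b, hb, hfb⟩ := Submodule.mem_sup.1 (h y hy)
    refine ⟨f, hf, ?_⟩
    rw [← hfb, map_add, (Submodule.Quotient.mk_eq_zero B).2 hb |> (fun h => (h : B.mkQ b = 0)),
      add_zero]
  have hfg : (X.map B.mkQ).FG := by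
    have h1 : (F.map B.mkQ).FG := hF.map _
    have : Module.Finite D (F.map B.mkQ) := Module.Finite.iff_fg.2 h1
    have : IsNoetherian D (F.map B.mkQ) := isNoetherian_of_isNoetherianRing_of_finite _ _
    have h2 := (isNoetherian_submodule.1 this) (X.map B.mkQ) hle
    exact h2
  obtain ⟨k, g, hg⟩ := Submodule.fg_iff_exists_fin_generating_family.1 hfg
  have : ∀ a, ∃ m ∈ N', B.mkQ (Pm m) = g a := by
    intro a
    have : g a ∈ X.map B.mkQ := by rw [← hg]; exact Submodule.subset_span ⟨a, rfl⟩
    obtain ⟨_, ⟨y, hy, rfl⟩, h⟩ := this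
    exact ⟨y, hy, h⟩
  choose m hm hmg using this
  refine ⟨k, m, hm, fun y hy => ?_⟩
  have h3 : B.mkQ (Pm y) ∈ Submodule.span D (Set.range g) := by
    rw [hg]; exact ⟨_, ⟨y, hy, rfl⟩, rfl⟩
  obtain ⟨c, hc⟩ := (Submodule.mem_span_range_iff_exists_fun D).1 h3
  have : ∀ a, ∃ c' ∈ D', π c' = c a := by
    intro a
    exact hD.le (c a).2
  choose c' hc' hcc using this
  refine ⟨c', hc', ?_⟩
  rw [← Submodule.Quotient.mk_eq_zero B]
  change B.mkQ _ = 0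
  rw [map_sub, map_sub, map_sum, map_sum, ← hc, sub_eq_zero]
  apply sum_congr rfl
  intro a _
  rw [hPm, hcc, ← hmg]
  exact (map_smul B.mkQ (c a) (Pm (m a))).symm
end GrothUFD

namespace GrothUFD
open Finset

namespace Step
variable {ι : Type*} {T' T : Type*} [CommRing T'] [CommRing T]
    {π : T' →+* T} {x : T'} {S' : Finset ι → Subring T'} {S : Finset ι → Subring T}
    (h : Step π x S' S)
include h

theorem reg_pow (n : ℕ) {t : T'} (ht : x ^ n * t = 0) : t = 0 := by
  induction n with
  | zero => simpa using ht
  | succ n ih => exact ih (h.reg _ (by rw [← ht]; ring))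

theorem sat_pow (σ : Finset ι) (n : ℕ) {t : T'} (ht : x ^ n * t ∈ S' σ) : t ∈ S' σ := by
  induction n with
  | zero => simpa using ht
  | succ n ih => exact ih (h.sat σ _ (by convert ht using 1; ring))

theorem map_mem {σ : Finset ι} {t : T'} (ht : t ∈ S' σ) : π t ∈ S σ := by
  rw [h.map]; exact ⟨t, ht, rfl⟩

theorem lift_mem {σ : Finset ι} {t : T} (ht : t ∈ S σ) : ∃ s ∈ S' σ, π s = t := by
  rw [h.map] at ht; exact ht

theorem xm (σ : Finset ι) : x ∈ S' σ := h.mono (empty_subset _) h.xmem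

theorem closed (σ : Finset ι) (t : T') (ht : ∀ n : ℕ, ∃ s ∈ S' σ, ∃ u, t = s + x ^ n * u) :
    t ∈ S' σ := by
  obtain ⟨c, _, b, hb, e⟩ := CN (S' σ) x (h.scl σ) (Ω := T') h.haus (fun a : Fin 0 => (0 : T'))
    (S' σ).toAddSubgroup (h.scl σ) {t | ∀ n : ℕ, ∃ s ∈ S' σ, ∃ u, t = s + x ^ n * u} (by
      intro y hy
      refine ⟨fun _ => 0, fun _ => (S' σ).zero_mem, ?_⟩
      obtain ⟨s, hs, u, hu⟩ := hy 1
      refine ⟨s, hs, u, ?_, by simpa using hu⟩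
      intro n
      obtain ⟨s', hs', u', hu'⟩ := hy (n + 1)
      refine ⟨u - x ^ n * u', ?_, u', by ring⟩
      apply h.sat
      have : x * (u - x ^ n * u') = s' - s := by
        rw [hu] at hu'
        linear_combination hu'
      rw [this]; exact (S' σ).sub_mem hs' hs) t ht
  simp at e
  rw [e]; exact hb

theorem unitlift {σ : Finset ι} {s : T'} (hs : s ∈ S' σ) (hu : UnitIn (S σ) (π s)) :
    UnitIn (S' σ) s := by
  obtain ⟨_, u, hu, hsu⟩ := hu
  obtain ⟨u', hu', rfl⟩ := h.lift_mem hu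
  obtain ⟨w, hw⟩ := h.ker (s * u' - 1) (by simp [hsu])
  have hw' : w ∈ S' σ := by
    apply h.sat; rw [← hw]; exact (S' σ).sub_mem ((S' σ).mul_mem hs hu') (S' σ).one_mem
  obtain ⟨_, z, hz, hz1⟩ := unitIn_geom h.haus (S' σ) (h.scl σ) (h.xm σ) hw'
  refine ⟨hs, u' * z, (S' σ).mul_mem hu' hz, ?_⟩
  rw [← hz1, ← hw]; ring

theorem isUnit_lift {s : T'} (hu : IsUnit (π s)) : IsUnit s := by
  obtain ⟨u, hu⟩ := hu.exists_right_inv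
  obtain ⟨u', rfl⟩ := h.surj u
  obtain ⟨w, hw⟩ := h.ker (s * u' - 1) (by simp [hu])
  obtain ⟨_, z, hz, hz1⟩ := unitIn_geom (E := ⊤) h.haus (by simpa using h.sum) trivial (w := w) trivial
  apply IsUnit.of_mul_eq_one (u' * z)
  rw [← hz1, ← hw]; ring

theorem exists_pow {a : T'} (ha : a ≠ 0) : ∃ (n : ℕ) (b : T'), a = x ^ n * b ∧ π b ≠ 0 := by
  by_contra hcon
  push Not at hcon
  apply ha
  apply h.haus
  intro n
  induction n with
  | zero => exact ⟨a, by simp⟩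
  | succ n ih =>
    obtain ⟨u, hu⟩ := ih
    obtain ⟨w, hw⟩ := h.ker u (hcon n u hu)
    exact ⟨w, by rw [hu, hw]; simp only [smul_eq_mul]; ring⟩

theorem dom (hd : IsDomain T) : IsDomain T' := by
  have : Nontrivial T' := π.domain_nontrivial
  have : NoZeroDivisors T' := by
    constructor
    intro a b hab
    by_contra hcon
    push Not at hcon
    obtain ⟨n, a', ha, ha'⟩ := h.exists_pow hcon.1
    obtain ⟨m, b', hb, hb'⟩ := h.exists_pow hcon.2
    have : a' * b' = 0 := by
      apply h.reg_pow (n + m)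
      rw [← hab, ha, hb]; ring
    have := congrArg π this
    rw [map_mul, map_zero] at this
    exact (mul_ne_zero ha' hb') this
  exact NoZeroDivisors.to_isDomain _

theorem noeth (hn : IsNoetherianRing (S ∅)) : IsNoetherianRing (S' ∅) := by
  apply IsNoetherianRing.of_prime
  intro P hP
  let ιm : (S' ∅) →ₗ[S' ∅] T' := (Algebra.linearMap (S' ∅) T')
  obtain ⟨k, m, hm, hy⟩ := fg_lift (Ω' := T') (Ω := T) π (S' ∅) (S ∅) (h.map ∅) hn π.toAddMonoidHom
    (by intro t w; simp) (Submodule.map ιm P) (Submodule.span _ {1}) ⊥ ⟨{1}, by simp⟩ (by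
      rintro _ ⟨y, hy, rfl⟩
      apply Submodule.mem_sup_left
      rw [Submodule.mem_span_singleton]
      exact ⟨⟨π y, h.map_mem y.2⟩, by simp [ιm, Subring.smul_def]; rfl⟩)
  choose m' hm' hmm using hm
  have key : ∀ y ∈ P, ∃ c : Fin k → S' ∅, ∃ y' : S' ∅, y = ∑ a, c a * m' a + ⟨x, h.xmem⟩ * y' := by
    intro y hyP
    obtain ⟨c, hc, hcy⟩ := hy y ⟨y, hyP, rfl⟩
    obtain ⟨u, hu⟩ := h.ker ((y : T') - ∑ a, c a * m a) (by simpa using hcy)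
    have hu' : u ∈ S' ∅ := by
      apply h.sat; rw [← hu]
      refine (S' ∅).sub_mem y.2 ((S' ∅).sum_mem fun a _ => (S' ∅).mul_mem (hc a) ?_)
      rw [← hmm]; exact (m' a).2
    refine ⟨fun a => ⟨c a, hc a⟩, ⟨u, hu'⟩, ?_⟩
    apply Subtype.ext
    push_cast
    rw [← hu]
    have : ∀ a, ((m' a : S' ∅) : T') = m a := hmm
    simp [this]
  by_cases hx : (⟨x, h.xmem⟩ : S' ∅) ∈ P
  · have : P = Ideal.span (Set.range m' ∪ {⟨x, h.xmem⟩}) := by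
      apply le_antisymm
      · intro y hy
        obtain ⟨c, y', e⟩ := key y hy
        rw [e]
        apply Ideal.add_mem
        · exact Ideal.sum_mem _ fun a _ => Ideal.mul_mem_left _ _ (Ideal.subset_span (Or.inl ⟨a, rfl⟩))
        · exact Ideal.mul_mem_right _ _ (Ideal.subset_span (Or.inr rfl))
      · rw [Ideal.span_le]
        rintro _ (⟨a, rfl⟩ | rfl)
        · exact hm' a
        · exact hx
    rw [this]
    exact Submodule.fg_span ((Set.finite_range _).union (Set.finite_singleton _))
  · have : P = Ideal.span (Set.range m') := by
      apply le_antisymm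
      · intro y hy
        obtain ⟨c, hc, b, hb, e⟩ := CN (S' ∅) x (h.scl ∅) (Ω := T') h.haus m ⊥ (by
          intro b hb
          refine ⟨0, rfl, fun n => ⟨0, ?_⟩⟩
          have : ∀ n, b n = 0 := hb
          simp [this]) ((fun z : S' ∅ => (z : T')) '' P) (by
            rintro _ ⟨y, hy, rfl⟩
            obtain ⟨c, y', e⟩ := key y hy
            refine ⟨fun a => c a, fun a => (c a).2, 0, rfl, y', ⟨y', ?_, rfl⟩, ?_⟩
            · have : (⟨x, h.xmem⟩ : S' ∅) * y' ∈ P := by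
                have : (⟨x, h.xmem⟩ : S' ∅) * y' = y - ∑ a, c a * m' a := by rw [e]; ring
                rw [this]
                exact P.sub_mem hy (P.sum_mem fun a _ => P.mul_mem_left _ (hm' a))
              exact (hP.mem_or_mem this).resolve_left hx
            · have := congrArg (fun z : S' ∅ => (z : T')) e
              have hmm' : ∀ a, ((m' a : S' ∅) : T') = m a := hmm
              simpa [hmm'] using this) y ⟨y, hy, rfl⟩
        have hb : b = 0 := hb
        have : y = ∑ a, (⟨c a, hc a⟩ : S' ∅) * m' a := by
          apply Subtype.ext
          have hmm' : ∀ a, ((m' a : S' ∅) : T') = m a := hmm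
          simp [e, hb, hmm']
        rw [this]
        exact Ideal.sum_mem _ fun a _ => Ideal.mul_mem_left _ _ (Ideal.subset_span ⟨a, rfl⟩)
      · rw [Ideal.span_le]
        rintro _ ⟨a, rfl⟩
        exact hm' a
    rw [this]
    exact Submodule.fg_span (Set.finite_range _)

end Step
end GrothUFD

namespace GrothUFD
open Finset

namespace Step
variable {ι : Type*} [Fintype ι] [DecidableEq ι] {T' T : Type*} [CommRing T'] [CommRing T]
    {π : T' →+* T} {x : T'} {S' : Finset ι → Subring T'} {S : Finset ι → Subring T}
    (h : Step π x S' S)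
include h

omit [Fintype ι] [DecidableEq ι] in
theorem p2_aux (α : Type*) : Haus (α → T') x := by
  intro w hw
  funext i
  apply h.haus
  intro n
  obtain ⟨u, hu⟩ := hw n
  exact ⟨u i, by rw [hu]; rfl⟩

theorem p2' (hp : P2 S) : P2 S' := by
  let B : AddSubgroup (ι → ι → T') :=
    { carrier := {ε | ∃ r : ι → T', ∀ i j, ε i j - r i + r j ∈ S' {i, j}}
      add_mem' := by
        rintro a b ⟨r, hr⟩ ⟨s, hs⟩
        refine ⟨r + s, fun i j => ?_⟩
        have := (S' {i, j}).add_mem (hr i j) (hs i j)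
        simp only [Pi.add_apply]
        convert this using 1; ring
      zero_mem' := ⟨0, fun i j => by simp⟩
      neg_mem' := by
        rintro a ⟨r, hr⟩
        refine ⟨-r, fun i j => ?_⟩
        have := (S' {i, j}).neg_mem (hr i j)
        simp only [Pi.neg_apply]
        convert this using 1; ring }
  intro ε hε
  have hB : SumCl x (B : Set (ι → ι → T')) := by
    intro b hb
    choose r hr using hb
    choose R _ hR using fun i => h.sum (fun n => r n i) (fun n => trivial)
    choose E hE hEE using fun i j => h.scl {i, j} (fun n => b n i j - r n i + r n j) (fun n => hr n i j)
    refine ⟨fun i j => E i j + R i - R j, ⟨R, fun i j => ?_⟩, fun n => ?_⟩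
    · convert SetLike.mem_coe.1 (hE i j) using 1; ring
    · choose u hu using fun i => hR i n
      choose w hw using fun i j => hEE i j n
      refine ⟨fun i j => w i j + u i - u j, ?_⟩
      funext i j
      rw [hw i j, hu i, hu j]
      simp only [Pi.add_apply, Finset.sum_apply, Pi.smul_apply, smul_eq_mul, mul_add, mul_sub,
        sum_add_distrib, sum_sub_distrib]
      ring
  obtain ⟨c, _, b, ⟨r, hr⟩, e⟩ := CN (S' ∅) x (h.scl ∅) (Ω := ι → ι → T')
    (by
      intro w hw
      funext i j
      apply h.haus
      intro n
      obtain ⟨u, hu⟩ := hw n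
      exact ⟨u i j, by rw [hu]; rfl⟩) (fun a : Fin 0 => 0) B hB
      {ε | ∀ i j k, ε i j + ε j k - ε i k ∈ S' {i, j, k}} (by
      intro y hy
      refine ⟨fun _ => 0, fun _ => (S' ∅).zero_mem, ?_⟩
      obtain ⟨r, hr⟩ := hp (fun i j => π (y i j)) (by
        intro i j k
        have := h.map_mem (hy i j k)
        simpa using this)
      choose r' hr' using fun i => h.surj (r i)
      choose s hs hss using fun i j => h.lift_mem (hr i j)
      choose z hz using fun i j => h.ker (y i j - r' i + r' j - s i j) (by simp [hss, hr'])
      refine ⟨fun i j => r' i - r' j + s i j, ⟨r', fun i j => ?_⟩, z, ?_, ?_⟩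
      · convert hs i j using 1; ring
      · intro i j k
        apply h.sat
        have e : x * (z i j + z j k - z i k) = (y i j + y j k - y i k) - (s i j + s j k - s i k) := by
          linear_combination -hz i j - hz j k + hz i k
        rw [e]
        refine (S' _).sub_mem (hy i j k) ((S' _).sub_mem ((S' _).add_mem ?_ ?_) ?_)
        · exact h.mono (by intro a; simp; tauto) (hs i j)
        · exact h.mono (by intro a; simp; tauto) (hs j k)
        · exact h.mono (by intro a; simp; tauto) (hs i k)
      · funext i j
        simp
        linear_combination hz i j) ε hε
  simp at e
  exact ⟨r, by rw [e]; exact hr⟩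

/-- one step of the lifting of the cocycle -/
theorem lift_step (hp : P2 S) (v₀ : ι → Tˣ)
    (hcoc : ∀ i j, (v₀ i : T) * ((v₀ j)⁻¹ : Tˣ) ∈ S {i, j}) (n : ℕ) (v : ι → T')
    (hv : ∀ i, π (v i) = v₀ i)
    (hvv : ∀ i j, ∃ w ∈ S' {i, j}, ∃ e, v i = (w + x ^ (n + 1) * e) * v j) :
    ∃ d : ι → T', ∀ i j, ∃ w ∈ S' {i, j}, ∃ e,
      (v i + x ^ (n + 1) * d i) = (w + x ^ (n + 2) * e) * (v j + x ^ (n + 1) * d j) := by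
  choose w hw e he using hvv
  have hvu : ∀ i, IsUnit (v i) := fun i => h.isUnit_lift (by rw [hv]; exact (v₀ i).isUnit)
  have hVV : ∀ i j, π (w i j) = (v₀ i : T) * ((v₀ j)⁻¹ : Tˣ) := by
    intro i j
    have := congrArg π (he i j)
    rw [map_mul, map_add, map_mul, map_pow, h.pix, hv, hv] at this
    rw [this]
    simp
  have hee : ∀ i j k, e i j * w j k + w i j * e j k - e i k + x ^ (n + 1) * (e i j * e j k)
      ∈ S' {i, j, k} := by
    intro i j k
    apply h.sat_pow _ (n + 1)
    have e1 : v k * ((w i j + x ^ (n+1) * e i j) * (w j k + x ^ (n+1) * e j k)) =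
        v k * (w i k + x ^ (n+1) * e i k) := by
      linear_combination -he i j - (w i j + x ^ (n+1) * e i j) * he j k + he i k
    have e2 := (hvu k).mul_left_cancel e1
    have e3 : x ^ (n+1) * (e i j * w j k + w i j * e j k - e i k + x ^ (n + 1) * (e i j * e j k))
        = w i k - w i j * w j k := by linear_combination e2
    rw [e3]
    refine (S' _).sub_mem ?_ ((S' _).mul_mem ?_ ?_)
    · exact h.mono (by intro a; simp; tauto) (hw i k)
    · exact h.mono (by intro a; simp; tauto) (hw i j)
    · exact h.mono (by intro a; simp; tauto) (hw j k)
  obtain ⟨r, hr⟩ := hp (fun i j => π (e i j) * ((v₀ j : T) * ((v₀ i)⁻¹ : Tˣ))) (by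
    intro i j k
    have h1 := h.map_mem (hee i j k)
    simp only [map_add, map_sub, map_mul, map_pow, h.pix, hVV] at h1
    have h2 : (v₀ k : T) * ((v₀ i)⁻¹ : Tˣ) ∈ S {i, j, k} := by
      have := hcoc k i
      rw [h.map] at this ⊢
      obtain ⟨a, ha, hae⟩ := this
      exact ⟨a, h.mono (by intro a; simp; tauto) ha, hae⟩
    have h3 := (S {i,j,k}).mul_mem h1 h2
    convert h3 using 1
    have a1 := (v₀ i).mul_inv
    have a2 := (v₀ j).mul_inv
    have a3 := (v₀ k).mul_inv
    simp only [zero_pow (Nat.succ_ne_zero n)]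
    linear_combination (-π (e i j) * v₀ j * ((v₀ i)⁻¹ : Tˣ)) * a3 -
      (π (e j k) * v₀ k * ((v₀ j)⁻¹ : Tˣ)) * a1)
  choose r' hr' using fun i => h.surj (r i)
  have : ∀ i j, ∃ s ∈ S' {i, j}, ∃ z, e i j - w i j * r' i + w i j * r' j = s + x * z := by
    intro i j
    have h1 := (S {i, j}).mul_mem (h.map_mem (hw i j)) (hr i j)
    obtain ⟨s, hs, hss⟩ := h.lift_mem h1
    obtain ⟨z, hz⟩ := h.ker (e i j - w i j * r' i + w i j * r' j - s) (by
      rw [map_sub, hss]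
      simp only [map_add, map_sub, map_mul, hr', hVV]
      have a1 := (v₀ i).mul_inv
      have a2 := (v₀ j).mul_inv
      linear_combination (-π (e i j)) * a1 - (π (e i j) * v₀ i * ((v₀ i)⁻¹ : Tˣ)) * a2)
    exact ⟨s, hs, z, by linear_combination hz⟩
  choose s hs z hz using this
  refine ⟨fun i => - (v i * r' i), fun i j => ?_⟩
  have hju : IsUnit (v j + x ^ (n + 1) * -(v j * r' j)) := by
    apply h.isUnit_lift
    simp [h.pix, hv]
  obtain ⟨q, hq⟩ := hju.exists_left_inv
  refine ⟨w i j + x ^ (n+1) * s i j, (S' _).add_mem (hw i j) ((S' _).mul_mem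
    ((S' _).pow_mem (h.xm _) _) (hs i j)), v j * (z i j - x ^ n * e i j * r' i +
      x ^ n * s i j * r' j) * q, ?_⟩
  have h1 : x ^ (n + 2) * (v j * (z i j - x ^ n * e i j * r' i + x ^ n * s i j * r' j) * q) *
      (v j + x ^ (n + 1) * -(v j * r' j)) =
      x ^ (n + 2) * (v j * (z i j - x ^ n * e i j * r' i + x ^ n * s i j * r' j)) := by
    linear_combination x ^ (n + 2) * (v j * (z i j - x ^ n * e i j * r' i + x ^ n * s i j * r' j)) * hq
  rw [add_mul (w i j + _), h1]
  simp only [pow_succ] at he ⊢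
  linear_combination (1 - x ^ n * x * r' i) * he i j + v j * x ^ n * x * hz i j

theorem lift_v (hp : P2 S) (v₀ : ι → Tˣ)
    (hcoc : ∀ i j, (v₀ i : T) * ((v₀ j)⁻¹ : Tˣ) ∈ S {i, j}) :
    ∃ v : ι → T'ˣ, (∀ i, π (v i) = v₀ i) ∧ ∀ i j, (v i : T') * ((v j)⁻¹ : T'ˣ) ∈ S' {i, j} := by
  let P : ℕ → (ι → T') → Prop := fun n v => (∀ i, π (v i) = v₀ i) ∧
    ∀ i j, ∃ w ∈ S' {i, j}, ∃ e, v i = (w + x ^ (n + 1) * e) * v j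
  have hstep : ∀ (n : ℕ) (v : {v : ι → T' // P n v}), ∃ d : ι → T', P (n + 1) (v.1 + x ^ (n + 1) • d) := by
    rintro n ⟨v, hv1, hv2⟩
    obtain ⟨d, hd⟩ := h.lift_step hp v₀ hcoc n v hv1 hv2
    refine ⟨d, fun i => ?_, hd⟩
    simp [h.pix, hv1]
  choose d hd using hstep
  choose u hu using fun i => h.surj (v₀ i : T)
  have hP0 : P 0 u := by
    refine ⟨hu, fun i j => ?_⟩
    obtain ⟨w, hw, hww⟩ := h.lift_mem (hcoc i j)
    have huj : IsUnit (u j) := h.isUnit_lift (by rw [hu]; exact (v₀ j).isUnit)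
    obtain ⟨q, hq⟩ := huj.exists_left_inv
    obtain ⟨z, hz⟩ := h.ker (u i - w * u j) (by simp [hu, hww])
    refine ⟨w, hw, z * q, ?_⟩
    linear_combination hz - x * z * hq
  let V : (n : ℕ) → {v : ι → T' // P n v} := fun n => Nat.rec ⟨u, hP0⟩
    (fun n v => ⟨v.1 + x ^ (n + 1) • d n v, hd n v⟩) n
  have hV : ∀ n i, (V (n+1)).1 i = (V n).1 i + x ^ (n + 1) * d n (V n) i := fun n i => rfl
  choose s _ hs using fun i => h.sum (fun n => d n (V n) i) (fun n => trivial)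
  have hL : ∀ n i, ∃ z, u i + x * s i = (V n).1 i + x ^ (n + 1) * z := by
    intro n i
    obtain ⟨z, hz⟩ := hs i n
    refine ⟨z, ?_⟩
    have : (V n).1 i = u i + x * ∑ m ∈ range n, x ^ m • d m (V m) i := by
      clear hz
      induction n with
      | zero => simp [V]
      | succ n ih => rw [hV, ih, sum_range_succ]; simp only [smul_eq_mul]; ring
    rw [this, hz]; simp only [smul_eq_mul]; ring
  have hLu : ∀ i, IsUnit (u i + x * s i) := fun i =>
    h.isUnit_lift (by simp [h.pix, hu])
  refine ⟨fun i => (hLu i).unit, fun i => by simp [h.pix, hu], fun i j => ?_⟩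
  apply h.closed
  intro n
  obtain ⟨z, hz⟩ := hL n i
  obtain ⟨z', hz'⟩ := hL n j
  obtain ⟨w, hw, e, he⟩ := (V n).2.2 i j
  have hinv := (hLu j).unit.mul_inv
  simp only [IsUnit.unit_spec] at hinv ⊢
  refine ⟨w, hw, (x * e * (V n).1 j + x * z - w * (x * z')) * ((hLu j).unit⁻¹ : T'ˣ), ?_⟩
  have : u i + x * s i = w * (u j + x * s j) +
    x ^ n * (x * e * (V n).1 j + x * z - w * (x * z')) := by
    rw [hz, hz', he]; ring
  rw [this]
  linear_combination w * hinv

omit [Fintype ι] [DecidableEq ι] in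
theorem sumcl_cobB (v : ι → T'ˣ) :
    SumCl x (cobB S' v h.mono : Set (ι → T')) := by
  intro b hb
  choose r hr using hb
  obtain ⟨R, _, hR⟩ := h.sum (fun n => r n) (fun n => trivial)
  choose E hE hEE using fun i => h.scl {i} _ (fun n => hr n i)
  refine ⟨fun i => v i * E i + R, ⟨R, fun i => ?_⟩, fun n => ?_⟩
  · simpa using hE i
  · obtain ⟨u, hu⟩ := hR n
    choose w hw using fun i => hEE i n
    refine ⟨fun i => v i * w i + u, ?_⟩
    funext i
    conv_lhs => rw [hw i, hu]
    simp only [Pi.add_apply, Finset.sum_apply, Pi.smul_apply, smul_eq_mul, mul_add, mul_sum]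
    have : ∀ m, (v i : T') * (x ^ m * (((v i)⁻¹ : T'ˣ) * (b m i - r m))) = x ^ m * (b m i) - x ^ m * r m := by
      intro m
      have := (v i).mul_inv
      linear_combination (x ^ m * (b m i - r m)) * this
    simp only [this, sum_sub_distrib]
    ring

end Step
end GrothUFD

namespace GrothUFD
open Finset

namespace Step
variable {ι : Type*} [Fintype ι] [DecidableEq ι] {T' T : Type*} [CommRing T'] [CommRing T]
    {π : T' →+* T} {x : T'} {S' : Finset ι → Subring T'} {S : Finset ι → Subring T}
    (h : Step π x S' S) (hS : Monotone S)
    {v : ι → Tˣ} {v' : ι → T'ˣ} (hv : ∀ i, π (v' i) = v i)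
    (hc : ∀ i j, (v' i : T') * ((v' j)⁻¹ : T'ˣ) ∈ S' {i, j})
include h hv

omit [Fintype ι] [DecidableEq ι] h in
theorem hvi (i : ι) : π ((v' i)⁻¹ : T'ˣ) = ((v i)⁻¹ : Tˣ) := by
  have h1 : Units.map π.toMonoidHom (v' i) = v i := Units.ext (hv i)
  rw [← h1]; simp

omit [Fintype ι] [DecidableEq ι] in
theorem map_sec {y : T'} (hy : y ∈ secM S' v' h.mono) : π y ∈ secM S v hS := by
  intro i
  have := h.map_mem (hy i)
  rwa [map_mul, hvi hv] at this

omit [Fintype ι] in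
theorem map_coc {y : ι → T'} (hy : y ∈ cocZ S' v' h.mono) : (fun i => π (y i)) ∈ cocZ S v hS := by
  intro i j
  have := h.map_mem (hy i j)
  rwa [map_mul, hvi hv, map_sub] at this

omit [Fintype ι] [DecidableEq ι] hv in
theorem sat_sec {y : T'} (hy : x * y ∈ secM S' v' h.mono) : y ∈ secM S' v' h.mono := by
  intro i
  apply h.sat
  convert hy i using 1; ring

omit [Fintype ι] hv in
theorem sat_coc {y : ι → T'} (hy : x • y ∈ cocZ S' v' h.mono) : y ∈ cocZ S' v' h.mono := by
  intro i j
  apply h.sat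
  convert hy i j using 1
  simp; ring

omit [Fintype ι] hv in
include hc in
theorem cob_le : cobB S' v' h.mono ≤ cocZ S' v' h.mono := by
  rintro b ⟨t, ht⟩ i j
  have h1 : ((v' i)⁻¹ : T'ˣ) * (v' j : T') ∈ S' {i, j} := by
    have := hc j i
    rw [mul_comm, Finset.pair_comm]; exact this
  have h2 := h.mono (by simp : {i} ⊆ ({i, j} : Finset ι)) (ht i)
  have h3 := h.mono (by simp : {j} ⊆ ({i, j} : Finset ι)) (ht j)
  have h4 := (S' _).sub_mem h2 ((S' _).mul_mem h1 h3)
  convert h4 using 1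
  have := (v' j).mul_inv
  linear_combination ((v' i)⁻¹ : T'ˣ) * (b j - t) * this

theorem mfg' (hn : IsNoetherianRing (S ∅)) (hm : (secM S v hS).FG) : (secM S' v' h.mono).FG := by
  obtain ⟨k, m, hm, hy⟩ := fg_lift (Ω' := T') (Ω := T) π (S' ∅) (S ∅) (h.map ∅) hn π.toAddMonoidHom
    (by intro t w; simp) (secM S' v' h.mono) (secM S v hS) ⊥ hm (by
      intro y hy
      exact Submodule.mem_sup_left (h.map_sec hS hv hy))
  have : secM S' v' h.mono = Submodule.span (S' ∅) (Set.range m) := by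
    apply le_antisymm
    · intro y hyM
      obtain ⟨c, hc, b, hb, e⟩ := CN (S' ∅) x (h.scl ∅) (Ω := T') h.haus m ⊥ (by
          intro b hb
          refine ⟨0, rfl, fun n => ⟨0, ?_⟩⟩
          have : ∀ n, b n = 0 := hb
          simp [this]) (secM S' v' h.mono) (by
            intro y hyM
            obtain ⟨c, hc, hcy⟩ := hy y hyM
            obtain ⟨u, hu⟩ := h.ker (y - ∑ a, c a * m a) (by simpa using hcy)
            refine ⟨c, hc, 0, rfl, u, ?_, by simp; linear_combination hu⟩
            apply h.sat_sec
            rw [← hu]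
            refine Submodule.sub_mem _ hyM (Submodule.sum_mem _ fun a _ => ?_)
            exact Submodule.smul_mem _ (⟨c a, hc a⟩ : S' ∅) (hm a)) y hyM
      have hb : b = 0 := hb
      rw [e, hb, add_zero]
      exact Submodule.sum_mem _ fun a _ => Submodule.smul_mem _ (⟨c a, hc a⟩ : S' ∅)
        (Submodule.subset_span ⟨a, rfl⟩)
    · rw [Submodule.span_le]
      rintro _ ⟨a, rfl⟩
      exact hm a
  rw [this]
  exact Submodule.fg_span (Set.finite_range _)

include hc in
theorem coc_of_cob {z : ι → T'} (hz : z ∈ cocZ S' v' h.mono)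
    (hzb : (fun i => π (z i)) ∈ cobB S v hS) :
    ∃ b ∈ cobB S' v' h.mono, ∃ r ∈ cocZ S' v' h.mono, z = b + x • r := by
  obtain ⟨t, ht⟩ := hzb
  obtain ⟨t', rfl⟩ := h.surj t
  choose s hs hss using fun i => h.lift_mem (ht i)
  choose r hr using fun i => h.ker (z i - t' - v' i * s i) (by
    simp only [map_sub, map_mul, hss, hv]
    have := (v i).mul_inv
    linear_combination -(π (z i) - π t') * this)
  have hb : (fun i => t' + v' i * s i) ∈ cobB S' v' h.mono := ⟨t', fun i => by simpa using hs i⟩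
  have e : z = (fun i => t' + v' i * s i) + x • r := by
    funext i
    simp
    linear_combination hr i
  refine ⟨_, hb, r, ?_, e⟩
  apply h.sat_coc
  have : x • r = z - (fun i => t' + v' i * s i) := by rw [e]; simp
  rw [this]
  exact Submodule.sub_mem _ hz (h.cob_le hc hb)

/-- coordinatewise application of `π` -/
def piMap {ι : Type*} (π : T' →+* T) : (ι → T') →+ (ι → T) where
  toFun y i := π (y i)
  map_zero' := by funext i; simp
  map_add' a b := by funext i; simp

include hc in
theorem zfg' (hn : IsNoetherianRing (S ∅))
    (hz : ∃ F : Submodule (S ∅) (ι → T), F.FG ∧ F ≤ cocZ S v hS ∧ cocZ S v hS ≤ F ⊔ cobB S v hS) :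
    ∃ F : Submodule (S' ∅) (ι → T'), F.FG ∧ F ≤ cocZ S' v' h.mono ∧
      cocZ S' v' h.mono ≤ F ⊔ cobB S' v' h.mono := by
  obtain ⟨F, hF, _, hF2⟩ := hz
  obtain ⟨k, m, hm, hy⟩ := fg_lift (Ω' := ι → T') (Ω := ι → T) π (S' ∅) (S ∅) (h.map ∅) hn (piMap π)
    (by intro t w; funext i; simp [piMap]) (cocZ S' v' h.mono) F (cobB S v hS) hF (by
      intro y hy
      exact hF2 (h.map_coc hS hv hy))
  refine ⟨Submodule.span (S' ∅) (Set.range m), Submodule.fg_span (Set.finite_range _), ?_, ?_⟩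
  · rw [Submodule.span_le]
    rintro _ ⟨a, rfl⟩
    exact hm a
  · intro y hyM
    obtain ⟨c, hc, b, hb, e⟩ := CN (S' ∅) x (h.scl ∅) (Ω := ι → T') (h.p2_aux ι) m
      (cobB S' v' h.mono).toAddSubgroup (h.sumcl_cobB v') (cocZ S' v' h.mono) (by
        intro y hyM
        obtain ⟨c, hc', hcy⟩ := hy y hyM
        obtain ⟨b, hb, r, hr, e⟩ := h.coc_of_cob hS hv hc (z := y - ∑ a, c a • m a)
          (Submodule.sub_mem _ hyM (Submodule.sum_mem _ fun a _ =>
            Submodule.smul_mem _ (⟨c a, hc' a⟩ : S' ∅) (hm a))) hcy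
        refine ⟨c, hc', b, hb, r, hr, ?_⟩
        rw [add_assoc, ← e]; abel) y hyM
    rw [e]
    refine Submodule.add_mem_sup ?_ hb
    exact Submodule.sum_mem _ fun a _ => Submodule.smul_mem _ (⟨c a, hc a⟩ : S' ∅)
        (Submodule.subset_span ⟨a, rfl⟩)

end Step
end GrothUFD

namespace GrothUFD
open Finset

/-- a submodule version of `det_kill`. -/
theorem det_kill' {D Ω : Type*} [CommRing D] [AddCommGroup Ω] [Module D Ω]
    (Z B F : Submodule D Ω) (hF : F.FG) (hFZ : F ≤ Z) (hZ : Z ≤ F ⊔ B) (x ψ : D)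
    (h : ∀ z ∈ Z, ∃ b ∈ B, ∃ z' ∈ Z, ψ • z = b + x • z') :
    ∃ (n : ℕ) (d : D), ∀ z ∈ Z, (ψ ^ n + x * d) • z ∈ B := by
  let Q : Submodule D (Ω ⧸ B) := Z.map B.mkQ
  have hQ : Q = F.map B.mkQ := by
    apply le_antisymm
    · rintro _ ⟨z, hz, rfl⟩
      obtain ⟨f, hf, b, hb, e⟩ := Submodule.mem_sup.1 (hZ hz)
      refine ⟨f, hf, ?_⟩
      rw [← e, map_add, (Submodule.Quotient.mk_eq_zero B).2 hb |> (fun h => (h : B.mkQ b = 0)),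
        add_zero]
    · exact Submodule.map_mono hFZ
  have : Module.Finite D Q := Module.Finite.iff_fg.2 (hQ ▸ hF.map _)
  obtain ⟨n, d, hd⟩ := det_kill (Q := Q) x ψ (by
    rintro ⟨_, z, hz, rfl⟩
    obtain ⟨b, hb, z', hz', e⟩ := h z hz
    refine ⟨⟨B.mkQ z', z', hz', rfl⟩, ?_⟩
    apply Subtype.ext
    change ψ • B.mkQ z = x • B.mkQ z'
    rw [← map_smul, e, map_add, (Submodule.Quotient.mk_eq_zero B).2 hb |> (fun h => (h : B.mkQ b = 0)),
        zero_add, map_smul])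
  refine ⟨n, d, fun z hz => ?_⟩
  have := congrArg Subtype.val (hd ⟨B.mkQ z, z, hz, rfl⟩)
  rw [← Submodule.Quotient.mk_eq_zero B]
  exact this

namespace Step
variable {ι : Type*} [Fintype ι] [DecidableEq ι] {T' T : Type*} [CommRing T'] [CommRing T]
    {π : T' →+* T} {x : T'} {S' : Finset ι → Subring T'} {S : Finset ι → Subring T}
    (h : Step π x S' S) (hS : Monotone S)
    {v : ι → Tˣ} {v' : ι → T'ˣ} (hv : ∀ i, π (v' i) = v i)
    (hc : ∀ i j, (v' i : T') * ((v' j)⁻¹ : T'ˣ) ∈ S' {i, j})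
include h hv

omit [Fintype ι] [DecidableEq ι] hv in
theorem unitpow {i : ι} {ψ : T'} (hψ : ψ ∈ S' ∅) (hu : UnitIn (S {i}) (π ψ)) (n : ℕ) {d : T'}
    (hd : d ∈ S' ∅) : UnitIn (S' {i}) (ψ ^ n + x * d) := by
  apply h.unitlift
  · apply h.mono (empty_subset {i})
    exact (S' _).add_mem ((S' _).pow_mem hψ _) ((S' _).mul_mem h.xmem hd)
  · have := hu.pow n
    simpa [h.pix] using this

include hc in
theorem kill' (hz : ∃ F : Submodule (S' ∅) (ι → T'), F.FG ∧ F ≤ cocZ S' v' h.mono ∧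
      cocZ S' v' h.mono ≤ F ⊔ cobB S' v' h.mono) (i : ι)
    (hk : ∃ ψ : S ∅, UnitIn (S {i}) (ψ : T) ∧ ∀ r ∈ cocZ S v hS, ψ • r ∈ cobB S v hS) :
    ∃ ψ : S' ∅, UnitIn (S' {i}) (ψ : T') ∧ ∀ r ∈ cocZ S' v' h.mono, ψ • r ∈ cobB S' v' h.mono := by
  obtain ⟨F, hF, hFZ, hZF⟩ := hz
  obtain ⟨⟨ψ, hψm⟩, hψu, hψ⟩ := hk
  obtain ⟨ψ', hψ', rfl⟩ := h.lift_mem hψm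
  obtain ⟨n, d, hd⟩ := det_kill' (cocZ S' v' h.mono) (cobB S' v' h.mono) F hF hFZ hZF
    (⟨x, h.xmem⟩ : S' ∅) ⟨ψ', hψ'⟩ (by
      intro z hz
      obtain ⟨b, hb, r, hr, e⟩ := h.coc_of_cob hS hv hc (z := (⟨ψ', hψ'⟩ : S' ∅) • z)
        (Submodule.smul_mem _ _ hz) (by
          have := hψ _ (h.map_coc hS hv hz)
          convert this using 1
          funext i
          simp [Subring.smul_def])
      exact ⟨b, hb, r, hr, e⟩)
  refine ⟨_, ?_, hd⟩
  have := h.unitpow hψ' hψu n d.2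
  simpa using this

include hc in
theorem lift_sec (ψ : S' ∅) (hψ : ∀ r ∈ cocZ S' v' h.mono, ψ • r ∈ cobB S' v' h.mono)
    {m : T} (hm : m ∈ secM S v hS) : ∃ m' ∈ secM S' v' h.mono, π m' = π ψ * m := by
  obtain ⟨m', rfl⟩ := h.surj m
  choose s hs hss using fun i => h.lift_mem (hm i)
  choose r hr using fun i => h.ker (m' - v' i * s i) (by
    simp only [map_sub, map_mul, hss, hv]
    have := (v i).mul_inv
    linear_combination -(π m') * this)
  obtain ⟨t, ht⟩ := hψ r (by
    apply h.sat_coc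
    intro i j
    have h1 : ((v' i)⁻¹ : T'ˣ) * (v' j : T') ∈ S' {i, j} := by
      have := hc j i
      rw [mul_comm, Finset.pair_comm]; exact this
    have h2 := h.mono (by simp : {i} ⊆ ({i, j} : Finset ι)) (hs i)
    have h3 := h.mono (by simp : {j} ⊆ ({i, j} : Finset ι)) (hs j)
    have h4 := (S' _).sub_mem ((S' _).mul_mem h1 h3) h2
    convert h4 using 1
    simp only [Pi.smul_apply, smul_eq_mul]
    rw [← hr, ← hr]
    have := (v' i).mul_inv
    linear_combination -s i * this)
  refine ⟨ψ * m' - x * t, fun i => ?_, by simp [h.pix]⟩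
  have h5 := (S' {i}).add_mem ((S' _).mul_mem (h.mono (empty_subset {i}) ψ.2) (hs i))
    ((S' {i}).mul_mem (h.xm {i}) (ht i))
  convert h5 using 1
  have := (v' i).mul_inv
  simp only [Pi.smul_apply, Subring.smul_def, smul_eq_mul]
  linear_combination ((v' i)⁻¹ : T'ˣ) * ψ * hr i + ψ * s i * this

include hc in
theorem gen' (hmfg : (secM S' v' h.mono).FG) (i : ι)
    (hk : ∃ ψ : S' ∅, UnitIn (S' {i}) (ψ : T') ∧ ∀ r ∈ cocZ S' v' h.mono, ψ • r ∈ cobB S' v' h.mono)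
    (hg : ∃ n ∈ secM S v hS, ∃ φ : S ∅, UnitIn (S {i}) (φ : T) ∧ UnitIn (S {i}) ((v i)⁻¹ * n) ∧
    ∀ y ∈ secM S v hS, ∃ b : S ∅, φ • y = b • n) :
    ∃ n ∈ secM S' v' h.mono, ∃ φ : S' ∅, UnitIn (S' {i}) (φ : T') ∧
      UnitIn (S' {i}) ((v' i)⁻¹ * n) ∧ ∀ y ∈ secM S' v' h.mono, ∃ b : S' ∅, φ • y = b • n := by
  obtain ⟨ψ, hψu, hψ⟩ := hk
  obtain ⟨n, hn, ⟨φ, hφm⟩, hφu, hnu, hgen⟩ := hg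
  obtain ⟨φ', hφ', rfl⟩ := h.lift_mem hφm
  obtain ⟨n', hn', hnn⟩ := h.lift_sec hS hv hc ψ hψ hn
  have hψ2 : UnitIn (S {i}) (π ψ) := by rw [h.map]; exact hψu.map π
  obtain ⟨k, d, hd⟩ := det_kill' (secM S' v' h.mono) (Submodule.span (S' ∅) {n'}) (secM S' v' h.mono)
    hmfg le_rfl le_sup_left (⟨x, h.xmem⟩ : S' ∅) (ψ * ⟨φ', hφ'⟩) (by
      intro y hy
      obtain ⟨⟨b, hb⟩, hbe⟩ := hgen _ (h.map_sec hS hv hy)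
      obtain ⟨b', hb', rfl⟩ := h.lift_mem hb
      obtain ⟨z, hz⟩ := h.ker (ψ * φ' * y - b' * n') (by
        have hbe : π φ' * π y = π b' * n := hbe
        simp only [map_sub, map_mul, hnn]
        linear_combination π ψ * hbe)
      refine ⟨(⟨b', hb'⟩ : S' ∅) • n', Submodule.smul_mem _ _ (Submodule.mem_span_singleton_self _),
        z, ?_, ?_⟩
      · apply h.sat_sec
        rw [← hz]
        exact Submodule.sub_mem _ (Submodule.smul_mem _ (ψ * ⟨φ', hφ'⟩) hy)
          (Submodule.smul_mem _ (⟨b', hb'⟩ : S' ∅) hn')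
      · simp only [Subring.smul_def, smul_eq_mul]
        push_cast
        linear_combination hz)
  refine ⟨n', hn', (ψ * ⟨φ', hφ'⟩) ^ k + ⟨x, h.xmem⟩ * d, ?_, ?_, fun y hy => ?_⟩
  · have := h.unitpow (i := i) (ψ * ⟨φ', hφ'⟩ : S' ∅).2 (by
      push_cast; rw [map_mul]; exact hψ2.mul hφu) k d.2
    convert this using 1
    simp
  · apply h.unitlift (hn' i)
    rw [map_mul, hvi hv, hnn, mul_left_comm]
    exact hψ2.mul hnu
  · obtain ⟨b, hb⟩ := Submodule.mem_span_singleton.1 (hd y hy)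
    exact ⟨b, hb.symm⟩

omit hv in
theorem main (v : ι → Tˣ) (hI : Inv S v hS) : ∃ v' : ι → T'ˣ, Inv S' v' h.mono ∧
    (Triv S' v' → Triv S v) := by
  obtain ⟨v', hv, hc⟩ := h.lift_v hI.p2 v hI.coc
  have hz := h.zfg' hS hv hc hI.noeth hI.zfg
  have hm := h.mfg' hS hv hI.noeth hI.mfg
  have hk := fun i => h.kill' hS hv hc hz i (hI.kill i)
  refine ⟨v', ⟨h.noeth hI.noeth, h.dom hI.dom, hc, h.p2' hI.p2, hm, hz, hk,
    fun i => h.gen' hS hv hc hm i (hk i) (hI.gen i)⟩, ?_⟩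
  rintro ⟨e, he⟩
  refine ⟨Units.map π.toMonoidHom e, fun i => ?_⟩
  have := (he i).map π
  rw [h.map]
  convert this using 1
  simp [hv]

end Step
end GrothUFD

namespace GrothUFD
open RingTheory.Sequence

universe u

theorem free_of_reg : ∀ (rs' : List ℕ) (D : Type u) [CommRing D] [IsLocalRing D] [IsNoetherianRing D]
    (X : Type u) [AddCommGroup X] [Module D X] [Module.Finite D X] (rs : List D),
    rs.length = rs'.length → Ideal.ofList rs = IsLocalRing.maximalIdeal D → IsWeaklyRegular X rs →
    Module.Free D X := by
  intro rs'
  induction rs' with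
  | nil =>
    intro D _ _ _ X _ _ _ rs hl hm _
    obtain rfl : rs = [] := List.length_eq_zero_iff.1 hl
    rw [Ideal.ofList_nil] at hm
    have hf : IsField D := IsLocalRing.isField_iff_maximalIdeal_eq.2 hm.symm
    let _ := hf.toField
    exact Module.Free.of_divisionRing D X
  | cons k rs' ih =>
    intro D _ _ _ X _ _ _ rs hl hm hw
    match rs, hl with
    | r :: rs, hl =>
      rw [isWeaklyRegular_cons_iff'] at hw
      have hr : r ∈ IsLocalRing.maximalIdeal D := by
        rw [← hm]; exact Ideal.subset_span (by simp)
      have : Nontrivial (D ⧸ Ideal.span {r}) := by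
        rw [Ideal.Quotient.nontrivial_iff]
        intro h
        apply (IsLocalRing.mem_maximalIdeal r).1 hr
        exact Ideal.span_singleton_eq_top.1 h
      have hsurj : Function.Surjective (Ideal.Quotient.mk (Ideal.span {r})) :=
        Ideal.Quotient.mk_surjective
      have : IsLocalRing (D ⧸ Ideal.span {r}) := IsLocalRing.of_surjective' _ hsurj
      have hfin : Module.Finite (D ⧸ Ideal.span {r}) (QuotSMulTop r X) :=
        Module.Finite.of_restrictScalars_finite D _ _
      have hfree := ih (D ⧸ Ideal.span {r}) (QuotSMulTop r X)
        (rs.map (Ideal.Quotient.mk (Ideal.span {r}))) (by simpa using hl) (by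
          rw [← Ideal.map_ofList]
          have h1 : (IsLocalRing.maximalIdeal D).map (Ideal.Quotient.mk (Ideal.span {r})) =
              IsLocalRing.maximalIdeal _ := by
            apply le_antisymm
            · rw [Ideal.map_le_iff_le_comap]
              have : (Ideal.comap (Ideal.Quotient.mk (Ideal.span {r}))
                (IsLocalRing.maximalIdeal (D ⧸ Ideal.span {r}))).IsMaximal :=
                Ideal.comap_isMaximal_of_surjective _ hsurj
              exact (IsLocalRing.eq_maximalIdeal this).ge
            · intro y hy
              obtain ⟨y, rfl⟩ := hsurj y
              apply Ideal.mem_map_of_mem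
              rw [IsLocalRing.mem_maximalIdeal, mem_nonunits_iff] at hy ⊢
              exact fun h => hy (h.map _)
          rw [← h1, ← hm, Ideal.ofList_cons, Ideal.map_sup]
          have : Ideal.map (Ideal.Quotient.mk (Ideal.span {r})) (Ideal.span {r}) = ⊥ := by
            rw [Ideal.map_eq_bot_iff_le_ker]; simp
          rw [this, bot_sup_eq]) hw.2
      have : Module.FinitePresentation D X := Module.finitePresentation_of_finite D X
      exact (Module.free_quotSMulTop_iff_free D X (by
        rw [IsLocalRing.jacobson_eq_maximalIdeal _ bot_ne_top]; exact hr) hw.1).1 hfree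

theorem reg_syz {D : Type u} [CommRing D] (rs : List D) (y : D) :
    ∀ (Y F X : Type u) [AddCommGroup Y] [Module D Y] [AddCommGroup F] [Module D F]
    [AddCommGroup X] [Module D X] (i : Y →ₗ[D] F) (p : F →ₗ[D] X), Function.Injective i →
    Function.Exact i p → Function.Surjective p → IsWeaklyRegular X rs →
    IsWeaklyRegular F (rs ++ [y]) → IsWeaklyRegular Y (rs ++ [y]) := by
  induction rs with
  | nil =>
    intro Y F X _ _ _ _ _ _ i p hi _ _ _ hF
    simp only [List.nil_append, isWeaklyRegular_singleton_iff] at hF ⊢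
    exact hF.of_injective i hi
  | cons r rs ih =>
    intro Y F X _ _ _ _ _ _ i p hi hex hp hX hF
    rw [List.cons_append, isWeaklyRegular_cons_iff] at hF ⊢
    rw [isWeaklyRegular_cons_iff] at hX
    refine ⟨hF.1.of_injective i hi, ?_⟩
    apply ih _ _ _ (QuotSMulTop.map r i) (QuotSMulTop.map r p) ?_ (QuotSMulTop.map_exact r hex hp)
      (QuotSMulTop.map_surjective r hp) hX.2 hF.2
    rw [injective_iff_map_eq_zero]
    intro z hz
    obtain ⟨z, rfl⟩ := Submodule.mkQ_surjective _ z
    have hz : (Submodule.Quotient.mk (i z) : QuotSMulTop r F) = 0 := hz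
    rw [Submodule.Quotient.mk_eq_zero] at hz
    obtain ⟨f, _, hf⟩ := hz
    have hf : r • f = i z := hf
    have hpf : p f = 0 := by
      apply hX.1
      change r • p f = r • (0 : X)
      rw [← map_smul, hf, smul_zero]
      exact hex.apply_apply_eq_zero z
    obtain ⟨w, rfl⟩ := (hex f).1 hpf
    have : r • w = z := hi (by rw [map_smul, hf])
    change (Submodule.Quotient.mk z : QuotSMulTop r Y) = 0
    rw [Submodule.Quotient.mk_eq_zero]
    exact ⟨w, trivial, this⟩

/-- finite free resolutions of length `n`. -/
def FFR (D : Type u) [CommRing D] : ℕ → (X : Type u) → [AddCommGroup X] → [Module D X] → Prop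
  | 0, X, _, _ => Module.Free D X
  | n + 1, X, _, _ => ∃ (m : ℕ) (f : (Fin m → D) →ₗ[D] X), Function.Surjective f ∧
      FFR D n (LinearMap.ker f)

theorem FFR.equiv {D : Type u} [CommRing D] {n : ℕ} {X Y : Type u} [AddCommGroup X] [Module D X]
    [AddCommGroup Y] [Module D Y] (e : X ≃ₗ[D] Y) (h : FFR D n X) : FFR D n Y := by
  cases n with
  | zero =>
    have : Module.Free D X := h
    exact Module.Free.of_equiv e
  | succ n =>
    obtain ⟨m, f, hf, hk⟩ := h
    refine ⟨m, e.toLinearMap ∘ₗ f, e.surjective.comp hf, ?_⟩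
    rw [LinearEquiv.ker_comp]
    exact hk

theorem ffr_aux (D : Type u) [CommRing D] [IsLocalRing D] [IsNoetherianRing D] (rs : List D)
    (hm : Ideal.ofList rs = IsLocalRing.maximalIdeal D) (hrs : IsWeaklyRegular D rs) :
    ∀ (n : ℕ) (hn : n ≤ rs.length) (X : Type u) [AddCommGroup X] [Module D X] [Module.Finite D X],
    IsWeaklyRegular X (rs.take (rs.length - n)) → FFR D n X := by
  intro n
  induction n with
  | zero =>
    intro _ X _ _ _ hX
    simp only [Nat.sub_zero, List.take_length] at hX
    exact free_of_reg (List.replicate rs.length 0) D X rs (by simp) hm hX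
  | succ n ih =>
    intro hn X _ _ _ hX
    obtain ⟨m, f, hf⟩ := Module.Finite.exists_fin' D X
    refine ⟨m, f, hf, ih (by omega) _ ?_⟩
    have e : rs.length - n = rs.length - (n + 1) + 1 := by omega
    rw [e, List.take_add_one, List.getElem?_eq_getElem (by omega)]
    refine reg_syz _ _ _ _ _ (LinearMap.ker f).subtype f (Submodule.subtype_injective _) ?_ hf hX ?_
    · rw [LinearMap.exact_iff]; simp
    · have h2 : IsWeaklyRegular D (rs.take (rs.length - (n + 1)) ++ [rs[rs.length - (n+1)]]) := by
        have : rs = (rs.take (rs.length - (n + 1)) ++ [rs[rs.length - (n+1)]]) ++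
          rs.drop (rs.length - (n + 1) + 1) := by
          simp
        rw [this, isWeaklyRegular_append_iff] at hrs
        exact hrs.1
      have h3 : IsWeaklyRegular (TensorProduct D (Fin m → D) D)
        (rs.take (rs.length - (n + 1)) ++ [rs[rs.length - (n+1)]]) := h2.isWeaklyRegular_lTensor
      exact ((TensorProduct.rid D (Fin m → D)).isWeaklyRegular_congr _).1 h3

theorem ffr_of_reg (D : Type u) [CommRing D] [IsLocalRing D] [IsNoetherianRing D] (rs : List D)
    (hm : Ideal.ofList rs = IsLocalRing.maximalIdeal D) (hrs : IsWeaklyRegular D rs)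
    (X : Type u) [AddCommGroup X] [Module D X] [Module.Finite D X] : ∃ n, FFR D n X :=
  ⟨rs.length, ffr_aux D rs hm hrs _ le_rfl X (by simp)⟩

end GrothUFD

namespace GrothUFD

universe u

section L1
variable {E : Type*} [Field E] {ι : Type*} [Fintype ι] [DecidableEq ι]

theorem det_ne_zero_of_span {b : ι → ι → E} (hb : Submodule.span E (Set.range b) = ⊤) :
    (Matrix.of b).det ≠ 0 := by
  have : ∀ i, ∃ q : ι → E, ∑ j, q j • b j = Pi.single i 1 := by
    intro i
    have h : (Pi.single i 1 : ι → E) ∈ Submodule.span E (Set.range b) := by rw [hb]; trivial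
    exact (Submodule.mem_span_range_iff_exists_fun E).1 h
  choose q hq using this
  have h : Matrix.of q * Matrix.of b = 1 := by
    ext i j
    have := congrFun (hq i) j
    simp only [Finset.sum_apply, Pi.smul_apply, smul_eq_mul] at this
    rw [Matrix.mul_apply]
    simp only [Matrix.of_apply]
    rw [this, Matrix.one_apply, Pi.single_apply]
    simp [eq_comm]
  intro h0
  have := congrArg Matrix.det h
  rw [Matrix.det_mul, h0, mul_zero, Matrix.det_one] at this
  exact zero_ne_one this

theorem det_factor (D' : Subring E) {b b' : ι → ι → E}
    (h : ∀ i, b' i ∈ Submodule.span D' (Set.range b)) :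
    ∃ d ∈ D', (Matrix.of b').det = d * (Matrix.of b).det := by
  have : ∀ i, ∃ q : ι → D', ∑ j, q j • b j = b' i := fun i =>
    (Submodule.mem_span_range_iff_exists_fun D').1 (h i)
  choose q hq using this
  refine ⟨((Matrix.of q).det : D'), SetLike.coe_mem _, ?_⟩
  have e : Matrix.of b' = (Matrix.of q).map D'.subtype * Matrix.of b := by
    ext i j
    have := congrFun (hq i) j
    simp only [Finset.sum_apply, Pi.smul_apply] at this
    rw [Matrix.mul_apply]
    simp only [Matrix.of_apply, Matrix.map_apply]
    exact this.symm
  rw [e, Matrix.det_mul]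
  congr 1
  exact (RingHom.map_det D'.subtype (Matrix.of q)).symm

theorem det_unit (D' : Subring E) {b b' : ι → ι → E}
    (hbb : Submodule.span D' (Set.range b) = Submodule.span D' (Set.range b'))
    (hb : Submodule.span E (Set.range b) = ⊤) :
    ∃ u, UnitIn D' u ∧ (Matrix.of b').det = u * (Matrix.of b).det := by
  obtain ⟨d, hd, e⟩ := det_factor D' (b := b) (b' := b') (fun i => by
    rw [hbb]; exact Submodule.subset_span ⟨i, rfl⟩)
  obtain ⟨d', hd', e'⟩ := det_factor D' (b := b') (b' := b) (fun i => by
    rw [← hbb]; exact Submodule.subset_span ⟨i, rfl⟩)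
  refine ⟨d, ⟨hd, d', hd', ?_⟩, e⟩
  have := det_ne_zero_of_span hb
  rw [e, ← mul_assoc] at e'
  have h1 : (1 - d' * d) * (Matrix.of b).det = 0 := by linear_combination e'
  have := (mul_eq_zero.1 h1).resolve_right this
  linear_combination -this
end L1

variable {D : Type u} [CommRing D] [IsDomain D] {E : Type u} [Field E] [Algebra D E] [IsFractionRing D E]

variable (D) in
/-- local subrings of the fraction field that are localizations -/
structure Nice (D' : Subring E) : Prop where
  loc : IsLocalRing D'
  mem : ∀ d : D, algebraMap D E d ∈ D'
  frac : ∀ t ∈ D', ∃ s : D, s ≠ 0 ∧ (algebraMap D E s)⁻¹ ∈ D' ∧ ∃ a : D, algebraMap D E s * t = algebraMap D E a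

omit [IsDomain D] [IsFractionRing D E] in
theorem span_le_of_nice {D' : Subring E} (hD : ∀ d : D, algebraMap D E d ∈ D') {V : Type*} [AddCommGroup V] [Module E V]
    [Module D V] [IsScalarTower D E V] (s : Set V) {x : V} (hx : x ∈ Submodule.span D s) :
    x ∈ Submodule.span D' s := by
  induction hx using Submodule.span_induction with
  | mem x h => exact Submodule.subset_span h
  | zero => exact Submodule.zero_mem _
  | add x y _ _ hx hy => exact Submodule.add_mem _ hx hy
  | smul a x _ hx =>
    have : a • x = (⟨algebraMap D E a, hD a⟩ : D') • x := by
      rw [Subring.smul_def]; simp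
    rw [this]; exact Submodule.smul_mem _ _ hx

omit [IsDomain D] [IsFractionRing D E] in
theorem span_span_nice {D' : Subring E} (hD : ∀ d : D, algebraMap D E d ∈ D') {V : Type*} [AddCommGroup V] [Module E V]
    [Module D V] [IsScalarTower D E V] (s : Set V) :
    Submodule.span D' (Submodule.span D s : Set V) = Submodule.span D' s := by
  apply le_antisymm
  · rw [Submodule.span_le]
    intro x hx
    exact span_le_of_nice hD s hx
  · exact Submodule.span_mono Submodule.subset_span

/-- conclusion of the determinant lemma -/
def HasDelta (D : Type u) [CommRing D] {E : Type u} [Field E] [Algebra D E] {ι : Type} [Fintype ι] [DecidableEq ι]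
    (X : Submodule D (ι → E)) : Prop :=
  ∃ δ : E, δ ≠ 0 ∧ ∀ D' : Subring E, Nice D D' → ∀ b : ι → ι → E,
    Submodule.span D' (X : Set (ι → E)) = Submodule.span D' (Set.range b) →
    ∃ u, UnitIn D' u ∧ (Matrix.of b).det = u * δ

theorem delta_zero {r : ℕ} (X : Submodule D (Fin r → E)) (hX : Module.Free D X)
    (hs : Submodule.span E (X : Set (Fin r → E)) = ⊤) : HasDelta D X := by
  let c := Module.Free.chooseBasis D X
  let I := Module.Free.ChooseBasisIndex D X
  let c' : I → (Fin r → E) := fun i => (c i : Fin r → E)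
  have hli : LinearIndependent E c' := by
    rw [← LinearIndependent.iff_fractionRing D E]
    exact c.linearIndependent.map' X.subtype (by simp)
  have hXs : X = Submodule.span D (Set.range c') := by
    have := congrArg (Submodule.map X.subtype) c.span_eq
    rw [Submodule.map_span, Submodule.map_top, Submodule.range_subtype, ← Set.range_comp] at this
    exact this.symm
  have hsp : ⊤ ≤ Submodule.span E (Set.range c') := by
    rw [← hs, Submodule.span_le]
    intro x hx
    have hx : x ∈ X := hx
    rw [hXs] at hx
    exact Submodule.span_le_restrictScalars D E _ hx
  let B := Module.Basis.mk hli hsp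
  let e : I ≃ Fin r := B.indexEquiv (Pi.basisFun E (Fin r))
  let b₀ : Fin r → Fin r → E := fun i => c' (e.symm i)
  have hr : Set.range b₀ = Set.range c' := e.symm.surjective.range_comp c'
  refine ⟨(Matrix.of b₀).det, det_ne_zero_of_span (by rw [hr]; exact top_le_iff.1 hsp), ?_⟩
  intro D' hD' b hb
  apply det_unit D' _ (by rw [hr]; exact top_le_iff.1 hsp)
  rw [← hb, hr, hXs]
  exact (span_span_nice hD'.mem _).symm

end GrothUFD

namespace GrothUFD

universe u
variable {D : Type u} [CommRing D] [IsDomain D] {E : Type u} [Field E] [Algebra D E] [IsFractionRing D E]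

theorem nice_top : Nice D (⊤ : Subring E) where
  loc := by
    have : IsLocalRing E := inferInstance
    exact IsLocalRing.of_surjective' (Subring.topEquiv (R := E)).symm.toRingHom
      (Subring.topEquiv (R := E)).symm.surjective
  mem := fun _ => trivial
  frac := fun t _ => by
    obtain ⟨a, s, hs, h⟩ := IsFractionRing.div_surjective (A := D) t
    have hs0 : s ≠ 0 := nonZeroDivisors.ne_zero hs
    have : algebraMap D E s ≠ 0 := by simpa using hs0
    exact ⟨s, hs0, trivial, a, by rw [← h]; field_simp⟩

theorem nice_tuple {D' : Subring E} (hD : Nice D D') {m : ℕ} (κ : Fin m → E) (h : ∀ j, κ j ∈ D') :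
    ∃ s : D, s ≠ 0 ∧ (algebraMap D E s)⁻¹ ∈ D' ∧ ∃ y : Fin m → D, ∀ j, algebraMap D E s * κ j = algebraMap D E (y j) := by
  choose s hs0 hs a ha using fun j => hD.frac (κ j) (h j)
  refine ⟨∏ j, s j, Finset.prod_ne_zero_iff.2 fun j _ => hs0 j, ?_, fun j => (∏ i ∈ Finset.univ.erase j, s i) * a j, ?_⟩
  · rw [map_prod, ← Finset.prod_inv_distrib]
    exact Subring.prod_mem _ fun j _ => hs j
  · intro j
    rw [← Finset.prod_erase_mul _ _ (Finset.mem_univ j), map_mul, map_mul, mul_assoc, ha]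

/-- coordinatewise inclusion -/
def coeV (D' : Subring E) (m : ℕ) : (Fin m → D') →ₗ[D'] (Fin m → E) where
  toFun y j := y j
  map_add' _ _ := by ext; simp
  map_smul' _ _ := by ext; simp [Subring.smul_def]

theorem range_coeV (D' : Subring E) (m : ℕ) : LinearMap.range (coeV D' m) =
    Submodule.span D' (Set.range fun j : Fin m => (Pi.single j 1 : Fin m → E)) := by
  have h1 : (⊤ : Submodule D' (Fin m → D')) = Submodule.span D' (Set.range (Pi.basisFun D' (Fin m))) :=
    (Module.Basis.span_eq _).symm
  rw [LinearMap.range_eq_map, h1, Submodule.map_span, ← Set.range_comp]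
  congr 2
  ext j l
  simp only [Function.comp, Pi.basisFun_apply, coeV, LinearMap.coe_mk, AddHom.coe_mk, Pi.single_apply]
  split_ifs <;> simp

theorem delta_succ {r m : ℕ} (X : Submodule D (Fin r → E)) 
    (hs : Submodule.span E (X : Set (Fin r → E)) = ⊤) (f : (Fin m → D) →ₗ[D] X)
    (hf : Function.Surjective f)
    (ih : ∀ (k : ℕ) (Y : Submodule D (Fin k → E)) (_ : Y ≃ₗ[D] LinearMap.ker f),
       Submodule.span E (Y : Set (Fin k → E)) = ⊤ → HasDelta D Y) : HasDelta D X := by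
  let w : Fin m → Fin r → E := fun j => (f (Pi.single j 1) : Fin r → E)
  let fE : (Fin m → E) →ₗ[E] (Fin r → E) := Fintype.linearCombination E w
  have hfEw : ∀ j, fE (Pi.single j 1) = w j := fun j => by
    simp only [fE]; rw [Fintype.linearCombination_apply_single, one_smul]
  let ιD : (Fin m → D) →ₗ[D] (Fin m → E) := LinearMap.pi fun j => (Algebra.linearMap D E) ∘ₗ LinearMap.proj j
  have hι : ∀ y j, ιD y j = algebraMap D E (y j) := fun _ _ => rfl
  have hιinj : Function.Injective ιD := fun y z h => by
    ext j
    exact IsFractionRing.injective D E (congrFun h j)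
  have hfι : ∀ y, fE (ιD y) = (f y : Fin r → E) := by
    intro y
    have : X.subtype ∘ₗ f = fE.restrictScalars D ∘ₗ ιD := by
      apply LinearMap.pi_ext'
      intro j
      apply LinearMap.ext_ring
      have e1 : ιD (Pi.single j 1) = Pi.single j 1 := by
        ext l
        rw [hι, Pi.single_apply, Pi.single_apply]
        split_ifs <;> simp
      change (f (Pi.single j 1) : Fin r → E) = fE (ιD (Pi.single j 1))
      rw [e1, hfEw]
    exact (LinearMap.congr_fun this y).symm
  have hXw : X = Submodule.span D (Set.range w) := by
    have h1 : (⊤ : Submodule D (Fin m → D)) = Submodule.span D (Set.range (Pi.basisFun D (Fin m))) :=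
      (Module.Basis.span_eq _).symm
    have h2 : X = LinearMap.range (X.subtype ∘ₗ f) := by
      rw [LinearMap.range_comp, LinearMap.range_eq_top.2 hf, Submodule.map_top, Submodule.range_subtype]
    conv_lhs => rw [h2]
    rw [LinearMap.range_eq_map, h1, Submodule.map_span, ← Set.range_comp]
    congr 2
    ext j
    simp [w]
  have hfEs : LinearMap.range fE = ⊤ := by
    rw [← top_le_iff, ← hs, Submodule.span_le]
    intro x hx
    obtain ⟨y, hy⟩ := hf ⟨x, hx⟩
    exact ⟨ιD y, by rw [hfι, hy]⟩
  let K := LinearMap.ker fE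
  let k := Module.finrank E K
  let eK : K ≃ₗ[E] (Fin k → E) := (Module.finBasis E K).equivFun
  obtain ⟨q, hq⟩ := LinearMap.exists_leftInverse_of_injective K.subtype (by simp)
  let p : (Fin m → E) →ₗ[E] (Fin k → E) := eK.toLinearMap ∘ₗ q
  have hpK : ∀ κ : K, p κ = eK κ := fun κ => by
    have := LinearMap.congr_fun hq κ
    simp only [LinearMap.comp_apply, Submodule.subtype_apply, LinearMap.id_apply] at this
    simp [p, this]
  have hkr : r + k = m := by
    have := LinearMap.finrank_range_add_finrank_ker fE
    rw [hfEs] at this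
    simpa using this
  -- the D-module
  let pD : LinearMap.ker f →ₗ[D] (Fin k → E) := p.restrictScalars D ∘ₗ ιD ∘ₗ (LinearMap.ker f).subtype
  have hpD : ∀ y, pD y = p (ιD y) := fun _ => rfl
  have hkerK : ∀ y : LinearMap.ker f, ιD y ∈ K := fun y => by
    rw [LinearMap.mem_ker, hfι, LinearMap.mem_ker.1 y.2]; rfl
  have hpDinj : Function.Injective pD := fun y z h => by
    rw [hpD, hpD, hpK ⟨_, hkerK y⟩, hpK ⟨_, hkerK z⟩] at h
    have := eK.injective h
    exact Subtype.ext (hιinj (congrArg Subtype.val this))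
  let Xk := LinearMap.range pD
  have hXk : ∀ D' : Subring E, Nice D D' → ∀ κ ∈ K, (∀ j, κ j ∈ D') →
      p κ ∈ Submodule.span D' (Xk : Set (Fin k → E)) := by
    intro D' hD' κ hκ hκD
    obtain ⟨s, hs0, hsi, y, hy⟩ := nice_tuple hD' κ hκD
    have hs1 : algebraMap D E s ≠ 0 := by simpa using hs0
    have e1 : algebraMap D E s • κ = ιD y := by
      ext j; simp [hι, hy]
    have hy0 : y ∈ LinearMap.ker f := by
      rw [LinearMap.mem_ker, ← Submodule.coe_eq_zero, ← hfι, ← e1, map_smul, LinearMap.mem_ker.1 hκ, smul_zero]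
    have e2 : p κ = (⟨(algebraMap D E s)⁻¹, hsi⟩ : D') • pD ⟨y, hy0⟩ := by
      rw [hpD, ← e1, Subring.smul_def, map_smul, smul_smul]
      simp [hs1]
    rw [e2]
    exact Submodule.smul_mem _ _ (Submodule.subset_span ⟨_, rfl⟩)
  have hXktop : Submodule.span E (Xk : Set (Fin k → E)) = ⊤ := by
    rw [← top_le_iff]
    intro z _
    have := hXk ⊤ nice_top (eK.symm z) (eK.symm z).2 (fun _ => trivial)
    rw [hpK, eK.apply_symm_apply] at this
    exact Submodule.span_le_restrictScalars (⊤ : Subring E) E _ this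
  obtain ⟨δ', hδ', H⟩ := ih k Xk (LinearEquiv.ofInjective pD hpDinj).symm hXktop
  -- the big map
  let Θ : (Fin m → E) →ₗ[E] (Fin k ⊕ Fin r → E) :=
    (LinearEquiv.sumArrowLequivProdArrow (Fin k) (Fin r) E E).symm.toLinearMap ∘ₗ p.prod fE
  have hΘl : ∀ y i, Θ y (Sum.inl i) = p y i := fun _ _ => rfl
  have hΘr : ∀ y i, Θ y (Sum.inr i) = fE y i := fun _ _ => rfl
  have hΘs : LinearMap.range Θ = ⊤ := by
    rw [LinearMap.range_eq_top]
    intro z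
    obtain ⟨y, hy⟩ := LinearMap.range_eq_top.1 hfEs (fun i => z (Sum.inr i))
    refine ⟨y + (eK.symm ((fun i => z (Sum.inl i)) - p y) : K), ?_⟩
    ext (i | i)
    · rw [hΘl, map_add, hpK, eK.apply_symm_apply]; simp
    · rw [hΘr, map_add, hy, LinearMap.mem_ker.1 (Subtype.prop _)]; simp
  let ε : Fin k ⊕ Fin r ≃ Fin m := finSumFinEquiv.trans (finCongr (by omega))
  let st : Fin k ⊕ Fin r → (Fin m → E) := fun l => Pi.single (ε l) 1
  have hst : Set.range st = Set.range fun j : Fin m => (Pi.single j 1 : Fin m → E) :=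
    ε.surjective.range_comp fun j : Fin m => (Pi.single j 1 : Fin m → E)
  have hΘst : Submodule.span E (Set.range (Θ ∘ st)) = ⊤ := by
    rw [Set.range_comp, ← Submodule.map_span, hst, ← hΘs, LinearMap.range_eq_map]
    congr 1
    have := (Pi.basisFun E (Fin m)).span_eq
    convert this using 3
    ext j; simp
  have hθ := det_ne_zero_of_span hΘst
  refine ⟨(Matrix.of (Θ ∘ st)).det / δ', div_ne_zero hθ hδ', ?_⟩
  intro D' hD' b hb
  have := hD'.loc
  have hXb : ∀ x ∈ X, x ∈ Submodule.span D' (Set.range b) := by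
    intro x hx
    have : x ∈ Submodule.span D' (X : Set (Fin r → E)) := Submodule.subset_span hx
    rw [hb] at this
    exact this
  have hbE : ⊤ ≤ Submodule.span E (Set.range b) := by
    rw [← hs, Submodule.span_le]
    intro x hx
    exact Submodule.span_le_restrictScalars D' E _ (hXb x hx)
  have hbli : LinearIndependent E b := linearIndependent_of_top_le_span_of_card_eq_finrank hbE (by simp)
  have hbli' : LinearIndependent D' b := hbli.restrict_scalars (by
    intro x y h
    have : (x : E) * 1 = y * 1 := h
    simpa using this)
  let fD : (Fin m → D') →ₗ[D'] (Fin r → E) := fE.restrictScalars D' ∘ₗ coeV D' m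
  have hfD : ∀ y, fD y = fE (coeV D' m y) := fun _ => rfl
  have hrange : LinearMap.range fD = Submodule.span D' (Set.range b) := by
    rw [← hb, LinearMap.range_comp, range_coeV, Submodule.map_span, ← Set.range_comp, hXw,
      span_span_nice hD'.mem]
    congr 2
    ext1 j
    exact hfEw j
  let B : Module.Basis (Fin r) D' (LinearMap.range fD) :=
    (Module.Basis.span hbli').map (LinearEquiv.ofEq _ _ hrange.symm)
  have hB : ∀ i, (B i : Fin r → E) = b i := by
    intro i
    simp [B, Module.Basis.span_apply]
  have : Module.Free D' (LinearMap.range fD) := Module.Free.of_basis B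
  obtain ⟨s, hs'⟩ := Module.projective_lifting_property fD.rangeRestrict LinearMap.id fD.surjective_rangeRestrict
  have hs' : ∀ z, fD.rangeRestrict (s z) = z := fun z => LinearMap.congr_fun hs' z
  have hfs : ∀ z, fD (s z) = z := fun z => congrArg Subtype.val (hs' z)
  let ρ : (Fin m → D') →ₗ[D'] LinearMap.ker fD := (LinearMap.id - s ∘ₗ fD.rangeRestrict).codRestrict _ (by
    intro z
    rw [LinearMap.mem_ker]
    simp [hfs])
  have hρ : ρ ∘ₗ (LinearMap.ker fD).subtype = LinearMap.id := by
    ext1 z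
    apply Subtype.ext
    have : fD.rangeRestrict z = 0 := Subtype.ext (LinearMap.mem_ker.1 z.2)
    simp [ρ, this]
  have : Module.Projective D' (LinearMap.ker fD) := Module.Projective.of_split _ ρ hρ
  have : Module.Finite D' (LinearMap.ker fD) := Module.Finite.of_surjective ρ (fun z => ⟨z, LinearMap.congr_fun hρ z⟩)
  have : Module.Free D' (LinearMap.ker fD) := Module.free_of_flat_of_isLocalRing
  have hk : Module.finrank D' (LinearMap.ker fD) = k := by
    have := (LinearMap.ker fD).finrank_quotient_add_finrank
    rw [fD.quotKerEquivRange.finrank_eq, Module.finrank_eq_card_basis B] at this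
    simp at this
    omega
  let bY := Module.finBasisOfFinrankEq D' (LinearMap.ker fD) hk
  let c : Fin k ⊕ Fin r → (Fin m → D') := Sum.elim (fun i => (bY i : Fin m → D')) (fun i => s (B i))
  have hc : Submodule.span D' (Set.range c) = ⊤ := by
    rw [← top_le_iff]
    intro z _
    have e : z = (ρ z : Fin m → D') + s (fD.rangeRestrict z) := by simp [ρ]
    rw [e]
    apply Submodule.add_mem
    · have h1 : ρ z ∈ Submodule.span D' (Set.range bY) := by rw [bY.span_eq]; trivial
      have h2 := Submodule.mem_map_of_mem (f := (LinearMap.ker fD).subtype) h1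
      rw [Submodule.map_span, ← Set.range_comp] at h2
      refine Submodule.span_mono ?_ h2
      rintro _ ⟨i, rfl⟩
      exact ⟨Sum.inl i, rfl⟩
    · have h1 : fD.rangeRestrict z ∈ Submodule.span D' (Set.range B) := by rw [B.span_eq]; trivial
      have h2 := Submodule.mem_map_of_mem (f := s) h1
      rw [Submodule.map_span, ← Set.range_comp] at h2
      refine Submodule.span_mono ?_ h2
      rintro _ ⟨i, rfl⟩
      exact ⟨Sum.inr i, rfl⟩
  have hcst : Submodule.span D' (Set.range (Θ ∘ st)) = Submodule.span D' (Set.range (Θ ∘ coeV D' m ∘ c)) := by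
    have h1 : Submodule.span D' (Set.range (coeV D' m ∘ c)) = LinearMap.range (coeV D' m) := by
      rw [Set.range_comp, ← Submodule.map_span, hc, Submodule.map_top]
    have h2 := congrArg (Submodule.map (Θ.restrictScalars D')) (h1.trans (range_coeV D' m))
    rw [← hst, Submodule.map_span, Submodule.map_span, ← Set.range_comp, ← Set.range_comp] at h2
    exact h2.symm
  obtain ⟨u, hu, hdet⟩ := det_unit D' hcst hΘst
  let bk : Fin k → Fin k → E := fun i => p (coeV D' m (bY i))
  have hblock : Matrix.of (Θ ∘ coeV D' m ∘ c) = Matrix.fromBlocks (Matrix.of bk) 0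
      (Matrix.of fun i => p (coeV D' m (s (B i)))) (Matrix.of b) := by
    ext (i | i) (j | j)
    · rfl
    · have : fD (bY i) = 0 := LinearMap.mem_ker.1 (bY i).2
      simp only [Matrix.of_apply, Function.comp, Matrix.fromBlocks_apply₁₂, c, Sum.elim_inl, hΘr, ← hfD, this]
      rfl
    · rfl
    · simp only [Matrix.of_apply, Function.comp, Matrix.fromBlocks_apply₂₂, c, Sum.elim_inr, hΘr, ← hfD, hfs, hB]
  rw [hblock, Matrix.det_fromBlocks_zero₁₂] at hdet
  have hspan : Submodule.span D' (Xk : Set (Fin k → E)) = Submodule.span D' (Set.range bk) := by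
    have h3 : ∀ κ ∈ K, (∀ j, κ j ∈ D') → p κ ∈ Submodule.span D' (Set.range bk) := by
      intro κ hκ hκD
      let z : Fin m → D' := fun j => ⟨κ j, hκD j⟩
      have hz : z ∈ LinearMap.ker fD := LinearMap.mem_ker.2 (LinearMap.mem_ker.1 hκ)
      have h1 : (⟨z, hz⟩ : LinearMap.ker fD) ∈ Submodule.span D' (Set.range bY) := by rw [bY.span_eq]; trivial
      have h2 := Submodule.mem_map_of_mem (f := p.restrictScalars D' ∘ₗ coeV D' m ∘ₗ (LinearMap.ker fD).subtype) h1
      rw [Submodule.map_span, ← Set.range_comp] at h2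
      exact h2
    apply le_antisymm
    · rw [Submodule.span_le]
      rintro _ ⟨y, rfl⟩
      exact h3 _ (hkerK y) (fun j => hD'.mem _)
    · rw [Submodule.span_le]
      rintro _ ⟨i, rfl⟩
      exact hXk D' hD' _ (LinearMap.mem_ker.2 (LinearMap.mem_ker.1 (bY i).2)) (fun j => Subtype.prop _)
  obtain ⟨u', ⟨hu', u'', hu'', huu⟩, hdet'⟩ := H D' hD' bk hspan
  refine ⟨u * u'', hu.mul ⟨hu'', u', hu', by rw [mul_comm, huu]⟩, ?_⟩
  rw [hdet'] at hdet
  field_simp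
  linear_combination (-(Matrix.of b).det * δ') * huu + u'' * hdet

theorem delta_of_ffr : ∀ (n r : ℕ) (X : Submodule D (Fin r → E)), FFR D n X →
    Submodule.span E (X : Set (Fin r → E)) = ⊤ → HasDelta D X := by
  intro n
  induction n with
  | zero => intro r X h hs; exact delta_zero X h hs
  | succ n ih =>
    intro r X h hs
    obtain ⟨m, f, hf, hk⟩ := h
    exact delta_succ X hs f hf fun k Y e hY => ih k Y (hk.equiv e.symm) hY

end GrothUFD

namespace GrothUFD
open RingTheory.Sequence
universe u

section
variable {D : Type u} [CommRing D] [IsDomain D] {E : Type u} [Field E] [Algebra D E] [IsFractionRing D E]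

variable (E) in
/-- localization at a prime, inside the fraction field -/
def locAt (p : Ideal D) [p.IsPrime] : Subring E where
  carrier := {t | ∃ s ∉ p, ∃ a, algebraMap D E s * t = algebraMap D E a}
  mul_mem' := by
    rintro t t' ⟨s, hs, a, h⟩ ⟨s', hs', a', h'⟩
    refine ⟨s * s', fun hh => (Ideal.IsPrime.mem_or_mem ‹_› hh).elim hs hs', a * a', ?_⟩
    rw [map_mul, map_mul, ← h, ← h']; ring
  one_mem' := ⟨1, fun h => Ideal.IsPrime.ne_top ‹_› ((Ideal.eq_top_iff_one _).2 h), 1, by simp⟩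
  add_mem' := by
    rintro t t' ⟨s, hs, a, h⟩ ⟨s', hs', a', h'⟩
    refine ⟨s * s', fun hh => (Ideal.IsPrime.mem_or_mem ‹_› hh).elim hs hs', s' * a + s * a', ?_⟩
    rw [map_add, map_mul, map_mul, map_mul, ← h, ← h']; ring
  zero_mem' := ⟨1, fun h => Ideal.IsPrime.ne_top ‹_› ((Ideal.eq_top_iff_one _).2 h), 0, by simp⟩
  neg_mem' := by
    rintro t ⟨s, hs, a, h⟩
    exact ⟨s, hs, -a, by rw [map_neg, ← h]; ring⟩

theorem mem_locAt_inv (p : Ideal D) [p.IsPrime] {s : D} (hs : s ∉ p) : (algebraMap D E s)⁻¹ ∈ locAt E p := by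
  have : algebraMap D E s ≠ 0 := by
    simp only [ne_eq, FaithfulSMul.algebraMap_eq_zero_iff]
    rintro rfl; exact hs p.zero_mem
  exact ⟨s, hs, 1, by simp [this]⟩

theorem nice_locAt (p : Ideal D) [p.IsPrime] : Nice D (locAt E p) where
  loc := by
    apply IsLocalRing.of_isUnit_or_isUnit_one_sub_self
    rintro ⟨t, s, hs, a, h⟩
    have hs0 : algebraMap D E s ≠ 0 := by
      simp only [ne_eq, FaithfulSMul.algebraMap_eq_zero_iff]
      rintro rfl; exact hs p.zero_mem
    by_cases ha : a ∈ p
    · right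
      have hsa : s - a ∉ p := fun hh => hs (by simpa using p.add_mem hh ha)
      have : algebraMap D E (s - a) ≠ 0 := by
        simp only [ne_eq, FaithfulSMul.algebraMap_eq_zero_iff]
        intro h0; rw [h0] at hsa; exact hsa p.zero_mem
      refine IsUnit.of_mul_eq_one ⟨algebraMap D E s / algebraMap D E (s - a), s - a, hsa, s, by field_simp⟩ ?_
      apply Subtype.ext
      change (1 - t) * (algebraMap D E s / algebraMap D E (s - a)) = 1
      rw [← mul_div_assoc, div_eq_one_iff_eq this, map_sub, ← h]; ring
    · left
      have : algebraMap D E a ≠ 0 := by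
        simp only [ne_eq, FaithfulSMul.algebraMap_eq_zero_iff]
        rintro rfl; exact ha p.zero_mem
      refine IsUnit.of_mul_eq_one ⟨algebraMap D E s / algebraMap D E a, a, ha, s, by field_simp⟩ ?_
      apply Subtype.ext
      change t * (algebraMap D E s / algebraMap D E a) = 1
      rw [← mul_div_assoc, div_eq_one_iff_eq this, ← h]; ring
  mem d := ⟨1, fun h => Ideal.IsPrime.ne_top ‹_› ((Ideal.eq_top_iff_one _).2 h), d, by simp⟩
  frac := by
    rintro t ⟨s, hs, a, h⟩
    exact ⟨s, by rintro rfl; exact hs p.zero_mem, mem_locAt_inv p hs, a, h⟩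

/-- consequence of the determinant lemma for ideals -/
theorem ideal_delta [IsNoetherianRing D] [IsLocalRing D] (rs : List D)
    (hm : Ideal.ofList rs = IsLocalRing.maximalIdeal D) (hrs : IsWeaklyRegular D rs)
    (I : Ideal D) (hI : I ≠ ⊥) : ∃ δ : E, δ ≠ 0 ∧ ∀ φ ν : D, ν ∈ I → (∀ b ∈ I, ∃ b', φ * b = b' * ν) →
      ∃ (k : ℕ) (b b' : D), algebraMap D E (φ ^ k) * δ = algebraMap D E (b * ν) ∧
        algebraMap D E (φ ^ k * ν) = algebraMap D E b' * δ := by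
  let L : D →ₗ[D] (Fin 1 → E) := LinearMap.pi fun _ => Algebra.linearMap D E
  let X : Submodule D (Fin 1 → E) := Submodule.map L I
  have : Module.Finite D X := Module.Finite.iff_fg.2 ((IsNoetherian.noetherian I).map L)
  obtain ⟨n, hn⟩ := ffr_of_reg D rs hm hrs X
  have hs : Submodule.span E (X : Set (Fin 1 → E)) = ⊤ := by
    obtain ⟨a, ha, ha0⟩ := Submodule.exists_mem_ne_zero_of_ne_bot hI
    have ha1 : algebraMap D E a ≠ 0 := by simpa using ha0
    rw [← top_le_iff]
    intro w _
    have : w = (w 0 / algebraMap D E a) • L a := by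
      ext j
      rw [Subsingleton.elim j 0]
      simp [L, ha1]
    rw [this]
    exact Submodule.smul_mem _ _ (Submodule.subset_span ⟨a, ha, rfl⟩)
  obtain ⟨δ, hδ, H⟩ := delta_of_ffr n 1 X hn hs
  refine ⟨δ, hδ, fun φ ν hν hφ => ?_⟩
  let 𝔞 : Ideal D :=
    { carrier := {s | (∃ b : D, algebraMap D E s * δ = algebraMap D E (b * ν)) ∧
        ∃ b' : D, algebraMap D E (s * ν) = algebraMap D E b' * δ}
      zero_mem' := ⟨⟨0, by simp⟩, ⟨0, by simp⟩⟩
      add_mem' := by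
        rintro s t ⟨⟨a, ha⟩, ⟨b, hb⟩⟩ ⟨⟨a', ha'⟩, ⟨b', hb'⟩⟩
        exact ⟨⟨a + a', by rw [map_add, add_mul, ha, ha', ← map_add]; ring_nf⟩,
          ⟨b + b', by rw [add_mul, map_add, hb, hb', map_add, add_mul]⟩⟩
      smul_mem' := by
        rintro c s ⟨⟨a, ha⟩, ⟨b, hb⟩⟩
        exact ⟨⟨c * a, by rw [smul_eq_mul, map_mul, mul_assoc, ha, ← map_mul]; ring_nf⟩,
          ⟨c * b, by rw [smul_eq_mul, mul_assoc, map_mul, hb, map_mul, mul_assoc]⟩⟩ }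
  have hrad : φ ∈ 𝔞.radical := by
    rw [Ideal.radical_eq_sInf, Ideal.mem_sInf]
    rintro p ⟨hp, hpp⟩
    by_contra hφp
    have hφ0 : algebraMap D E φ ≠ 0 := by
      simp only [ne_eq, FaithfulSMul.algebraMap_eq_zero_iff]
      rintro rfl; exact hφp p.zero_mem
    obtain ⟨u, ⟨hu, u', hu', huu⟩, hdet⟩ := H (locAt E p) (nice_locAt p) (fun _ => L ν) (by
      apply le_antisymm
      · rw [Submodule.span_le]
        rintro _ ⟨b, hb, rfl⟩
        obtain ⟨b', hb'⟩ := hφ b hb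
        have : L b = (⟨_, (locAt E p).mul_mem (mem_locAt_inv p hφp) ((nice_locAt p).mem b')⟩ : locAt E p) • L ν := by
          ext j
          have := congrArg (algebraMap D E) hb'
          rw [map_mul, map_mul] at this
          change algebraMap D E b = (algebraMap D E φ)⁻¹ * algebraMap D E b' * algebraMap D E ν
          rw [mul_assoc, ← this]; field_simp
        rw [SetLike.mem_coe, this]
        exact Submodule.smul_mem _ _ (Submodule.subset_span ⟨0, rfl⟩)
      · apply Submodule.span_mono
        rintro _ ⟨_, rfl⟩
        exact ⟨ν, hν, rfl⟩)
    have hdet : algebraMap D E ν = u * δ := by simpa [L] using hdet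
    obtain ⟨s, hs, a, ha⟩ := hu
    obtain ⟨s', hs', a', ha'⟩ := hu'
    have : s * s' ∈ 𝔞 := by
      refine ⟨⟨s * a', ?_⟩, ⟨s' * a, ?_⟩⟩
      · simp only [map_mul]; rw [hdet, ← ha']; linear_combination (-algebraMap D E s * algebraMap D E s' * δ) * huu
      · simp only [map_mul]; rw [hdet, ← ha]; ring
    exact (hpp.mem_or_mem (hp this)).elim hs hs'
  obtain ⟨k, ⟨b, hb⟩, ⟨b', hb'⟩⟩ := hrad
  exact ⟨k, b, b', hb, hb'⟩
end

theorem top_triv {ι : Type*} [Fintype ι] [DecidableEq ι] {T : Type u} [CommRing T]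
    (S : Finset ι → Subring T) (hS : Monotone S) (v : ι → Tˣ) (hI : Inv S v hS) [IsLocalRing (S ∅)]
    (rs : List (S ∅)) (hm : Ideal.ofList rs = IsLocalRing.maximalIdeal (S ∅))
    (hrs : IsWeaklyRegular (S ∅) rs) : Triv S v := by
  rcases isEmpty_or_nonempty ι with hι | ⟨⟨i₀⟩⟩
  · exact ⟨1, fun i => hι.elim i⟩
  have := hI.dom
  have := hI.noeth
  choose n hn φ hφ hvn hgen using hI.gen
  have hφ0 : ∀ i, (φ i : T) ≠ 0 := fun i h => by
    obtain ⟨_, u, _, hu⟩ := hφ i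
    rw [h, zero_mul] at hu; exact zero_ne_one hu
  have hn0 : ∀ i, n i ≠ 0 := fun i h => by
    obtain ⟨_, u, _, hu⟩ := hvn i
    rw [h, mul_zero, zero_mul] at hu; exact zero_ne_one hu
  let I : Ideal (S ∅) :=
    { carrier := {b | ∃ y ∈ secM S v hS, (φ i₀ : T) * y = b * n i₀}
      zero_mem' := ⟨0, Submodule.zero_mem _, by simp⟩
      add_mem' := by
        rintro a b ⟨y, hy, h⟩ ⟨y', hy', h'⟩
        exact ⟨y + y', Submodule.add_mem _ hy hy', by push_cast; rw [mul_add, h, h', add_mul]⟩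
      smul_mem' := by
        rintro c a ⟨y, hy, h⟩
        refine ⟨c • y, Submodule.smul_mem _ c hy, ?_⟩
        change (φ i₀ : T) * ((c : T) * y) = ((c : T) * a) * _
        rw [mul_left_comm, h, mul_assoc] }
  have hφI : φ i₀ ∈ I := ⟨n i₀, hn i₀, rfl⟩
  choose ν hν' using fun i => hgen i₀ (n i) (hn i)
  have hν' : ∀ i, (φ i₀ : T) * n i = ν i * n i₀ := hν'
  have hνI : ∀ i, ν i ∈ I := fun i => ⟨n i, hn i, hν' i⟩
  have hν0 : ∀ i, ν i ≠ 0 := fun i h => by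
    have := hν' i
    rw [h] at this
    simp [hφ0, hn0] at this
  obtain ⟨δ, hδ, H⟩ := ideal_delta (E := FractionRing (S ∅)) rs hm hrs I (by
    intro h
    rw [h, Submodule.mem_bot] at hφI
    exact hφ0 i₀ (by rw [hφI]; rfl))
  choose k b b' hb hb' using fun i => H (φ i) (ν i) (hνI i) (by
    rintro c ⟨y, hy, h⟩
    obtain ⟨c', hc'⟩ := hgen i y hy
    have hc' : (φ i : T) * y = c' * n i := hc'
    refine ⟨c', Subtype.ext ?_⟩
    apply mul_right_cancel₀ (hn0 i₀)
    push_cast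
    rw [mul_assoc, ← h, mul_assoc, ← hν']
    linear_combination (φ i₀ : T) * hc')
  have hinj := IsFractionRing.injective (S ∅) (FractionRing (S ∅))
  have hbb : ∀ i, b i * b' i = φ i ^ k i * φ i ^ k i := by
    intro i
    apply hinj
    apply mul_right_cancel₀ hδ
    have h1 := hb i
    have h2 := hb' i
    simp only [map_mul] at h1 h2 ⊢
    linear_combination (-algebraMap (S ∅) (FractionRing (S ∅)) (φ i ^ k i)) * h1 - algebraMap (S ∅) (FractionRing (S ∅)) (b i) * h2
  have hcomp : ∀ i j, (b i : T) * n i * (φ j : T) ^ k j = b j * n j * (φ i : T) ^ k i := by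
    intro i j
    have h3 : b i * ν i * φ j ^ k j = b j * ν j * φ i ^ k i := by
      apply hinj
      have h1 := hb i
      have h2 := hb j
      simp only [map_mul] at h1 h2 ⊢
      rw [← h1, ← h2]; ring
    have h3 : (b i : T) * ν i * (φ j : T) ^ k j = b j * ν j * (φ i : T) ^ k i := by
      exact_mod_cast congrArg Subtype.val h3
    apply mul_left_cancel₀ (hφ0 i₀)
    linear_combination b i * (φ j : T) ^ k j * hν' i - b j * (φ i : T) ^ k i * hν' j + n i₀ * h3
  have hle : ∀ i, S ∅ ≤ S {i} := fun i => hS (Finset.empty_subset _)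
  choose hφm φ' hφ' hφφ using fun i => (hφ i).pow (k i)
  choose hvm vn' hvn' hvv using hvn
  let e : T := b i₀ * n i₀ * φ' i₀
  have he : ∀ i, e = b i * n i * φ' i := by
    intro i
    have := hcomp i₀ i
    have h1 := hφφ i
    have h2 := hφφ i₀
    simp only [e]
    linear_combination (φ' i * φ' i₀) * this - (b i₀ * n i₀ * φ' i₀) * h1 + (b i * n i * φ' i) * h2
  have hbu : ∀ i, (b i : T) * (b' i * φ' i * φ' i) = 1 := by
    intro i
    have : (b i : T) * b' i = (φ i : T) ^ k i * (φ i : T) ^ k i := by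
      exact_mod_cast congrArg Subtype.val (hbb i)
    have h1 := hφφ i
    linear_combination (φ' i * φ' i) * this + ((φ i : T) ^ k i * φ' i + 1) * h1
  have key : ∀ i, UnitIn (S {i}) (((v i)⁻¹ : Tˣ) * e) := by
    intro i
    rw [he i]
    have h1 : UnitIn (S {i}) (b i : T) := ⟨hle i (b i).2, _, Subring.mul_mem _ (Subring.mul_mem _ (hle i (b' i).2) (hφ' i)) (hφ' i), hbu i⟩
    have h2 : UnitIn (S {i}) (φ' i) := ⟨hφ' i, _, hφm i, by rw [mul_comm]; exact hφφ i⟩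
    have h3 : UnitIn (S {i}) (((v i)⁻¹ : Tˣ) * n i) := ⟨hvm i, _, hvn' i, hvv i⟩
    have := (h1.mul h2).mul h3
    convert this using 1; ring
  have heu : IsUnit e := by
    obtain ⟨_, u, _, hu⟩ := key i₀
    exact IsUnit.of_mul_eq_one (((v i₀)⁻¹ : Tˣ) * u) (by linear_combination hu)
  obtain ⟨e', he'⟩ := heu
  refine ⟨e', fun i => ?_⟩
  obtain ⟨h1, u, h2, h3⟩ := key i
  rw [← he'] at h1 h3
  have : u = v i * ((e'⁻¹ : Tˣ) : T) := by
    have e1 : (v i : T) * ((v i)⁻¹ : Tˣ) = 1 := by simp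
    have e2 : (e' : T) * (e'⁻¹ : Tˣ) = 1 := by simp
    linear_combination (v i * ((e'⁻¹ : Tˣ) : T)) * h3 - u * e' * ((e'⁻¹ : Tˣ) : T) * e1 - u * e2
  rw [← this]
  exact ⟨h2, _, h1, by rw [mul_comm]; exact h3⟩

end GrothUFD

namespace GrothUFD

section
variable {ι R K : Type*} [Fintype ι] [DecidableEq ι] [CommRing R] [CommRing K] [Algebra R K]

variable (K) in
/-- the localization away from `∏ i ∈ σ, g i`, inside `K`. -/
def locS (g : ι → R) (σ : Finset ι) : Subring K where
  carrier := {t | ∃ (m : ℕ) (a : R), algebraMap R K ((∏ i ∈ σ, g i) ^ m) * t = algebraMap R K a}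
  mul_mem' := by
    rintro t t' ⟨m, a, h⟩ ⟨m', a', h'⟩
    refine ⟨m + m', a * a', ?_⟩
    rw [pow_add, map_mul, map_mul, ← h, ← h']; ring
  one_mem' := ⟨0, 1, by simp⟩
  add_mem' := by
    rintro t t' ⟨m, a, h⟩ ⟨m', a', h'⟩
    refine ⟨m + m', (∏ i ∈ σ, g i) ^ m' * a + (∏ i ∈ σ, g i) ^ m * a', ?_⟩
    rw [pow_add, map_mul, map_add, map_mul, map_mul, ← h, ← h']; ring
  zero_mem' := ⟨0, 0, by simp⟩
  neg_mem' := by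
    rintro t ⟨m, a, h⟩
    exact ⟨m, -a, by rw [map_neg, ← h]; ring⟩

omit [Fintype ι] [DecidableEq ι] in
theorem algebraMap_mem_locS (g : ι → R) (σ : Finset ι) (a : R) : algebraMap R K a ∈ locS K g σ :=
  ⟨0, a, by simp⟩

omit [Fintype ι] [DecidableEq ι] in
theorem locS_of_dvd {g : ι → R} {σ : Finset ι} {d : R} {m : ℕ} (hd : d ∣ (∏ i ∈ σ, g i) ^ m) {t : K} {a : R}
    (h : algebraMap R K d * t = algebraMap R K a) : t ∈ locS K g σ := by
  obtain ⟨c, hc⟩ := hd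
  exact ⟨m, c * a, by rw [hc, map_mul, map_mul, ← h]; ring⟩

omit [Fintype ι] in
theorem locS_mono (g : ι → R) : Monotone (locS K g) := by
  rintro σ τ h t ⟨m, a, ha⟩
  exact locS_of_dvd (pow_dvd_pow_of_dvd (Finset.prod_dvd_prod_of_subset _ _ _ h) m) ha

omit [Fintype ι] [DecidableEq ι] in
theorem mem_locS_empty (g : ι → R) (t : K) : t ∈ locS K g ∅ ↔ ∃ a, t = algebraMap R K a := by
  constructor
  · rintro ⟨m, a, h⟩
    exact ⟨a, by simpa using h⟩
  · rintro ⟨a, rfl⟩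
    exact algebraMap_mem_locS g _ a

omit [Fintype ι] in
theorem mem_locS_insert {g : ι → R} {i : ι} {τ : Finset ι} {t : K} : t ∈ locS K g (insert i τ) ↔
    ∃ N a, algebraMap R K (g i ^ N * (∏ i ∈ τ, g i) ^ N) * t = algebraMap R K a := by
  constructor
  · rintro ⟨m, a, h⟩
    by_cases hi : i ∈ τ
    · rw [Finset.insert_eq_of_mem hi] at h
      exact ⟨m, g i ^ m * a, by rw [map_mul, map_mul, ← h]; ring⟩
    · rw [Finset.prod_insert hi, mul_pow] at h
      exact ⟨m, a, h⟩
  · rintro ⟨N, a, h⟩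
    refine locS_of_dvd (m := N + N) ?_ h
    rw [pow_add]
    apply mul_dvd_mul
    · exact pow_dvd_pow_of_dvd (Finset.dvd_prod_of_mem g (Finset.mem_insert_self i τ)) N
    · exact pow_dvd_pow_of_dvd (Finset.prod_dvd_prod_of_subset _ _ _ (Finset.subset_insert i τ)) N

omit [Fintype ι] [DecidableEq ι] in
theorem locS_up {g : ι → R} {i j : ι} {τ : Finset ι} {t : K} {N N' : ℕ} (h : N ≤ N')
    (ht : ∃ a, algebraMap R K (g i ^ N * g j ^ N * (∏ i ∈ τ, g i) ^ N) * t = algebraMap R K a) :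
    ∃ a, algebraMap R K (g i ^ N' * g j ^ N' * (∏ i ∈ τ, g i) ^ N') * t = algebraMap R K a := by
  obtain ⟨a, ha⟩ := ht
  obtain ⟨k, rfl⟩ := Nat.exists_eq_add_of_le h
  refine ⟨(g i ^ k * g j ^ k * (∏ i ∈ τ, g i) ^ k) * a, ?_⟩
  rw [map_mul _ _ a, ← ha]
  simp only [map_mul, map_pow]
  ring

omit [Fintype ι] [DecidableEq ι] in
theorem locS_up1 {g : ι → R} {i : ι} {τ : Finset ι} {t : K} {N N' : ℕ} (h : N ≤ N')
    (ht : ∃ a, algebraMap R K (g i ^ N * (∏ i ∈ τ, g i) ^ N) * t = algebraMap R K a) :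
    ∃ a, algebraMap R K (g i ^ N' * (∏ i ∈ τ, g i) ^ N') * t = algebraMap R K a := by
  obtain ⟨a, ha⟩ := ht
  obtain ⟨k, rfl⟩ := Nat.exists_eq_add_of_le h
  refine ⟨(g i ^ k * (∏ i ∈ τ, g i) ^ k) * a, ?_⟩
  rw [map_mul _ _ a, ← ha]
  simp only [map_mul, map_pow]
  ring

omit [Fintype ι] in
theorem mem_locS_insert2 {g : ι → R} {i j : ι} {τ : Finset ι} {t : K} : t ∈ locS K g (insert i (insert j τ)) ↔
    ∃ N a, algebraMap R K (g i ^ N * g j ^ N * (∏ i ∈ τ, g i) ^ N) * t = algebraMap R K a := by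
  constructor
  · intro h
    obtain ⟨N, a, h⟩ := mem_locS_insert.1 h
    have : algebraMap R K (g i ^ N) * t ∈ locS K g (insert j τ) := by
      refine ⟨N, a, ?_⟩
      rw [← h, map_mul]; ring
    obtain ⟨M, b, h'⟩ := mem_locS_insert.1 this
    refine ⟨N + M, g i ^ M * g j ^ N * (∏ i ∈ τ, g i) ^ N * b, ?_⟩
    rw [map_mul _ _ b, ← h']
    simp only [map_mul, map_pow]
    ring
  · rintro ⟨N, a, h⟩
    refine locS_of_dvd (m := N + N + N) ?_ h
    rw [pow_add, pow_add]
    apply mul_dvd_mul (mul_dvd_mul _ _)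
    · exact pow_dvd_pow_of_dvd (Finset.prod_dvd_prod_of_subset _ _ _ (by intro x hx; simp [hx])) N
    · exact pow_dvd_pow_of_dvd (Finset.dvd_prod_of_mem g (by simp)) N
    · exact pow_dvd_pow_of_dvd (Finset.dvd_prod_of_mem g (by simp)) N
end

/-- elementary form of: all powers of `g` form a regular sequence. -/
structure Reg4 {R : Type*} [CommRing R] (g : Fin 4 → R) : Prop where
  nz : ∀ i, g i ≠ 0
  r1 : ∀ N a b, g 1 ^ N * a = g 0 ^ N * b → ∃ c, a = g 0 ^ N * c
  r2 : ∀ N a b c, g 2 ^ N * a = g 0 ^ N * b + g 1 ^ N * c → ∃ b' c', a = g 0 ^ N * b' + g 1 ^ N * c'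
  r3 : ∀ N a b c d, g 3 ^ N * a = g 0 ^ N * b + g 1 ^ N * c + g 2 ^ N * d →
    ∃ b' c' d', a = g 0 ^ N * b' + g 1 ^ N * c' + g 2 ^ N * d'

section
variable {R K : Type*} [CommRing R] [IsDomain R] [Field K] [Algebra R K] [IsFractionRing R K]
  {g : Fin 4 → R} (hg : Reg4 g)
include hg

theorem g_ne (i : Fin 4) : algebraMap R K (g i) ≠ 0 := by simpa using hg.nz i

theorem base_P0 (τ : Finset (Fin 4)) {t : K} (h0 : t ∈ locS K g (insert 0 τ)) (h1 : t ∈ locS K g (insert 1 τ)) :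
    t ∈ locS K g τ := by
  obtain ⟨N, h0⟩ := mem_locS_insert.1 h0
  obtain ⟨N', h1⟩ := mem_locS_insert.1 h1
  obtain ⟨a, ha⟩ := locS_up1 (le_max_left N N') h0
  obtain ⟨b, hb⟩ := locS_up1 (le_max_right N N') h1
  generalize max N N' = M at ha hb
  obtain ⟨c, hc⟩ := hg.r1 M a b (by
    apply IsFractionRing.injective R K
    rw [map_mul, map_mul, ← ha, ← hb]
    simp only [map_mul]; ring)
  refine ⟨M, c, ?_⟩
  have : algebraMap R K (g 0 ^ M) ≠ 0 := by rw [map_pow]; exact pow_ne_zero _ (g_ne hg 0)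
  apply mul_left_cancel₀ this
  rw [← mul_assoc, ← map_mul, ha, hc, map_mul]

theorem base_P1 (τ : Finset (Fin 4)) (U : Set (Fin 4)) (h0 : 0 ∈ U) (h1 : 1 ∈ U) (h2 : 2 ∈ U) (r : Fin 4 → K)
    (hr : ∀ i ∈ U, ∀ j ∈ U, r i - r j ∈ locS K g (insert i (insert j τ))) :
    ∃ t, ∀ i ∈ U, r i - t ∈ locS K g (insert i τ) := by
  obtain ⟨N1, H1⟩ := mem_locS_insert2.1 (hr 0 h0 1 h1)
  obtain ⟨N2, H2⟩ := mem_locS_insert2.1 (hr 0 h0 2 h2)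
  obtain ⟨N3, H3⟩ := mem_locS_insert2.1 (hr 1 h1 2 h2)
  obtain ⟨a1, ha1⟩ := locS_up (show N1 ≤ N1 + N2 + N3 by omega) H1
  obtain ⟨a2, ha2⟩ := locS_up (show N2 ≤ N1 + N2 + N3 by omega) H2
  obtain ⟨a3, ha3⟩ := locS_up (show N3 ≤ N1 + N2 + N3 by omega) H3
  generalize N1 + N2 + N3 = M at ha1 ha2 ha3
  obtain ⟨b, c, hbc⟩ := hg.r2 M a1 (-a3) a2 (by
    apply IsFractionRing.injective R K
    simp only [map_mul, map_add, map_neg]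
    rw [← ha1, ← ha2, ← ha3]
    simp only [map_mul]; ring)
  have e0 : algebraMap R K (g 0) ≠ 0 := g_ne hg 0
  have e1 : algebraMap R K (g 1) ≠ 0 := g_ne hg 1
  have eτ : algebraMap R K (∏ i ∈ τ, g i) ≠ 0 := by
    rw [map_prod]; exact Finset.prod_ne_zero_iff.2 fun i _ => g_ne hg i
  simp only [map_mul, map_pow] at ha1
  rw [hbc] at ha1
  simp only [map_add, map_mul, map_pow] at ha1
  set G0 := algebraMap R K (g 0)
  set G1 := algebraMap R K (g 1)
  set Gτ := algebraMap R K (∏ i ∈ τ, g i) with hGτ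
  let t := r 0 - algebraMap R K c / (G0 ^ M * Gτ ^ M)
  have ht0 : r 0 - t ∈ locS K g (insert 0 τ) := by
    refine mem_locS_insert.2 ⟨M, c, ?_⟩
    simp only [t, map_mul, map_pow, ← hGτ]
    field_simp
    ring
  have ht1 : r 1 - t ∈ locS K g (insert 1 τ) := by
    refine mem_locS_insert.2 ⟨M, -b, ?_⟩
    simp only [t, map_mul, map_pow, ← hGτ, map_neg]
    have e0' : G0 ^ M ≠ 0 := pow_ne_zero _ e0
    apply mul_left_cancel₀ e0'
    field_simp
    linear_combination -ha1
  refine ⟨t, fun i hi => ?_⟩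
  apply base_P0 hg
  · have : r i - t = (r 0 - t) - (r 0 - r i) := by ring
    rw [this]
    refine Subring.sub_mem _ (locS_mono g ?_ ht0) (hr 0 h0 i hi)
    exact Finset.insert_subset_insert _ (Finset.subset_insert _ _)
  · have : r i - t = (r 1 - t) - (r 1 - r i) := by ring
    rw [this]
    refine Subring.sub_mem _ (locS_mono g ?_ ht1) (hr 1 h1 i hi)
    exact Finset.insert_subset_insert _ (Finset.subset_insert _ _)

theorem base_P2 : P2 (locS K g) := by
  intro ε hε
  have hii : ∀ i, ε i i ∈ locS K g {i} := fun i => by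
    have := hε i i i
    simpa using this
  suffices H : ∃ r : Fin 4 → K, ∀ i j, i < j → ε i j - r i + r j ∈ locS K g {i, j} by
    obtain ⟨r, hr⟩ := H
    refine ⟨r, fun i j => ?_⟩
    rcases lt_trichotomy i j with h | rfl | h
    · exact hr i j h
    · simpa using hii i
    · have h1 := hr j i h
      have h2 := hε i j i
      have h3 := locS_mono (K := K) g (show ({i} : Finset (Fin 4)) ≤ {i, j} by intro x hx; simp at hx; simp [hx]) (hii i)
      have s1 : ({j, i} : Finset (Fin 4)) = {i, j} := Finset.pair_comm _ _
      have s2 : ({i, j, i} : Finset (Fin 4)) = {i, j} := by ext x; simp; tauto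
      rw [s1] at h1
      rw [s2] at h2
      have := Subring.add_mem _ (Subring.sub_mem _ h2 h1) h3
      convert this using 1; ring
  -- the Koszul relation
  have hmem3 : ∀ i j k, ∃ N a, algebraMap R K (g i ^ N * g j ^ N * g k ^ N) * (ε i j + ε j k - ε i k) = algebraMap R K a := by
    intro i j k
    obtain ⟨N, a, h⟩ := mem_locS_insert2.1 (hε i j k)
    exact ⟨N, a, by simpa using h⟩
  have hup : ∀ i j k N N', N ≤ N' → (∃ a, algebraMap R K (g i ^ N * g j ^ N * g k ^ N) * (ε i j + ε j k - ε i k) = algebraMap R K a) →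
      (∃ a, algebraMap R K (g i ^ N' * g j ^ N' * g k ^ N') * (ε i j + ε j k - ε i k) = algebraMap R K a) := by
    intro i j k N N' h ⟨a, ha⟩
    obtain ⟨l, rfl⟩ := Nat.exists_eq_add_of_le h
    refine ⟨g i ^ l * g j ^ l * g k ^ l * a, ?_⟩
    rw [map_mul _ _ a, ← ha]
    simp only [map_mul, map_pow]; ring
  obtain ⟨N1, H1⟩ := hmem3 0 1 2
  obtain ⟨N2, H2⟩ := hmem3 0 1 3
  obtain ⟨N3, H3⟩ := hmem3 0 2 3
  obtain ⟨N4, H4⟩ := hmem3 1 2 3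
  obtain ⟨a1, ha1⟩ := hup _ _ _ _ (N1 + N2 + N3 + N4) (by omega) H1
  obtain ⟨a2, ha2⟩ := hup _ _ _ _ (N1 + N2 + N3 + N4) (by omega) H2
  obtain ⟨a3, ha3⟩ := hup _ _ _ _ (N1 + N2 + N3 + N4) (by omega) H3
  obtain ⟨a4, ha4⟩ := hup _ _ _ _ (N1 + N2 + N3 + N4) (by omega) H4
  generalize N1 + N2 + N3 + N4 = M at ha1 ha2 ha3 ha4
  obtain ⟨b, c, d, hbcd⟩ := hg.r3 M a1 a4 (-a3) a2 (by
    apply IsFractionRing.injective R K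
    simp only [map_mul, map_add, map_neg]
    rw [← ha1, ← ha2, ← ha3, ← ha4]
    simp only [map_mul]; ring)
  have e0 : algebraMap R K (g 0) ≠ 0 := g_ne hg 0
  have e1 : algebraMap R K (g 1) ≠ 0 := g_ne hg 1
  have e2 : algebraMap R K (g 2) ≠ 0 := g_ne hg 2
  rw [hbcd] at ha1
  simp only [map_mul, map_pow, map_add] at ha1
  set G0 := algebraMap R K (g 0) with hG0
  set G1 := algebraMap R K (g 1) with hG1
  set G2 := algebraMap R K (g 2) with hG2
  -- ε' i j = ε i j - γ i j
  let γ01 := algebraMap R K d / (G0 ^ M * G1 ^ M)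
  let γ02 := - (algebraMap R K c / (G0 ^ M * G2 ^ M))
  let γ12 := algebraMap R K b / (G1 ^ M * G2 ^ M)
  have hγ : ε 0 1 + ε 1 2 - ε 0 2 = γ01 + γ12 - γ02 := by
    simp only [γ01, γ02, γ12]
    field_simp
    linear_combination ha1
  have m01 : γ01 ∈ locS K g {0, 1} := mem_locS_insert2 (τ := ∅).2 ⟨M, d, by
    simp only [γ01, map_mul, map_pow, ← hG0, ← hG1]; simp; field_simp⟩
  have m02 : γ02 ∈ locS K g {0, 2} := mem_locS_insert2 (τ := ∅).2 ⟨M, -c, by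
    simp only [γ02, map_mul, map_pow, ← hG0, ← hG2]; simp; field_simp⟩
  have m12 : γ12 ∈ locS K g {1, 2} := mem_locS_insert2 (τ := ∅).2 ⟨M, b, by
    simp only [γ12, map_mul, map_pow, ← hG1, ← hG2]; simp; field_simp⟩
  let r : Fin 4 → K := ![0, -(ε 0 1 - γ01), -(ε 0 2 - γ02), 0]
  have r01 : ε 0 1 - r 0 + r 1 ∈ locS K g {0, 1} := by
    convert m01 using 1; simp [r]
  have r02 : ε 0 2 - r 0 + r 2 ∈ locS K g {0, 2} := by
    convert m02 using 1; simp [r]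
  have r12 : ε 1 2 - r 1 + r 2 ∈ locS K g {1, 2} := by
    convert m12 using 1; simp [r]; linear_combination hγ
  have key : ∀ i j : Fin 4, i < j → j < 3 → ε i j - r i + r j ∈ locS K g {i, j} := by
    intro i j hij hj
    fin_cases i <;> fin_cases j <;> first | exact r01 | exact r02 | exact r12 | (exfalso; revert hij hj; decide)
  have key' : ∀ i j : Fin 4, i < j → j < 3 → (r i - ε i 3) - (r j - ε j 3) ∈ locS K g {i, j, 3} := by
    intro i j hij hj
    have h1 := hε i j 3
    have h2 := locS_mono (K := K) g (show ({i, j} : Finset (Fin 4)) ≤ {i, j, 3} by intro x hx; simp at hx ⊢; tauto) (key i j hij hj)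
    have := Subring.sub_mem _ h1 h2
    convert this using 1; ring
  obtain ⟨t, ht⟩ := base_P1 (K := K) hg {3} {i | i < 3} (by decide) (by decide) (by decide) (fun i => r i - ε i 3) (by
    intro i hi j hj
    rcases lt_trichotomy i j with h | rfl | h
    · exact key' i j h hj
    · rw [sub_self]; exact Subring.zero_mem _
    · have := Subring.neg_mem _ (key' j i h hi)
      rw [neg_sub, Finset.insert_comm] at this
      exact this)
  refine ⟨fun i => if i = 3 then t else r i, fun i j hij => ?_⟩
  have hi : i ≠ 3 := by rintro rfl; revert hij; revert j; decide
  simp only [hi, if_false]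
  split_ifs with hj
  · subst hj
    have := Subring.neg_mem _ (ht i hij)
    convert this using 1
    ring
  · exact key i j hij (by omega)
end
end GrothUFD

namespace GrothUFD

theorem fg_preimage {D V W : Type*} [CommRing D] [AddCommGroup V] [AddCommGroup W] [Module D V] [Module D W]
    (P : Submodule D V) (L : V →ₗ[D] W) (h : (P.map L).FG) : ∃ P' ≤ P, P'.FG ∧ P.map L ≤ P'.map L := by
  have : Module.Finite D (P.map L) := Module.Finite.iff_fg.2 h
  obtain ⟨n, f, hf⟩ := Module.Finite.exists_fin' D (P.map L)
  obtain ⟨q, hq⟩ := Module.projective_lifting_property (L.submoduleMap P) f (L.submoduleMap_surjective P)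
  refine ⟨LinearMap.range (P.subtype ∘ₗ q), ?_, ?_, ?_⟩
  · rintro _ ⟨z, rfl⟩
    exact (q z).2
  · rw [LinearMap.range_eq_map]
    exact (Module.Finite.fg_top).map _
  · intro y hy
    obtain ⟨z, hz⟩ := hf ⟨y, hy⟩
    refine ⟨q z, ⟨z, rfl⟩, ?_⟩
    have := congrArg Subtype.val (LinearMap.congr_fun hq z)
    rw [hz] at this
    exact this

section
variable {R K : Type*} [CommRing R] [IsDomain R] [IsNoetherianRing R] [Field K] [Algebra R K] [IsFractionRing R K]
  {g h : Fin 4 → R} (hg : Reg4 g) (𝔭 : Ideal R) (hh : ∀ i, h i ∈ 𝔭) (h0 : ∀ i, h i ≠ 0)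
  (hgp : ∀ i, ∀ a ∈ 𝔭, ∃ b, g i * a = h i * b)

omit [IsDomain R] [IsFractionRing R K] in
theorem base_noeth : IsNoetherianRing (locS K g ∅) := by
  let f : R →+* locS K g ∅ := (algebraMap R K).codRestrict _ (algebraMap_mem_locS g ∅)
  refine isNoetherianRing_of_surjective R _ f ?_
  rintro ⟨t, ht⟩
  obtain ⟨a, rfl⟩ := (mem_locS_empty g t).1 ht
  exact ⟨a, rfl⟩

/-- the units of `K` given by `h` -/
noncomputable def baseV (h0 : ∀ i, h i ≠ 0) (i : Fin 4) : Kˣ :=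
  Units.mk0 (algebraMap R K (h i)) (by simpa using h0 i)

omit [IsNoetherianRing R] in
theorem baseV_val (i : Fin 4) : ((baseV h0 i : Kˣ) : K) = algebraMap R K (h i) := rfl

omit [IsNoetherianRing R] in
theorem baseV_inv (i : Fin 4) : (((baseV h0 i)⁻¹ : Kˣ) : K) = (algebraMap R K (h i))⁻¹ := rfl

omit [IsNoetherianRing R] in
theorem h_ne (h0 : ∀ i, h i ≠ 0) (i : Fin 4) : algebraMap R K (h i) ≠ 0 := by simpa using h0 i

include hg in
omit [IsNoetherianRing R] in
theorem unit_g (i : Fin 4) (s : ℕ) : UnitIn (locS K g {i}) (algebraMap R K (g i ^ s)) := by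
  refine ⟨algebraMap_mem_locS _ _ _, (algebraMap R K (g i ^ s))⁻¹, ⟨s, 1, ?_⟩, ?_⟩
  · have : algebraMap R K (g i) ≠ 0 := g_ne hg i
    simp [this]
  · have : algebraMap R K (g i) ≠ 0 := g_ne hg i
    simp [this]

include hgp h0 hg in
omit [IsNoetherianRing R] in
theorem p_mem (i : Fin 4) {a : R} (ha : a ∈ 𝔭) : (algebraMap R K (h i))⁻¹ * algebraMap R K a ∈ locS K g {i} := by
  obtain ⟨b, hb⟩ := hgp i a ha
  refine ⟨1, b, ?_⟩
  have : algebraMap R K (h i) ≠ 0 := h_ne h0 i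
  have e := congrArg (algebraMap R K) hb
  rw [map_mul, map_mul] at e
  simp only [Finset.prod_singleton, pow_one]
  field_simp
  exact e

/-- `R` as a submodule of `K`. -/
def oneD (g : Fin 4 → R) : Submodule (locS K g ∅) K := Submodule.span _ {1}

omit [IsDomain R] [IsNoetherianRing R] [IsFractionRing R K] in
theorem mem_oneD (t : K) : t ∈ oneD g ↔ t ∈ locS K g ∅ := by
  rw [oneD, Submodule.mem_span_singleton]
  constructor
  · rintro ⟨a, rfl⟩
    rw [Subring.smul_def]; simp
  · intro h
    exact ⟨⟨t, h⟩, by rw [Subring.smul_def]; simp⟩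

omit [IsDomain R] [IsNoetherianRing R] [IsFractionRing R K] in
theorem oneD_fg : (oneD (K := K) g).FG := ⟨{1}, by simp [oneD]⟩

include hg in
omit [IsNoetherianRing R] in
theorem mem_of_all {t : K} (h : ∀ i, t ∈ locS K g {i}) : t ∈ locS K g ∅ :=
  base_P0 hg ∅ (h 0) (h 1)

include hg in
omit [IsNoetherianRing R] in
theorem secM_le : secM (locS K g) (baseV h0) (locS_mono g) ≤ oneD g := by
  intro t ht
  rw [mem_oneD]
  apply mem_of_all hg
  intro i
  have := Subring.mul_mem _ (algebraMap_mem_locS (K := K) g {i} (h i)) (ht i)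
  rw [baseV_inv] at this
  have e : algebraMap R K (h i) ≠ 0 := h_ne h0 i
  rwa [mul_inv_cancel_left₀ e] at this

include hg in
omit [IsNoetherianRing R] in
theorem locS_cancel (i : Fin 4) (s : ℕ) {σ : Finset (Fin 4)} (hi : i ∈ σ) {t : K}
    (ht : algebraMap R K (g i ^ s) * t ∈ locS K g σ) : t ∈ locS K g σ := by
  obtain ⟨_, u, hu, huu⟩ := (unit_g (K := K) hg i s).mono (locS_mono g (Finset.singleton_subset_iff.2 hi))
  have := Subring.mul_mem _ hu ht
  convert this using 1
  linear_combination (-t) * huu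

include hh hgp hg in
theorem base_zfg : ∃ F : Submodule (locS K g ∅) (Fin 4 → K), F.FG ∧ F ≤ cocZ (locS K g) (baseV h0) (locS_mono g) ∧
    cocZ (locS K g) (baseV h0) (locS_mono g) ≤ F ⊔ cobB (locS K g) (baseV h0) (locS_mono g) := by
  have : IsNoetherianRing (locS K g ∅) := base_noeth
  let a : Fin 4 → K := fun l => algebraMap R K (g l) * (algebraMap R K (h l))⁻¹
  let β : K := algebraMap R K (∏ i, h i)
  have hβ : β ≠ 0 := by
    simp only [β, map_prod]; exact Finset.prod_ne_zero_iff.2 fun i _ => h_ne h0 i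
  have ha : ∀ l, a l ≠ 0 := fun l => mul_ne_zero (g_ne hg l) (inv_ne_zero (h_ne h0 l))
  have haβ : ∀ l, β * a l ∈ locS K g ∅ := by
    intro l
    have e : algebraMap R K (h l) ≠ 0 := h_ne h0 l
    rw [mem_locS_empty]
    refine ⟨(∏ i ∈ Finset.univ.erase l, h i) * g l, ?_⟩
    simp only [β, a]
    rw [← Finset.prod_erase_mul _ _ (Finset.mem_univ l), map_mul, map_mul]
    field_simp
  have hah : ∀ l i, a l * algebraMap R K (h i) ∈ locS K g ∅ := by
    intro l i
    obtain ⟨b, hb⟩ := hgp l (h i) (hh i)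
    rw [mem_locS_empty]
    refine ⟨b, ?_⟩
    have e : algebraMap R K (h l) ≠ 0 := h_ne h0 l
    have e' := congrArg (algebraMap R K) hb
    rw [map_mul, map_mul] at e'
    simp only [a]; field_simp; exact e'
  have hle : ∀ σ, locS K g ∅ ≤ locS K g σ := fun σ => locS_mono g (Finset.empty_subset σ)
  let P : Submodule (locS K g ∅) ((Fin 4 → K) × (Fin 4 → K)) :=
    { carrier := {x | x.1 ∈ cocZ (locS K g) (baseV h0) (locS_mono g) ∧ ∀ l i, a l * x.1 i - x.2 l ∈ locS K g {i}}
      zero_mem' := ⟨Submodule.zero_mem _, fun l i => by simp⟩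
      add_mem' := by
        rintro x y ⟨hx, hx'⟩ ⟨hy, hy'⟩
        refine ⟨Submodule.add_mem _ hx hy, fun l i => ?_⟩
        have := Subring.add_mem _ (hx' l i) (hy' l i)
        simp only [Prod.fst_add, Prod.snd_add, Pi.add_apply]
        convert this using 1; ring
      smul_mem' := by
        rintro c x ⟨hx, hx'⟩
        refine ⟨Submodule.smul_mem _ c hx, fun l i => ?_⟩
        have := Subring.mul_mem _ (hle _ c.2) (hx' l i)
        change a l * ((c : K) * x.1 i) - (c : K) * x.2 l ∈ _
        convert this using 1; ring }
  let L : ((Fin 4 → K) × (Fin 4 → K)) →ₗ[locS K g ∅] (Fin 4 → Fin 4 → K) :=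
    { toFun := fun x l m => β * a m * x.2 l - β * a l * x.2 m
      map_add' := by
        intro x y; ext l m; simp only [Prod.snd_add, Pi.add_apply]; ring
      map_smul' := by
        intro c x; ext l m
        change β * a m * ((c : K) * x.2 l) - β * a l * ((c : K) * x.2 m) = (c : K) * (β * a m * x.2 l - β * a l * x.2 m)
        ring }
  have hL : ∀ x l m, L x l m = β * a m * x.2 l - β * a l * x.2 m := fun _ _ _ => rfl
  have hPL : P.map L ≤ Submodule.pi Set.univ fun _ => Submodule.pi Set.univ fun _ => oneD g := by
    rintro _ ⟨x, ⟨_, hx'⟩, rfl⟩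
    rw [Submodule.mem_pi]
    intro l _
    rw [Submodule.mem_pi]
    intro m _
    rw [mem_oneD]
    apply mem_of_all hg
    intro i
    have := Subring.sub_mem _ (Subring.mul_mem _ (hle _ (haβ l)) (hx' m i)) (Subring.mul_mem _ (hle _ (haβ m)) (hx' l i))
    rw [hL]
    convert this using 1; ring
  obtain ⟨P', hP', hP'fg, hP'L⟩ := fg_preimage P L
    (Submodule.FG.of_le (Submodule.fg_pi fun _ => Submodule.fg_pi fun _ => oneD_fg) hPL)
  refine ⟨P'.map (LinearMap.fst _ _ _), hP'fg.map _, ?_, ?_⟩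
  · rintro _ ⟨x, hx, rfl⟩
    exact (hP' hx).1
  · intro r hr
    have : ∀ l, ∃ t, ∀ i, a l * r i - t ∈ locS K g {i} := by
      intro l
      obtain ⟨t, ht⟩ := base_P1 (K := K) hg ∅ Set.univ trivial trivial trivial (fun i => a l * r i) (by
        intro i _ j _
        have := Subring.mul_mem _ (hle _ (hah l i)) (hr i j)
        rw [baseV_inv] at this
        have e : algebraMap R K (h i) ≠ 0 := h_ne h0 i
        have e2 : a l * r i - a l * r j = a l * algebraMap R K (h i) * ((algebraMap R K (h i))⁻¹ * (r i - r j)) := by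
          rw [mul_assoc (a l), mul_inv_cancel_left₀ e, mul_sub]
        show a l * r i - a l * r j ∈ _
        rw [e2]; exact this)
      exact ⟨t, fun i => ht i trivial⟩
    choose t ht using this
    have hx : ((r, t) : (Fin 4 → K) × (Fin 4 → K)) ∈ P := ⟨hr, fun l i => ht l i⟩
    obtain ⟨y, hy, hyL⟩ := hP'L ⟨_, hx, rfl⟩
    have hyP := hP' hy
    have hz : ((r, t) - y) ∈ P := Submodule.sub_mem _ hx hyP
    have hzL : L ((r, t) - y) = 0 := by rw [map_sub, hyL, sub_self]
    generalize hzz : (r, t) - y = z at hz hzL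
    have hrz : r = y.1 + z.1 := by rw [← hzz]; simp
    rw [hrz]
    refine Submodule.add_mem _ (Submodule.mem_sup_left ⟨y, hy, rfl⟩) (Submodule.mem_sup_right ⟨z.2 0 / a 0, fun i => ?_⟩)
    have e1 : β * a 0 * z.2 i - β * a i * z.2 0 = 0 := by
      have := congrFun (congrFun hzL i) 0
      rwa [hL] at this
    have e2 : z.2 i = a i * (z.2 0 / a 0) := by
      have := ha 0
      field_simp
      apply mul_left_cancel₀ hβ
      linear_combination e1
    have e3 := hz.2 i i
    rw [e2, ← mul_sub] at e3
    apply locS_cancel hg i 1 (Finset.mem_singleton_self i)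
    rw [baseV_inv]
    convert e3 using 1
    simp only [a, pow_one]; ring

omit [IsDomain R] [IsNoetherianRing R] [IsFractionRing R K] in
theorem locS_clear (i j : Fin 4) {t : K} (ht : t ∈ locS K g {i, j}) : ∃ s, algebraMap R K (g i ^ s) * t ∈ locS K g {j} := by
  obtain ⟨N, a, h⟩ := mem_locS_insert.1 ht
  exact ⟨N, N, a, by rw [← h, map_mul]; ring⟩

omit [IsDomain R] [IsNoetherianRing R] [IsFractionRing R K] in
theorem exists_pow_span {V : Type*} [AddCommGroup V] [Module K V] (i : Fin 4) (F B : Submodule (locS K g ∅) V)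
    (hF : F.FG) (h : ∀ x ∈ F, ∃ s, ∀ s' ≥ s, algebraMap R K (g i ^ s') • x ∈ B) :
    ∃ s, ∀ x ∈ F, algebraMap R K (g i ^ s) • x ∈ B := by
  obtain ⟨t, rfl⟩ := hF
  choose! s hs using h
  refine ⟨t.sup s, fun x hx => ?_⟩
  induction hx using Submodule.span_induction with
  | mem x hx => exact hs x (Submodule.subset_span hx) _ (Finset.le_sup (f := s) hx)
  | zero => rw [smul_zero]; exact Submodule.zero_mem _
  | add x y _ _ hx hy => rw [smul_add]; exact Submodule.add_mem _ hx hy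
  | smul c x _ hx =>
    have := Submodule.smul_mem _ c hx
    rw [Subring.smul_def] at this ⊢
    rw [smul_comm]
    exact this

include hg hh hgp in
theorem base_inv : Inv (locS K g) (baseV h0) (locS_mono g) := by
  have hn : IsNoetherianRing (locS K g ∅) := base_noeth
  have hle : ∀ σ, locS K g ∅ ≤ locS K g σ := fun σ => locS_mono g (Finset.empty_subset σ)
  have hM : (secM (locS K g) (baseV h0) (locS_mono g)).FG := Submodule.FG.of_le oneD_fg (secM_le hg h0)
  have hZ := base_zfg (K := K) hg 𝔭 hh h0 hgp
  refine ⟨hn, inferInstance, ?_, base_P2 hg, hM, hZ, ?_, ?_⟩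
  · intro i j
    rw [baseV_inv, baseV_val, mul_comm]
    exact locS_mono g (by intro x hx; simp at hx; simp [hx]) (p_mem hg 𝔭 h0 hgp j (hh i))
  · intro i
    obtain ⟨F, hF, hFZ, hZF⟩ := hZ
    obtain ⟨s, hs⟩ := exists_pow_span (K := K) i F (cobB (locS K g) (baseV h0) (locS_mono g)) hF (by
      intro r hr
      have : ∀ j, ∃ s, algebraMap R K (g i ^ s) * (((baseV h0 j)⁻¹ : Kˣ) * (r j - r i)) ∈ locS K g {j} := by
        intro j
        have h1 := hFZ hr j i
        rw [Finset.pair_comm] at h1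
        exact locS_clear i j h1
      choose s hs using this
      refine ⟨Finset.univ.sup s, fun s' hs' => ⟨algebraMap R K (g i ^ s') * r i, fun j => ?_⟩⟩
      have : s j ≤ s' := le_trans (Finset.le_sup (f := s) (Finset.mem_univ j)) hs'
      obtain ⟨k, rfl⟩ := Nat.exists_eq_add_of_le this
      have := Subring.mul_mem _ (algebraMap_mem_locS (K := K) g {j} (g i ^ k)) (hs j)
      change _ * (algebraMap R K (g i ^ (s j + k)) * r j - _) ∈ _
      convert this using 1
      simp only [map_mul, map_pow]; ring)
    refine ⟨⟨algebraMap R K (g i ^ s), algebraMap_mem_locS _ _ _⟩, unit_g hg i s, fun r hr => ?_⟩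
    obtain ⟨x, hx, y, hy, rfl⟩ := Submodule.mem_sup.1 (hZF hr)
    rw [smul_add]
    exact Submodule.add_mem _ (hs x hx) (Submodule.smul_mem _ _ hy)
  · intro i
    refine ⟨algebraMap R K (h i), fun j => ?_, ?_⟩
    · rw [baseV_inv]; exact p_mem hg 𝔭 h0 hgp j (hh i)
    have e : algebraMap R K (h i) ≠ 0 := h_ne h0 i
    obtain ⟨s, hs⟩ := exists_pow_span (K := K) i (secM (locS K g) (baseV h0) (locS_mono g))
      (Submodule.span _ {algebraMap R K (h i)}) hM (by
      intro y hy
      obtain ⟨m, a, ha⟩ := hy i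
      rw [baseV_inv, Finset.prod_singleton] at ha
      refine ⟨m, fun s' hs' => ?_⟩
      obtain ⟨k, rfl⟩ := Nat.exists_eq_add_of_le hs'
      rw [Submodule.mem_span_singleton]
      refine ⟨⟨algebraMap R K (g i ^ k * a), algebraMap_mem_locS _ _ _⟩, ?_⟩
      change algebraMap R K (g i ^ k * a) * algebraMap R K (h i) = algebraMap R K (g i ^ (m + k)) * y
      rw [map_mul, ← ha]
      simp only [map_pow, pow_add, map_mul]
      field_simp)
    refine ⟨⟨algebraMap R K (g i ^ s), algebraMap_mem_locS _ _ _⟩, unit_g hg i s, ?_, fun y hy => ?_⟩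
    · rw [baseV_inv, inv_mul_cancel₀ e]
      exact ⟨Subring.one_mem _, 1, Subring.one_mem _, by simp⟩
    · obtain ⟨b, hb⟩ := Submodule.mem_span_singleton.1 (hs y hy)
      exact ⟨b, hb.symm⟩

include hg hh hgp in
omit [IsNoetherianRing R] in
theorem base_concl [𝔭.IsPrime] (hg0 : g 0 ∉ 𝔭) (hT : Triv (locS K g) (baseV (K := K) h0)) : ∃ a, 𝔭 = Ideal.span {a} := by
  obtain ⟨e, he⟩ := hT
  have hM : ∀ t, t ∈ secM (locS K g) (baseV h0) (locS_mono g) ↔ ((e⁻¹ : Kˣ) : K) * t ∈ locS K g ∅ := by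
    intro t
    constructor
    · intro ht
      apply mem_of_all hg
      intro i
      have := Subring.mul_mem _ (he i).1 (ht i)
      convert this using 1
      have : ((baseV (K := K) h0 i : Kˣ) : K) * ((baseV (K := K) h0 i)⁻¹ : Kˣ) = 1 := by simp
      linear_combination (-((e⁻¹ : Kˣ) : K) * t) * this
    · intro ht i
      obtain ⟨_, u, hu, huu⟩ := he i
      have := Subring.mul_mem _ hu (locS_mono g (Finset.empty_subset {i}) ht)
      convert this using 1
      have h2 : ((baseV (K := K) h0 i : Kˣ) : K) * ((baseV (K := K) h0 i)⁻¹ : Kˣ) = 1 := by simp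
      linear_combination (-((baseV (K := K) h0 i)⁻¹ : Kˣ) * t) * huu + (u * ((e⁻¹ : Kˣ) : K) * t) * h2
  have heM : (e : K) ∈ secM (locS K g) (baseV h0) (locS_mono g) := by
    rw [hM]; simp
  have := secM_le hg h0 heM
  rw [mem_oneD, mem_locS_empty] at this
  obtain ⟨a, ha⟩ := this
  refine ⟨a, le_antisymm ?_ ?_⟩
  · intro y hy
    have h1 : algebraMap R K y ∈ secM (locS K g) (baseV h0) (locS_mono g) := fun i => by
      rw [baseV_inv]; exact p_mem hg 𝔭 h0 hgp i hy
    rw [hM, mem_locS_empty] at h1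
    obtain ⟨b, hb⟩ := h1
    rw [Ideal.mem_span_singleton]
    refine ⟨b, IsFractionRing.injective R K ?_⟩
    rw [map_mul, ← hb, ← ha]; simp
  · rw [Ideal.span_singleton_le_iff_mem]
    obtain ⟨m, b, hb⟩ := heM 0
    rw [baseV_inv, ha, Finset.prod_singleton] at hb
    have e0 : algebraMap R K (h 0) ≠ 0 := h_ne h0 0
    have : g 0 ^ m * a = h 0 * b := by
      apply IsFractionRing.injective R K
      rw [map_mul, map_mul, ← hb]; field_simp
    have h2 : g 0 ^ m * a ∈ 𝔭 := by rw [this]; exact Ideal.mul_mem_right _ _ (hh 0)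
    exact ((Ideal.IsPrime.mem_or_mem ‹_› h2).resolve_left fun hh => hg0 (Ideal.IsPrime.mem_of_pow_mem ‹_› _ hh))
end

/-- the base case, packaged -/
theorem base_main {R T : Type*} [CommRing R] [IsDomain R] [IsNoetherianRing R] [CommRing T] [Algebra R T]
    [IsFractionRing R T] {g h : Fin 4 → R} (hg : Reg4 g) (𝔭 : Ideal R) [𝔭.IsPrime] (hh : ∀ i, h i ∈ 𝔭)
    (h0 : ∀ i, h i ≠ 0) (hgp : ∀ i, ∀ a ∈ 𝔭, ∃ b, g i * a = h i * b) (hg0 : g 0 ∉ 𝔭)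
    (H : ∀ v : Fin 4 → Tˣ, Inv (locS T g) v (locS_mono g) → Triv (locS T g) v) : ∃ a, 𝔭 = Ideal.span {a} := by
  letI : Field T := IsFractionRing.toField R
  exact base_concl (K := T) hg 𝔭 hh h0 hgp hg0 (H _ (base_inv hg 𝔭 hh h0 hgp))
end GrothUFD

namespace GrothUFD
open IsLocalRing RingTheory.Sequence
open scoped Pointwise

section
variable {A : Type*} [CommRing A]

/-- Elementary weak regularity of a list modulo an ideal. -/
def WR : Ideal A → List A → Prop
  | _, [] => True
  | I, x :: l => (∀ a, x * a ∈ I → a ∈ I) ∧ WR (I ⊔ Ideal.span {x}) l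

theorem wr_iff_quot (l : List A) : ∀ I : Ideal A, WR I l ↔ IsWeaklyRegular (A ⧸ I) l := by
  induction l with
  | nil => intro I; simp [WR]
  | cons x l ih =>
    intro I
    rw [WR, isWeaklyRegular_cons_iff, ih]
    refine and_congr ?_ ?_
    · constructor
      · intro h a b hab
        obtain ⟨a, rfl⟩ := Ideal.Quotient.mk_surjective a
        obtain ⟨b, rfl⟩ := Ideal.Quotient.mk_surjective b
        have h1 : Ideal.Quotient.mk I (x * a) = Ideal.Quotient.mk I (x * b) := hab
        rw [Ideal.Quotient.eq] at h1 ⊢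
        apply h; rwa [mul_sub]
      · intro h a ha
        rw [← Ideal.Quotient.eq_zero_iff_mem] at ha ⊢
        apply h
        change Ideal.Quotient.mk I (x * a) = _
        rw [ha]; simp
    · have e1 : (x • ⊤ : Submodule A (A ⧸ I)) = Submodule.map (Submodule.mkQ I) (Ideal.span {x}) := by
        ext y
        obtain ⟨y, rfl⟩ := Ideal.Quotient.mk_surjective y
        simp only [Submodule.mem_map, Ideal.mem_span_singleton', Submodule.mem_smul_pointwise_iff_exists]
        constructor
        · rintro ⟨z, -, hz⟩
          obtain ⟨z, rfl⟩ := Ideal.Quotient.mk_surjective z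
          exact ⟨x * z, ⟨z, mul_comm _ _⟩, hz⟩
        · rintro ⟨_, ⟨z, rfl⟩, hz⟩
          exact ⟨Ideal.Quotient.mk I z, trivial, by rw [← hz, mul_comm]; rfl⟩
      exact ((Submodule.quotEquivOfEq _ _ e1).trans (Submodule.quotientQuotientEquivQuotientSup I (Ideal.span {x}))).isWeaklyRegular_congr l |>.symm

theorem wr_bot_iff (l : List A) : WR (⊥ : Ideal A) l ↔ IsWeaklyRegular A l :=
  (wr_iff_quot l ⊥).trans ((Submodule.quotEquivOfEqBot ⊥ rfl).isWeaklyRegular_congr l)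

theorem comap_sup_span {B : Type*} [CommRing B] (φ : A →+* B) (hφ : Function.Surjective φ) (I : Ideal B) (x : A) :
    (I ⊔ Ideal.span {φ x}).comap φ = I.comap φ ⊔ Ideal.span {x} := by
  ext y
  simp only [Ideal.mem_comap, Submodule.mem_sup, Ideal.mem_span_singleton']
  constructor
  · rintro ⟨i, hi, _, ⟨b, rfl⟩, h⟩
    obtain ⟨b, rfl⟩ := hφ b
    exact ⟨y - b * x, by rw [map_sub, map_mul, ← h]; simpa, b * x, ⟨b, rfl⟩, by ring⟩
  · rintro ⟨i, hi, _, ⟨b, rfl⟩, h⟩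
    exact ⟨φ i, hi, _, ⟨φ b, rfl⟩, by rw [← h]; simp⟩

theorem wr_comap {B : Type*} [CommRing B] (φ : A →+* B) (hφ : Function.Surjective φ) (l : List A) :
    ∀ I : Ideal B, WR (I.comap φ) l ↔ WR I (l.map φ) := by
  induction l with
  | nil => intro I; simp [WR]
  | cons x l ih =>
    intro I
    rw [List.map_cons, WR, WR, ← ih, comap_sup_span φ hφ]
    refine and_congr_left fun _ => ?_
    simp only [Ideal.mem_comap, map_mul]
    rw [hφ.forall]

theorem wr_append (l₁ l₂ : List A) : ∀ I : Ideal A, WR I (l₁ ++ l₂) ↔ WR I l₁ ∧ WR (I ⊔ Ideal.ofList l₁) l₂ := by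
  induction l₁ with
  | nil => intro I; simp [WR]
  | cons x l ih =>
    intro I
    rw [List.cons_append, WR, WR, ih, Ideal.ofList_cons, sup_assoc, and_assoc]

/-- Coset prime avoidance for incomparable primes. -/
theorem coset_avoid (Q : Finset (Ideal A)) (hQ : ∀ P ∈ Q, P.IsPrime) (hinc : ∀ P ∈ Q, ∀ P' ∈ Q, P ≤ P' → P = P')
    (a : A) (I : Ideal A) (h : ∀ P ∈ Q, a ∈ P → ¬ I ≤ P) : ∃ y ∈ I, ∀ P ∈ Q, a + y ∉ P := by
  classical
  let Q1 := Q.filter (fun P => a ∈ P)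
  let K : Ideal A := I ⊓ (Q.filter (fun P => a ∉ P)).inf id
  have hK : ¬ ((K : Set A) ⊆ ⋃ P ∈ (Q1 : Set (Ideal A)), ((id P : Ideal A) : Set A)) := by
    rw [Ideal.subset_union_prime (f := id) ⊥ ⊥ (fun i hi _ _ => hQ i (Finset.mem_filter.1 hi).1)]
    rintro ⟨P, hP, hKP⟩
    have hP' := Finset.mem_filter.1 hP
    have := hQ P hP'.1
    rcases (this.inf_le).1 hKP with h1 | h1
    · exact h P hP'.1 hP'.2 h1
    · obtain ⟨P', hP'', h2⟩ := (this.inf_le').1 h1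
      have h3 := Finset.mem_filter.1 hP''
      have := hinc P' h3.1 P hP'.1 h2
      exact h3.2 (this ▸ hP'.2)
  obtain ⟨y, hyK, hy⟩ := Set.not_subset.1 hK
  refine ⟨y, hyK.1, fun P hP hay => ?_⟩
  simp only [Set.mem_iUnion, not_exists] at hy
  by_cases haP : a ∈ P
  · refine hy P (by exact_mod_cast Finset.mem_filter.2 ⟨hP, haP⟩) ?_
    have := P.sub_mem hay haP
    rwa [add_sub_cancel_left] at this
  · have : y ∈ P := (Finset.inf_le (f := id) (Finset.mem_filter.2 ⟨hP, haP⟩) : _ ≤ P) hyK.2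
    exact haP (by have := P.sub_mem hay this; rwa [add_sub_cancel_right] at this)

theorem ofList_map {B : Type*} [CommRing B] (φ : A →+* B) (l : List A) : (Ideal.ofList l).map φ = Ideal.ofList (l.map φ) := by
  simp [Ideal.map_ofList]

theorem max_quot [IsLocalRing A] (I : Ideal A) [Nontrivial (A ⧸ I)] :
    haveI : IsLocalRing (A ⧸ I) := IsLocalRing.of_surjective' _ Ideal.Quotient.mk_surjective
    maximalIdeal (A ⧸ I) = (maximalIdeal A).map (Ideal.Quotient.mk I) := by
  haveI : IsLocalRing (A ⧸ I) := IsLocalRing.of_surjective' _ Ideal.Quotient.mk_surjective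
  have := IsLocalHom.of_surjective (Ideal.Quotient.mk I) Ideal.Quotient.mk_surjective
  exact (IsLocalRing.map_maximalIdeal_of_surjective _ Ideal.Quotient.mk_surjective).symm
end

theorem quot_span (A : Type*) [CommRing A] [IsLocalRing A] [IsNoetherianRing A] (d : ℕ) (x : A) (l : List A)
    (hm : Ideal.ofList (x :: l) = maximalIdeal A) (hd : ((d + 1 : ℕ) : WithBot ℕ∞) ≤ ringKrullDim A) :
    ∃ _ : IsLocalRing (A ⧸ Ideal.span {x}), Ideal.ofList (l.map (Ideal.Quotient.mk (Ideal.span {x}))) = maximalIdeal (A ⧸ Ideal.span {x}) ∧ (d : WithBot ℕ∞) ≤ ringKrullDim (A ⧸ Ideal.span {x}) := by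
  have hx : x ∈ maximalIdeal A := by rw [← hm]; exact Ideal.subset_span (by simp)
  haveI : Nontrivial (A ⧸ Ideal.span {x}) := Ideal.Quotient.nontrivial_iff.2 (fun h => by
    have := (Ideal.span_singleton_le_iff_mem (maximalIdeal A)).2 hx
    rw [h] at this
    exact Ideal.IsPrime.ne_top' (top_le_iff.1 this))
  haveI : IsLocalRing (A ⧸ Ideal.span {x}) := IsLocalRing.of_surjective' _ Ideal.Quotient.mk_surjective
  refine ⟨this, ?_, ?_⟩
  · rw [max_quot, ← hm, Ideal.ofList_cons, Ideal.map_sup, Ideal.map_quotient_self, bot_sup_eq, ofList_map]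
  · have := ringKrullDim_le_ringKrullDim_quotient_add_card ({x} : Finset A) (by
      intro y hy; simp at hy; subst hy
      rw [IsLocalRing.ringJacobson_eq_maximalIdeal]; exact hx)
    have h2 := hd.trans this
    simp only [Finset.coe_singleton, Finset.card_singleton] at h2
    push_cast at h2
    have h3 := ENat.WithBot.add_le_add_one_right_iff.1 h2
    have e : Ideal.span ((({x} : Finset A)) : Set A) = Ideal.span {x} := by rw [Finset.coe_singleton]
    exact h3.trans (ringKrullDim_eq_of_ringEquiv (Ideal.quotEquivOfEq e)).le

theorem reg_dom (d : ℕ) : ∀ (A : Type u) [CommRing A] [IsLocalRing A] [IsNoetherianRing A] (l : List A), l.length = d →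
    Ideal.ofList l = maximalIdeal A → (d : WithBot ℕ∞) ≤ ringKrullDim A → IsDomain A := by
  induction d with
  | zero =>
    intro A _ _ _ l hl hm _
    rw [List.length_eq_zero_iff] at hl
    subst hl
    rw [Ideal.ofList_nil] at hm
    have := (IsLocalRing.isField_iff_maximalIdeal_eq (R := A)).2 hm.symm
    exact this.isDomain
  | succ d ih =>
    intro A _ _ _ l hl hm hd
    obtain ⟨a, l, rfl⟩ := List.exists_cons_of_length_eq_add_one hl
    have hfin := minimalPrimes.finite_of_isNoetherianRing A
    obtain ⟨y, hy, hav⟩ := coset_avoid hfin.toFinset (fun P hP => (hfin.mem_toFinset.1 hP).1.1)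
      (fun P hP P' hP' h => le_antisymm h ((hfin.mem_toFinset.1 hP').2 (hfin.mem_toFinset.1 hP).1 h))
      a (Ideal.ofList l) (by
        intro P hP haP hlP
        have hP := hfin.mem_toFinset.1 hP
        have := hP.1.1
        have hmP : maximalIdeal A ≤ P := by
          rw [← hm, Ideal.ofList_cons, sup_le_iff, Ideal.span_singleton_le_iff_mem]
          exact ⟨haP, hlP⟩
        have : P = maximalIdeal A := le_antisymm (IsLocalRing.le_maximalIdeal this.ne_top) hmP
        have h0 : (maximalIdeal A).height = 0 := by
          rw [Ideal.height_eq_zero_iff]; rw [← this]; exact hP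
        rw [← IsLocalRing.maximalIdeal_height_eq_ringKrullDim, h0] at hd
        norm_cast at hd)
    have hm' : Ideal.ofList ((a + y) :: l) = maximalIdeal A := by
      rw [← hm, Ideal.ofList_cons, Ideal.ofList_cons]
      apply le_antisymm
      · rw [sup_le_iff, Ideal.span_singleton_le_iff_mem]
        exact ⟨Ideal.add_mem _ (Submodule.mem_sup_left (Ideal.mem_span_singleton_self a)) (Submodule.mem_sup_right hy), le_sup_right⟩
      · rw [sup_le_iff, Ideal.span_singleton_le_iff_mem]
        refine ⟨?_, le_sup_right⟩
        have := Ideal.sub_mem (Ideal.span {a + y} ⊔ Ideal.ofList l) (Submodule.mem_sup_left (Ideal.mem_span_singleton_self (a+y))) (Submodule.mem_sup_right hy)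
        rwa [add_sub_cancel_right] at this
    generalize a + y = x at hm' hav
    have hx : x ∈ maximalIdeal A := by rw [← hm']; exact Ideal.subset_span (by simp)
    obtain ⟨i1, h1, h2⟩ := quot_span A d x l hm' hd
    have := ih (A ⧸ Ideal.span {x}) _ (by simpa using hl) h1 h2
    have hp : (Ideal.span {x}).IsPrime := (Ideal.Quotient.isDomain_iff_prime _).1 this
    obtain ⟨P, hP, hPx⟩ := Ideal.exists_minimalPrimes_le (show (⊥ : Ideal A) ≤ Ideal.span {x} from bot_le)
    have hxP := hav P (hfin.mem_toFinset.2 hP)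
    have hPp := hP.1.1
    have : P = ⊥ := by
      apply Submodule.eq_bot_of_le_smul_of_le_jacobson_bot (Ideal.span {x}) P (IsNoetherian.noetherian P)
      · intro p hp
        obtain ⟨b, rfl⟩ := Ideal.mem_span_singleton.1 (hPx hp)
        have : b ∈ P := (hPp.mem_or_mem hp).resolve_left hxP
        exact Submodule.smul_mem_smul (Ideal.mem_span_singleton_self x) this
      · rw [IsLocalRing.jacobson_eq_maximalIdeal _ bot_ne_top, Ideal.span_singleton_le_iff_mem]; exact hx
    subst this
    exact IsDomain.of_bot_isPrime A

theorem reg_wr (d : ℕ) : ∀ (A : Type u) [CommRing A] [IsLocalRing A] [IsNoetherianRing A] (l : List A), l.length = d →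
    Ideal.ofList l = maximalIdeal A → (d : WithBot ℕ∞) ≤ ringKrullDim A → WR (⊥ : Ideal A) l := by
  induction d with
  | zero =>
    intro A _ _ _ l hl hm _
    rw [List.length_eq_zero_iff] at hl
    subst hl
    simp [WR]
  | succ d ih =>
    intro A _ _ _ l hl hm hd
    have hdom := reg_dom (d+1) A l hl hm hd
    obtain ⟨a, l, rfl⟩ := List.exists_cons_of_length_eq_add_one hl
    obtain ⟨i1, h1, h2⟩ := quot_span A d a l hm hd
    have h3 := ih (A ⧸ Ideal.span {a}) _ (by simpa using hl) h1 h2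
    rw [← wr_comap _ Ideal.Quotient.mk_surjective] at h3
    refine ⟨fun b hb => ?_, ?_⟩
    · have ha : a ≠ 0 := by
        rintro rfl
        rw [Ideal.ofList_cons, Ideal.span_singleton_eq_bot.2 rfl, bot_sup_eq] at hm
        have h4 := hd.trans (ringKrullDim_le_spanFinrank_maximalIdeal A)
        rw [← hm] at h4
        have h5 : (Ideal.ofList l).spanFinrank ≤ l.length := by
          classical
          have := Submodule.spanFinrank_span_le_ncard_of_finite (R := A) (l.toFinset.finite_toSet)
          rw [Set.ncard_coe_finset] at this
          have h6 : Submodule.span A (l.toFinset : Set A) = Ideal.ofList l := by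
            congr 1; ext; simp
          rw [h6] at this
          exact this.trans (List.toFinset_card_le l)
        simp at hl
        have : d + 1 ≤ (Ideal.ofList l).spanFinrank := by exact_mod_cast h4
        omega
      simpa [ha] using hb
    · rw [bot_sup_eq]
      rwa [← RingHom.ker_eq_comap_bot, Ideal.mk_ker] at h3

end GrothUFD

namespace GrothUFD
open IsLocalRing

section
variable {A : Type*} [CommRing A]

/-- Associated primes of `A/I`, elementwise. -/
def AssI (I : Ideal A) : Set (Ideal A) := {q | q.IsPrime ∧ ∃ u, ∀ a, a ∈ q ↔ a * u ∈ I}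

theorem mem_colon_mk (I : Ideal A) (u a : A) :
    a ∈ (⊥ : Submodule A (A ⧸ I)).colon {Ideal.Quotient.mk I u} ↔ a * u ∈ I := by
  rw [Submodule.mem_colon_singleton, Submodule.mem_bot, ← Ideal.Quotient.eq_zero_iff_mem]
  rfl

variable [IsNoetherianRing A]

theorem assI_eq (I : Ideal A) : AssI I = associatedPrimes A (A ⧸ I) := by
  ext q
  rw [AssociatedPrimes.mem_iff, isAssociatedPrime_iff]
  refine and_congr_right fun _ => ?_
  rw [Ideal.Quotient.mk_surjective.exists]
  refine exists_congr fun u => ?_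
  rw [SetLike.ext_iff]
  simp only [mem_colon_mk]

theorem assI_finite (I : Ideal A) : (AssI I).Finite := by
  rw [assI_eq]; exact associatedPrimes.finite A (A ⧸ I)

theorem assI_exists (I : Ideal A) (u : A) (hu : u ∉ I) : ∃ q ∈ AssI I, ∀ a, a * u ∈ I → a ∈ q := by
  obtain ⟨P, hP, h⟩ := exists_le_isAssociatedPrime_of_isNoetherianRing A (Ideal.Quotient.mk I u)
    (by rwa [Ne, Ideal.Quotient.eq_zero_iff_mem])
  refine ⟨P, by rw [assI_eq]; exact hP, fun a ha => h ?_⟩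
  rwa [mem_colon_mk]

theorem reg_of_not_assI (I : Ideal A) (z : A) (hz : ∀ q ∈ AssI I, z ∉ q) (a : A) (h : z * a ∈ I) : a ∈ I := by
  by_contra ha
  obtain ⟨q, hq, h'⟩ := assI_exists I a ha
  exact hz q hq (h' z h)

omit [IsNoetherianRing A] in
theorem not_mem_assI {I q : Ideal A} (hq : q ∈ AssI I) {z : A} (hz : ∀ a, z * a ∈ I → a ∈ I) : z ∉ q := by
  obtain ⟨hp, u, hu⟩ := hq
  intro h
  have := hz u ((hu z).1 h)
  exact hp.ne_top ((Ideal.eq_top_iff_one _).2 ((hu 1).2 (by simpa)))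

/-- Prime avoidance for a finite set of primes. -/
theorem avoid {A : Type*} [CommRing A] (Q : Set (Ideal A)) (hf : Q.Finite) (hQ : ∀ P ∈ Q, P.IsPrime) (I : Ideal A) (h : ∀ P ∈ Q, ¬ I ≤ P) :
    ∃ y ∈ I, ∀ P ∈ Q, y ∉ P := by
  have := (Ideal.subset_union_prime_finite hf (f := id) ⊥ ⊥ (fun i hi _ _ => hQ i hi) (I := I)).not.2 (by
    rintro ⟨P, hP, h'⟩; exact h P hP h')
  obtain ⟨y, hy, hy'⟩ := Set.not_subset.1 this
  refine ⟨y, hy, fun P hP hyP => hy' ?_⟩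
  simp only [Set.mem_iUnion]
  exact ⟨P, hP, hyP⟩

variable [IsLocalRing A]

omit [IsNoetherianRing A] in
/-- Depth at least `n` of `A/I`. -/
def Dep {A : Type*} [CommRing A] [IsLocalRing A] : ℕ → Ideal A → Prop
  | 0, _ => True
  | n + 1, I => ∃ x ∈ maximalIdeal A, (∀ a, x * a ∈ I → a ∈ I) ∧ Dep n (I ⊔ Ideal.span {x})

omit [IsNoetherianRing A] in
theorem dep_of_wr (l : List A) (hl : ∀ x ∈ l, x ∈ maximalIdeal A) : ∀ I, WR I l → Dep l.length I := by
  induction l with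
  | nil => intro I _; trivial
  | cons x l ih =>
    intro I h
    exact ⟨x, hl x (by simp), h.1, ih (fun y hy => hl y (by simp [hy])) _ h.2⟩

omit [IsNoetherianRing A] in
theorem dep_comap {B : Type*} [CommRing B] [IsLocalRing B] (φ : A →+* B) (hφ : Function.Surjective φ) (n : ℕ) :
    ∀ I : Ideal B, Dep n (I.comap φ) → Dep n I := by
  have := IsLocalHom.of_surjective φ hφ
  induction n with
  | zero => intro I _; trivial
  | succ n ih =>
    rintro I ⟨x, hx, h1, h2⟩
    refine ⟨φ x, ?_, ?_, ih _ (by rwa [comap_sup_span φ hφ])⟩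
    · exact (IsLocalRing.map_maximalIdeal_of_surjective φ hφ) ▸ Ideal.mem_map_of_mem φ hx
    · rw [hφ.forall]
      intro a ha
      exact h1 a (by simpa using ha)

omit [IsNoetherianRing A] [IsLocalRing A] in
theorem swap_reg {I : Ideal A} {s z : A} (hs : ∀ a, s * a ∈ I → a ∈ I)
    (hz : ∀ a, z * a ∈ I ⊔ Ideal.span {s} → a ∈ I ⊔ Ideal.span {s}) (a : A) (h : s * a ∈ I ⊔ Ideal.span {z}) :
    a ∈ I ⊔ Ideal.span {z} := by
  simp only [Submodule.mem_sup, Ideal.mem_span_singleton'] at *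
  obtain ⟨i, hi, _, ⟨b, rfl⟩, h⟩ := h
  obtain ⟨i', hi', _, ⟨c, rfl⟩, h'⟩ := hz b ⟨-i, I.neg_mem hi, _, ⟨a, rfl⟩, by linear_combination -h⟩
  refine ⟨a - c * z, hs _ ?_, _, ⟨c, rfl⟩, by ring⟩
  have : s * (a - c * z) = i + z * i' := by linear_combination -h -z * h'
  rw [this]; exact I.add_mem hi (I.mul_mem_left _ hi')

theorem exchange (d : ℕ) : ∀ (I : Ideal A) (y : A), y ∈ maximalIdeal A → (∀ a, y * a ∈ I → a ∈ I) → Dep (d + 1) I →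
    Dep d (I ⊔ Ideal.span {y}) := by
  induction d with
  | zero => intros; trivial
  | succ d ih =>
    rintro I y hym hy ⟨s, hsm, hs, t, htm, ht, hD⟩
    obtain ⟨z, hzm, hz⟩ := avoid (AssI I ∪ AssI (I ⊔ Ideal.span {y}) ∪ AssI (I ⊔ Ideal.span {s}))
      (((assI_finite _).union (assI_finite _)).union (assI_finite _)) (by
        rintro P ((h | h) | h) <;> exact h.1) (maximalIdeal A) (by
        rintro P ((h | h) | h) hmP
        · exact not_mem_assI h hs (hmP hsm)
        · obtain ⟨hp, u, hu⟩ := h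
          apply hp.ne_top
          rw [Ideal.eq_top_iff_one, hu, one_mul]
          have h1 := (hu s).1 (hmP hsm)
          have h2 := (hu t).1 (hmP htm)
          simp only [Submodule.mem_sup, Ideal.mem_span_singleton'] at h1 h2 ht ⊢
          obtain ⟨i, hi, _, ⟨w, rfl⟩, h1⟩ := h1
          obtain ⟨j, hj, _, ⟨v, rfl⟩, h2⟩ := h2
          obtain ⟨k, hk, _, ⟨w', rfl⟩, h3⟩ := ht w ⟨t * w - s * v, hy _ (by
            have : y * (t * w - s * v) = s * j - t * i := by linear_combination t * h1 - s * h2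
            rw [this]; exact I.sub_mem (I.mul_mem_left _ hj) (I.mul_mem_left _ hi)), _, ⟨v, rfl⟩, by ring⟩
          refine ⟨u - w' * y, hs _ ?_, _, ⟨w', rfl⟩, by ring⟩
          have : s * (u - w' * y) = i + y * k := by linear_combination -h1 - y * h3
          rw [this]; exact I.add_mem hi (I.mul_mem_left _ hk)
        · exact not_mem_assI h ht (hmP htm))
    have hz1 := reg_of_not_assI I z (fun q hq => hz q (Or.inl (Or.inl hq)))
    have hz2 := reg_of_not_assI _ z (fun q hq => hz q (Or.inl (Or.inr hq)))
    have hz3 := reg_of_not_assI _ z (fun q hq => hz q (Or.inr hq))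
    have h1 : Dep d (I ⊔ Ideal.span {s} ⊔ Ideal.span {z}) := ih _ z hzm hz3 ⟨t, htm, ht, hD⟩
    have h2 : Dep (d + 1) (I ⊔ Ideal.span {z}) :=
      ⟨s, hsm, swap_reg hs hz3, by rwa [sup_right_comm]⟩
    exact ⟨z, hzm, hz2, by rw [sup_right_comm]; exact ih _ y hym (swap_reg hy hz2) h2⟩

theorem dep_quot (l : List A) (hl : ∀ x ∈ l, x ∈ maximalIdeal A) : ∀ (n : ℕ) (I : Ideal A), WR I l → Dep (n + l.length) I →
    Dep n (I ⊔ Ideal.ofList l) := by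
  induction l with
  | nil => intro n I _ h; simpa using h
  | cons x l ih =>
    intro n I h hd
    rw [Ideal.ofList_cons, ← sup_assoc]
    exact ih (fun y hy => hl y (by simp [hy])) n _ h.2 (exchange _ I x (hl x (by simp)) h.1 (by simpa [add_assoc] using hd))

theorem ass_coheight (n : ℕ) : ∀ (I : Ideal A) (q : Ideal A) (hq : q ∈ AssI I), Dep n I →
    (n : ℕ∞) ≤ Order.coheight (⟨q, hq.1⟩ : PrimeSpectrum A) := by
  induction n with
  | zero => intros; simp
  | succ n ih =>
    rintro I q hq ⟨x, hxm, hx, hD⟩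
    have hxq := not_mem_assI hq hx
    let N : Ideal A := 
      { carrier := {w | ∀ a ∈ q, a * w ∈ I}
        add_mem' := fun {v w} hv hw a ha => by rw [mul_add]; exact I.add_mem (hv a ha) (hw a ha)
        zero_mem' := fun a _ => by simp
        smul_mem' := fun c w hw a ha => by
          rw [smul_eq_mul, mul_left_comm]; exact I.mul_mem_left _ (hw a ha) }
    have hN : ¬ N ≤ I ⊔ Ideal.span {x} := by
      intro h
      have : N ≤ I := by
        apply Submodule.le_of_le_smul_of_le_jacobson_bot (I := Ideal.span {x}) (IsNoetherian.noetherian N)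
        · rw [IsLocalRing.jacobson_eq_maximalIdeal _ bot_ne_top, Ideal.span_singleton_le_iff_mem]; exact hxm
        · intro w hw
          obtain ⟨i, hi, v, hv, rfl⟩ := Submodule.mem_sup.1 (h hw)
          obtain ⟨b, rfl⟩ := Ideal.mem_span_singleton.1 hv
          refine Submodule.add_mem_sup hi (Submodule.smul_mem_smul (Ideal.mem_span_singleton_self x) ?_)
          intro a ha
          apply hx
          have h1 := hw a ha
          have : x * (a * b) = a * (i + x * b) - a * i := by ring
          rw [this]; exact I.sub_mem h1 (I.mul_mem_left _ hi)
      obtain ⟨hp, u, hu⟩ := hq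
      apply hp.ne_top
      rw [Ideal.eq_top_iff_one, hu, one_mul]
      exact this fun a ha => (hu a).1 ha
    obtain ⟨w, hw, hwx⟩ := Set.not_subset.1 hN
    obtain ⟨q', hq', h'⟩ := assI_exists _ w hwx
    have hqq : q ≤ q' := fun a ha => h' a (Submodule.mem_sup_left (hw a ha))
    have hxq' : x ∈ q' := h' x (Submodule.mem_sup_right (Ideal.mul_mem_right _ _ (Ideal.mem_span_singleton_self x)))
    have h1 := ih _ q' hq' hD
    have : (⟨q, hq.1⟩ : PrimeSpectrum A) < ⟨q', hq'.1⟩ := by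
      rw [← PrimeSpectrum.asIdeal_lt_asIdeal]
      exact lt_of_le_of_ne hqq (fun h => hxq (by change q = q' at h; rw [h]; exact hxq'))
    refine le_trans ?_ (Order.coheight_add_one_le this)
    push_cast
    gcongr

theorem ass_height {e : ℕ} (he : ringKrullDim A ≤ e) (hD : Dep e (⊥ : Ideal A)) (l : List A) (hl : ∀ x ∈ l, x ∈ maximalIdeal A)
    (hw : WR (⊥ : Ideal A) l) (q : Ideal A) (hq : q ∈ AssI (Ideal.ofList l)) :
    Order.height (⟨q, hq.1⟩ : PrimeSpectrum A) ≤ l.length := by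
  have h1 : Order.height (⟨q, hq.1⟩ : PrimeSpectrum A) + Order.coheight (⟨q, hq.1⟩ : PrimeSpectrum A) ≤ e := by
    have : ((Order.height (⟨q, hq.1⟩ : PrimeSpectrum A) + Order.coheight (⟨q, hq.1⟩ : PrimeSpectrum A) : ℕ∞) : WithBot ℕ∞) ≤ e := by
      refine le_trans ?_ he
      rw [ringKrullDim, Order.krullDim_eq_iSup_height_add_coheight_of_nonempty]
      exact WithBot.coe_le_coe.2 (le_iSup (fun a => Order.height a + Order.coheight a) (⟨q, hq.1⟩ : PrimeSpectrum A))
    exact_mod_cast this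
  rcases le_total l.length e with h | h
  · obtain ⟨n, rfl⟩ := Nat.exists_eq_add_of_le' h
    have h2 := dep_quot l hl n ⊥ hw hD
    rw [bot_sup_eq] at h2
    have h3 := ass_coheight n _ q hq h2
    have h4 := (add_le_add_right h3 (Order.height (⟨q, hq.1⟩ : PrimeSpectrum A))).trans h1
    push_cast at h4
    rw [add_comm] at h4
    exact (ENat.add_le_add_iff_left (ENat.natCast_ne_top n)).1 h4
  · exact (le_self_add.trans h1).trans (by exact_mod_cast h)

end
end GrothUFD

namespace GrothUFD
open IsLocalRing RingTheory.Sequence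

section
variable {R : Type*} [CommRing R]

/-- the colon ideal `(h : p)`. -/
def PC (p : Ideal R) (h : R) : Ideal R where
  carrier := {g | ∀ a ∈ p, ∃ b, g * a = h * b}
  add_mem' := by
    intro x y hx hy a ha
    obtain ⟨b, hb⟩ := hx a ha
    obtain ⟨c, hc⟩ := hy a ha
    exact ⟨b + c, by rw [add_mul, hb, hc]; ring⟩
  zero_mem' := fun a _ => ⟨0, by simp⟩
  smul_mem' := by
    intro c x hx a ha
    obtain ⟨b, hb⟩ := hx a ha
    exact ⟨c * b, by rw [smul_eq_mul, mul_assoc, hb]; ring⟩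

theorem mem_PC {p : Ideal R} {h g : R} : g ∈ PC p h ↔ ∀ a ∈ p, ∃ b, g * a = h * b := Iff.rfl

/-- combine local generators. -/
theorem combine (p : Ideal R) (Q : Finset (Ideal R)) (hQ : ∀ q ∈ Q, q.IsPrime) (hinc : ∀ P ∈ Q, ∀ P' ∈ Q, P ≤ P' → P = P')
    (hloc : ∀ q ∈ Q, ∃ h ∈ p, ¬ PC p h ≤ q) : ∃ h ∈ p, ∀ q ∈ Q, ¬ PC p h ≤ q := by
  classical
  have hc : ∀ q ∈ Q, ∃ c, c ∉ q ∧ ∀ q' ∈ Q, q' ≠ q → c ∈ q' := by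
    intro q hq
    have := hQ q hq
    have : ¬ (Q.erase q).inf id ≤ q := by
      intro h
      obtain ⟨q', hq', h⟩ := this.inf_le'.1 h
      rw [Finset.mem_erase] at hq'
      exact hq'.1 (hinc q' hq'.2 q hq h)
    obtain ⟨c, hc, hcq⟩ := Set.not_subset.1 this
    exact ⟨c, hcq, fun q' hq' hne => (Finset.inf_le (f := id) (Finset.mem_erase.2 ⟨hne, hq'⟩) : _ ≤ q') hc⟩
  choose! c hc1 hc2 using hc
  choose! h hh1 hh2 using hloc
  refine ⟨∑ q ∈ Q, c q * h q, Ideal.sum_mem _ fun q hq => p.mul_mem_left _ (hh1 q hq), fun q hq hle => ?_⟩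
  obtain ⟨g, hg, hgq⟩ := Set.not_subset.1 (hh2 q hq)
  have hp := hQ q hq
  have : ∀ q', ∃ b, q' ∈ Q → g * h q' = h q * b := by
    intro q'
    by_cases hq' : q' ∈ Q
    · obtain ⟨b, hb⟩ := mem_PC.1 hg (h q') (hh1 q' hq'); exact ⟨b, fun _ => hb⟩
    · exact ⟨0, fun h => (hq' h).elim⟩
  choose b hb using this
  let w := c q * g + ∑ q' ∈ Q.erase q, c q' * b q'
  have hw : g * ∑ q ∈ Q, c q * h q = h q * w := by
    rw [← Finset.add_sum_erase Q _ hq]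
    simp only [w, mul_add, Finset.mul_sum]
    congr 1
    · ring
    · refine Finset.sum_congr rfl fun q' hq' => ?_
      have := hb q' (Finset.mem_of_mem_erase hq')
      linear_combination c q' * this
  have hwq : w ∉ q := by
    intro hwq
    have h2 : ∑ q' ∈ Q.erase q, c q' * b q' ∈ q := Ideal.sum_mem _ fun q' hq' => by
      rw [Finset.mem_erase] at hq'
      exact q.mul_mem_right _ (hc2 q' hq'.2 q hq (Ne.symm hq'.1))
    have h3 := q.sub_mem hwq h2
    simp only [w, add_sub_cancel_right] at h3
    exact (hp.mem_or_mem h3).elim (hc1 q hq) hgq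
  have : w * g ∈ PC p (∑ q ∈ Q, c q * h q) := by
    intro a ha
    obtain ⟨b', hb'⟩ := mem_PC.1 hg a ha
    refine ⟨g * b', ?_⟩
    linear_combination w * hb' - b' * hw
  exact (hp.mem_or_mem (hle this)).elim hwq hgq

theorem combine' (p : Ideal R) (Q : Set (Ideal R)) (hf : Q.Finite) (hQ : ∀ q ∈ Q, q.IsPrime) 
    (hloc : ∀ q ∈ Q, ∃ h ∈ p, ¬ PC p h ≤ q) : ∃ h ∈ p, ∀ q ∈ Q, ¬ PC p h ≤ q := by
  have hf' : {q | Maximal (· ∈ Q) q}.Finite := hf.subset fun q hq => hq.1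
  obtain ⟨h, hp, hh⟩ := combine p hf'.toFinset (fun q hq => hQ q (hf'.mem_toFinset.1 hq).1) (by
    intro P hP P' hP' h
    exact le_antisymm h ((hf'.mem_toFinset.1 hP).2 (hf'.mem_toFinset.1 hP').1 h))
    (fun q hq => hloc q (hf'.mem_toFinset.1 hq).1)
  refine ⟨h, hp, fun q hq hle => ?_⟩
  obtain ⟨q', h1, h2⟩ := hf.exists_le_maximal hq
  exact hh q' (hf'.mem_toFinset.2 h2) (hle.trans h1)

variable [IsDomain R] [IsNoetherianRing R]

theorem local_gen (p : Ideal R) (hp : p.IsPrime) (hp0 : p ≠ ⊥) (hmin : ∀ q : Ideal R, q.IsPrime → q ≠ ⊥ → q ≤ p → q = p)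
    (q : Ideal R) [hq : q.IsPrime] [UniqueFactorizationMonoid (Localization.AtPrime q)] : ∃ h ∈ p, ¬ PC p h ≤ q := by
  by_cases hpq : p ≤ q
  · have hdis : Disjoint (q.primeCompl : Set R) (p : Set R) := by
      rw [Set.disjoint_left]; intro x hx hxp; exact hx (hpq hxp)
    let L := Localization.AtPrime q
    have hinj : Function.Injective (algebraMap R L) := IsLocalization.injective L q.primeCompl_le_nonZeroDivisors
    have h1 : (p.map (algebraMap R L)).IsPrime := IsLocalization.isPrime_of_isPrime_disjoint q.primeCompl L p hp hdis
    have hcm := IsLocalization.under_map_of_isPrime_disjoint q.primeCompl L hp hdis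
    have h2 : p.map (algebraMap R L) ≠ ⊥ := by
      rw [Ne, Ideal.map_eq_bot_iff_of_injective hinj]; exact hp0
    obtain ⟨π, hπ, hπp⟩ := h1.exists_mem_prime_of_ne_bot h2
    have h3 : (Ideal.span {π}).IsPrime := (Ideal.span_singleton_prime hπp.ne_zero).2 hπp
    obtain ⟨x, s, rfl⟩ := IsLocalization.exists_mk'_eq q.primeCompl π
    have hs : algebraMap R L x = IsLocalization.mk' L x s * algebraMap R L s := (IsLocalization.mk'_spec L x s).symm
    have hle : Ideal.span {IsLocalization.mk' L x s} ≤ p.map (algebraMap R L) := (Ideal.span_singleton_le_iff_mem _).2 hπ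
    have hx0 : x ≠ 0 := by
      rintro rfl
      exact hπp.ne_zero (by simp)
    have hxc : x ∈ (Ideal.span {IsLocalization.mk' L x s}).comap (algebraMap R L) := by
      rw [Ideal.mem_comap, hs]
      exact Ideal.mul_mem_right _ _ (Ideal.mem_span_singleton_self _)
    have h4 : (Ideal.span {IsLocalization.mk' L x s}).comap (algebraMap R L) = p := by
      apply hmin _ (Ideal.IsPrime.comap _)
      · intro h; rw [h] at hxc; exact hx0 hxc
      · have := Ideal.comap_mono (f := algebraMap R L) hle
        rw [Ideal.under_def] at hcm
        rwa [hcm] at this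
    refine ⟨x, h4 ▸ hxc, ?_⟩
    have h5 : ∀ a ∈ p, ∃ t, t ∉ q ∧ ∃ b, t * a = x * b := by
      intro a ha
      rw [← h4, Ideal.mem_comap, Ideal.mem_span_singleton] at ha
      obtain ⟨y, hy⟩ := ha
      obtain ⟨b, t, rfl⟩ := IsLocalization.exists_mk'_eq q.primeCompl y
      refine ⟨s * t, fun h => (hq.mem_or_mem h).elim s.2 t.2, b, hinj ?_⟩
      have ht : algebraMap R L b = IsLocalization.mk' L b t * algebraMap R L t := (IsLocalization.mk'_spec L b t).symm
      rw [map_mul, map_mul, map_mul, hy, hs, ht]; ring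
    choose! t ht1 ht2 using h5
    obtain ⟨S, hS⟩ := IsNoetherian.noetherian p
    have hSp : ∀ a ∈ S, a ∈ p := fun a ha => hS ▸ Submodule.subset_span ha
    intro hle
    have : ∏ a ∈ S, t a ∈ PC p x := by
      intro a ha
      have : p ≤ Submodule.comap (LinearMap.mulLeft R (∏ a ∈ S, t a)) (Ideal.span {x}) := by
        rw [← hS, Submodule.span_le]
        intro a ha
        change (∏ a ∈ S, t a) * a ∈ Ideal.span {x}
        obtain ⟨b, hb⟩ := ht2 a (hSp a ha)
        rw [Ideal.mem_span_singleton]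
        classical
        rw [← Finset.mul_prod_erase S t ha]
        exact ⟨(∏ a ∈ S.erase a, t a) * b, by linear_combination (∏ a ∈ S.erase a, t a) * hb⟩
      exact Ideal.mem_span_singleton.1 (this ha)
    obtain ⟨a, ha, h6⟩ := (hq.prod_mem_iff).1 (hle this)
    exact ht1 a (hSp a ha) h6
  · obtain ⟨h, hh, hhq⟩ := Set.not_subset.1 hpq
    exact ⟨h, hh, fun hle => hhq (hle fun a _ => ⟨a, rfl⟩)⟩

theorem choose_step [IsLocalRing R] {e : ℕ} (he : ringKrullDim R ≤ e) (hD : Dep e (⊥ : Ideal R))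
    (hUFD : ∀ (P : Ideal R) (hP : P.IsPrime), Order.height (⟨P, hP⟩ : PrimeSpectrum R) ≤ 3 → UniqueFactorizationMonoid (Localization.AtPrime P))
    (p : Ideal R) (hp : p.IsPrime) (hp0 : p ≠ ⊥) (hmin : ∀ q : Ideal R, q.IsPrime → q ≠ ⊥ → q ≤ p → q = p)
    (hp1 : Order.height (⟨p, hp⟩ : PrimeSpectrum R) ≤ 3)
    (hnp : ¬ ∃ a, p = Ideal.span {a})
    (l : List R) (hl : ∀ x ∈ l, x ∈ maximalIdeal R) (hw : WR (⊥ : Ideal R) l) (hlen : l.length ≤ 3) :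
    ∃ g ∈ maximalIdeal R, WR (⊥ : Ideal R) (l ++ [g]) ∧ g ∉ p ∧ ∃ h ∈ p, h ≠ 0 ∧ ∀ a ∈ p, ∃ b, g * a = h * b := by
  have hQ : ∀ q ∈ AssI (Ideal.ofList l) ∪ {p}, q.IsPrime := by
    rintro q (h | h)
    · exact h.1
    · rw [Set.mem_singleton_iff.1 h]; exact hp
  have hQf : (AssI (Ideal.ofList l) ∪ {p}).Finite := (assI_finite _).union (Set.finite_singleton _)
  obtain ⟨h, hh, hh2⟩ := combine' p _ hQf hQ (by
    rintro q hq
    have := hQ q hq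
    have := hUFD q this (by
      rcases hq with h | h
      · exact (ass_height he hD l hl hw q h).trans (by exact_mod_cast hlen)
      · rw [Set.mem_singleton_iff] at h; subst h; exact hp1)
    exact local_gen p hp hp0 hmin q)
  obtain ⟨g, hg, hgQ⟩ := avoid _ hQf hQ (PC p h) hh2
  have hgp := hgQ p (Or.inr rfl)
  have hg0 : g ≠ 0 := fun h => hgp (h ▸ p.zero_mem)
  obtain ⟨a, ha, ha0⟩ := Submodule.exists_mem_ne_zero_of_ne_bot hp0
  refine ⟨g, ?_, ?_, hgp, h, hh, ?_, hg⟩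
  · rw [IsLocalRing.mem_maximalIdeal, mem_nonunits_iff]
    intro hu
    refine hnp ⟨h, le_antisymm ?_ ((Ideal.span_singleton_le_iff_mem _).2 hh)⟩
    intro a ha
    obtain ⟨b, hb⟩ := mem_PC.1 hg a ha
    obtain ⟨u, rfl⟩ := hu
    rw [Ideal.mem_span_singleton]
    refine ⟨(u⁻¹ : Rˣ) * b, ?_⟩
    rw [mul_left_comm, ← hb]; simp
  · rw [wr_append, bot_sup_eq]
    exact ⟨hw, reg_of_not_assI _ g fun q hq => hgQ q (Or.inl hq), trivial⟩
  · rintro rfl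
    obtain ⟨b, hb⟩ := mem_PC.1 hg a ha
    rw [zero_mul] at hb
    exact (mul_ne_zero hg0 ha0) hb

omit [IsDomain R] in
theorem wr_pow [IsLocalRing R] (l : List R) (g : R) (N : ℕ) (hl : ∀ x ∈ g :: l, x ∈ maximalIdeal R)
    (hN : N ≠ 0) (h : WR (⊥ : Ideal R) (g :: l)) : WR (⊥ : Ideal R) (l ++ [g ^ N]) := by
  have h1 : WR (⊥ : Ideal R) (l ++ [g]) := by
    rw [wr_bot_iff] at h ⊢
    exact IsLocalRing.isWeaklyRegular_of_perm_of_subset_maximalIdeal h (List.perm_append_singleton g l).symm hl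
  rw [wr_append] at h1 ⊢
  refine ⟨h1.1, ?_, trivial⟩
  have h2 := h1.2.1
  intro a
  clear hN
  induction N generalizing a with
  | zero => simp
  | succ N ih => intro ha; exact ih a (h2 _ (by rwa [← mul_assoc, ← pow_succ']))

omit [IsDomain R] in
theorem reg4_of_wr [IsLocalRing R] (g : Fin 4 → R) (hg0 : ∀ i, g i ≠ 0) (hm : ∀ i, g i ∈ maximalIdeal R)
    (hw : WR (⊥ : Ideal R) [g 0, g 1, g 2, g 3]) : Reg4 g := by
  have key : ∀ N, N ≠ 0 → WR (⊥ : Ideal R) [g 0 ^ N, g 1 ^ N, g 2 ^ N, g 3 ^ N] := by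
    intro N hN
    have hmN : ∀ i, g i ^ N ∈ maximalIdeal R := fun i => Ideal.pow_mem_of_mem _ (hm i) N (Nat.pos_of_ne_zero hN)
    have h1 := wr_pow [g 1, g 2, g 3] (g 0) N (by simp [-IsLocalRing.mem_maximalIdeal, hm]) hN hw
    have h2 := wr_pow [g 2, g 3, g 0 ^ N] (g 1) N (by simp [-IsLocalRing.mem_maximalIdeal, hm, hmN]) hN h1
    have h3 := wr_pow [g 3, g 0 ^ N, g 1 ^ N] (g 2) N (by simp [-IsLocalRing.mem_maximalIdeal, hm, hmN]) hN h2
    exact wr_pow [g 0 ^ N, g 1 ^ N, g 2 ^ N] (g 3) N (by simp [-IsLocalRing.mem_maximalIdeal, hm, hmN]) hN h3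
  refine ⟨hg0, fun N a b h => ?_, fun N a b c h => ?_, fun N a b c d h => ?_⟩
  · rcases eq_or_ne N 0 with rfl | hN
    · exact ⟨a, by simp⟩
    have := (key N hN).2.1 a
    simp only [bot_sup_eq, Ideal.mem_span_singleton'] at this
    obtain ⟨c, hc⟩ := this ⟨b, by rw [h]; ring⟩
    exact ⟨c, by rw [← hc]; ring⟩
  · rcases eq_or_ne N 0 with rfl | hN
    · exact ⟨a, 0, by simp⟩
    have := (key N hN).2.2.1 a
    simp only [bot_sup_eq, Submodule.mem_sup, Ideal.mem_span_singleton'] at this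
    obtain ⟨_, ⟨c, rfl⟩, _, ⟨d, rfl⟩, hc⟩ := this ⟨_, ⟨b, rfl⟩, _, ⟨c, rfl⟩, by rw [h]; ring⟩
    exact ⟨c, d, by rw [← hc]; ring⟩
  · rcases eq_or_ne N 0 with rfl | hN
    · exact ⟨a, 0, 0, by simp⟩
    have := (key N hN).2.2.2.1 a
    simp only [bot_sup_eq, Submodule.mem_sup, Ideal.mem_span_singleton'] at this
    obtain ⟨_, ⟨_, ⟨c, rfl⟩, _, ⟨d, rfl⟩, rfl⟩, _, ⟨d', rfl⟩, hc⟩ := this ⟨_, ⟨_, ⟨b, rfl⟩, _, ⟨c, rfl⟩, rfl⟩, _, ⟨d, rfl⟩, by rw [h]; ring⟩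
    exact ⟨c, d, d', by rw [← hc]; ring⟩

theorem choose_gh [IsLocalRing R] {e : ℕ} (he : ringKrullDim R ≤ e) (hD : Dep e (⊥ : Ideal R))
    (hUFD : ∀ (P : Ideal R) (hP : P.IsPrime), Order.height (⟨P, hP⟩ : PrimeSpectrum R) ≤ 3 → UniqueFactorizationMonoid (Localization.AtPrime P))
    (p : Ideal R) (hp : p.IsPrime) (hp0 : p ≠ ⊥) (hmin : ∀ q : Ideal R, q.IsPrime → q ≠ ⊥ → q ≤ p → q = p)
    (hp1 : Order.height (⟨p, hp⟩ : PrimeSpectrum R) ≤ 3)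
    (hnp : ¬ ∃ a, p = Ideal.span {a}) :
    ∃ g h : Fin 4 → R, Reg4 g ∧ (∀ i, h i ∈ p) ∧ (∀ i, h i ≠ 0) ∧ (∀ i, ∀ a ∈ p, ∃ b, g i * a = h i * b) ∧ g 0 ∉ p := by
  have st := choose_step he hD hUFD p hp hp0 hmin hp1 hnp
  obtain ⟨g0, m0, w0, n0, h0, hp0', h00, hb0⟩ := st [] (by simp) trivial (by simp)
  obtain ⟨g1, m1, w1, n1, h1, hp1', h10, hb1⟩ := st [g0] (by simpa using m0) w0 (by simp)
  obtain ⟨g2, m2, w2, n2, h2, hp2', h20, hb2⟩ := st [g0, g1] (by simp [-IsLocalRing.mem_maximalIdeal, m0, m1]) w1 (by simp)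
  obtain ⟨g3, m3, w3, n3, h3, hp3', h30, hb3⟩ := st [g0, g1, g2] (by simp [-IsLocalRing.mem_maximalIdeal, m0, m1, m2]) w2 (by simp)
  refine ⟨![g0, g1, g2, g3], ![h0, h1, h2, h3], reg4_of_wr _ ?_ ?_ w3, ?_, ?_, ?_, n0⟩
  · have : ∀ g, g ∉ p → g ≠ 0 := fun g h h' => h (h' ▸ p.zero_mem)
    intro i; fin_cases i
    exacts [this _ n0, this _ n1, this _ n2, this _ n3]
  all_goals intro i; fin_cases i
  exacts [m0, m1, m2, m3, hp0', hp1', hp2', hp3', h00, h10, h20, h30, hb0, hb1, hb2, hb3]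

end
end GrothUFD

namespace GrothUFD
open Finset

section tel
variable {C : Type*} [CommRing C]

/-- telescopic completeness along `x`. -/
def Tel (C : Type*) [CommRing C] (x : C) : Prop :=
  (∀ b : ℕ → C, ∃ s : ℕ → C, ∀ i, s i = b i + x * s (i + 1)) ∧
  (∀ s : ℕ → C, (∀ i, s i = x * s (i + 1)) → ∀ i, s i = 0)

theorem Tel.quot {x : C} (h : Tel C x) {y : C} (hy : ∀ a, y * a = 0 → a = 0) :
    Tel (C ⧸ Ideal.span {y}) (Ideal.Quotient.mk _ x) := by
  constructor
  · intro b
    choose b' hb' using fun i => Ideal.Quotient.mk_surjective (b i)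
    obtain ⟨s, hs⟩ := h.1 b'
    refine ⟨fun i => Ideal.Quotient.mk _ (s i), fun i => ?_⟩
    change Ideal.Quotient.mk _ (s i) = b i + Ideal.Quotient.mk _ x * Ideal.Quotient.mk _ (s (i + 1))
    rw [← hb', ← map_mul, ← map_add, ← hs i]
  · intro s hs
    choose s' hs' using fun i => Ideal.Quotient.mk_surjective (s i)
    have : ∀ i, ∃ t, s' i - x * s' (i + 1) = y * t := by
      intro i
      have := hs i
      rw [← hs', ← hs', ← map_mul, Ideal.Quotient.eq, Ideal.mem_span_singleton] at this
      exact this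
    choose t ht using this
    obtain ⟨u, hu⟩ := h.1 t
    have := h.2 (fun i => s' i - y * u i) (fun i => by
      linear_combination ht i - y * hu i)
    intro i
    rw [← hs', Ideal.Quotient.eq_zero_iff_mem, Ideal.mem_span_singleton]
    exact ⟨u i, sub_eq_zero.1 (this i)⟩

theorem Tel.haus {x : C} (h : Tel C x) (hx : ∀ a, x * a = 0 → a = 0) : Haus C x := by
  intro w hw
  choose u hu using hw
  have hxn : ∀ n a, x ^ n * a = 0 → a = 0 := by
    intro n
    induction n with
    | zero => intro a; simp
    | succ n ih => intro a ha; exact ih a (hx _ (by rw [← mul_assoc, ← pow_succ']; exact ha))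
  have := h.2 u (fun i => by
    apply sub_eq_zero.1
    apply hxn i
    have h1 := hu i
    have h2 := hu (i + 1)
    rw [smul_eq_mul] at h1 h2
    linear_combination h2 - h1)
  rw [hu 0, this 0]; simp

theorem Tel.sum_eq {x : C} {b s : ℕ → C} (hs : ∀ i, s i = b i + x * s (i + 1)) (n : ℕ) :
    s 0 = ∑ i ∈ range n, x ^ i * b i + x ^ n * s n := by
  induction n with
  | zero => simp
  | succ n ih => rw [ih, sum_range_succ, hs n]; ring

theorem Tel.jac {x : C} (h : Tel C x) : x ∈ Ideal.jacobson (⊥ : Ideal C) := by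
  rw [Ideal.mem_jacobson_bot]
  intro y
  obtain ⟨s, hs⟩ := h.1 (fun i => (-y) ^ i)
  have := h.2 (fun i => s (i + 1) + y * s i) (fun i => by
    linear_combination hs (i + 1) + y * hs i) 0
  simp only [zero_add] at this
  have h0 := hs 0
  exact IsUnit.of_mul_eq_one (s 0) (by simp only [pow_zero, zero_add] at h0; linear_combination h0 + x * this)

theorem tel_of_complete {B : Type*} [CommRing B] [Algebra B C] (I : Ideal B) [IsAdicComplete I C] {x : B} (hx : x ∈ I) :
    Tel C (algebraMap B C x) := by
  have hp : ∀ n (c : C), (algebraMap B C x) ^ n * c ∈ (I ^ n • ⊤ : Submodule B C) := by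
    intro n c
    rw [← map_pow, ← Algebra.smul_def]
    exact Submodule.smul_mem_smul (Ideal.pow_mem_pow hx n) trivial
  have hH : ∀ c : C, (∀ n, c ∈ (I ^ n • ⊤ : Submodule B C)) → c = 0 := by
    intro c hc
    refine IsHausdorff.haus (inferInstance : IsHausdorff I C) c fun n => ?_
    rw [SModEq.zero]; exact hc n
  constructor
  · intro b
    let f : ℕ → ℕ → C := fun i n => ∑ j ∈ range n, (algebraMap B C x) ^ j * b (i + j)
    have hf : ∀ i, ∃ L : C, ∀ n, f i n ≡ L [SMOD (I ^ n • ⊤ : Submodule B C)] := by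
      intro i
      apply IsPrecomplete.prec (inferInstance : IsPrecomplete I C)
      intro m n hmn
      rw [SModEq.comm, SModEq.sub_mem]
      obtain ⟨k, rfl⟩ := Nat.exists_eq_add_of_le hmn
      have : f i (m + k) - f i m = (algebraMap B C x) ^ m * ∑ j ∈ range k, (algebraMap B C x) ^ j * b (i + (m + j)) := by
        simp only [f]
        rw [sum_range_add, add_sub_cancel_left, mul_sum]
        refine sum_congr rfl fun j _ => by rw [pow_add, mul_assoc]
      rw [this]; exact hp _ _
    choose L hL using hf
    refine ⟨L, fun i => sub_eq_zero.1 (hH _ fun n => ?_)⟩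
    have h1 := (SModEq.sub_mem.1 (hL i (n + 1)))
    have h2 := (SModEq.sub_mem.1 (hL (i + 1) n))
    have h3 : f i (n + 1) = b i + algebraMap B C x * f (i + 1) n := by
      simp only [f]
      rw [sum_range_succ', mul_sum, add_comm]
      congr 1
      · simp
      · refine sum_congr rfl fun j _ => ?_
        rw [show i + 1 + j = i + (j + 1) by ring]; ring
    have h1' : f i (n + 1) - L i ∈ (I ^ n • ⊤ : Submodule B C) :=
      Submodule.smul_mono_left (Ideal.pow_le_pow_right (Nat.le_succ n)) h1
    have h2' : x • (f (i + 1) n - L (i + 1)) ∈ (I ^ n • ⊤ : Submodule B C) := Submodule.smul_mem _ _ h2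
    have : L i - (b i + algebraMap B C x * L (i + 1)) = x • (f (i + 1) n - L (i + 1)) - (f i (n + 1) - L i) := by
      rw [Algebra.smul_def, h3]; ring
    rw [this]; exact Submodule.sub_mem _ h2' h1'
  · intro s hs i
    have : ∀ n i, s i = (algebraMap B C x) ^ n * s (i + n) := by
      intro n
      induction n with
      | zero => simp
      | succ n ih => intro i; rw [ih, hs (i + n)]; ring_nf
    exact hH _ fun n => by rw [this n i]; exact hp _ _
end tel
end GrothUFD

namespace GrothUFD
open Finset

section tow
variable {ι : Type*} {A : Type*} [CommRing A]

/-- tower data. -/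
structure Tow {T : Type*} [CommRing T] {C : Finset ι → Type*} [∀ σ, CommRing (C σ)]
    (xs : List A) (α : A →+* T) (γ : ∀ σ, A →+* C σ) (ψ : ∀ σ, C σ →+* T) : Prop where
  comp : ∀ σ a, ψ σ (γ σ a) = α a
  telT : ∀ x ∈ xs, Tel T (α x)
  telC : ∀ σ, ∀ x ∈ xs, Tel (C σ) (γ σ x)
  wrT : WR ⊥ (xs.map α)
  wrC : ∀ σ, WR ⊥ (xs.map (γ σ))
  inj : ∀ σ c, ψ σ c ∈ Ideal.ofList (xs.map α) → c ∈ Ideal.ofList (xs.map (γ σ))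
  mono : Monotone fun σ => (ψ σ).range

theorem wr_quot_cons {T : Type*} [CommRing T] (α : A →+* T) (x : A) (xs : List A) (h : WR ⊥ ((x :: xs).map α)) :
    WR ⊥ (xs.map ((Ideal.Quotient.mk (Ideal.span {α x})).comp α)) := by
  rw [List.map_cons, WR] at h
  have h2 := h.2
  rw [bot_sup_eq, ← Ideal.mk_ker (I := Ideal.span {α x}), RingHom.ker_eq_comap_bot,
    wr_comap _ Ideal.Quotient.mk_surjective, List.map_map] at h2
  exact h2

theorem reg_of_wr_cons {T : Type*} [CommRing T] (α : A →+* T) (x : A) (xs : List A) (h : WR ⊥ ((x :: xs).map α)) :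
    ∀ a, α x * a = 0 → a = 0 := by
  rw [List.map_cons, WR] at h
  simpa using h.1

theorem mem_ofList_quot {T : Type*} [CommRing T] (α : A →+* T) (x : A) (xs : List A) (t : T) :
    Ideal.Quotient.mk (Ideal.span {α x}) t ∈ Ideal.ofList (xs.map ((Ideal.Quotient.mk (Ideal.span {α x})).comp α)) ↔
    t ∈ Ideal.ofList ((x :: xs).map α) := by
  have : xs.map ((Ideal.Quotient.mk (Ideal.span {α x})).comp α) = (xs.map α).map (Ideal.Quotient.mk (Ideal.span {α x})) := by
    rw [List.map_map]; rfl
  rw [this, ← ofList_map, Ideal.mem_quotient_iff_mem_sup, List.map_cons, Ideal.ofList_cons, sup_comm]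

theorem Tow.le {T : Type*} [CommRing T] {C : Finset ι → Type*} [∀ σ, CommRing (C σ)]
    {xs : List A} {x : A} {α : A →+* T} {γ : ∀ σ, A →+* C σ} {ψ : ∀ σ, C σ →+* T} (h : Tow xs α γ ψ) (σ : Finset ι) :
    Ideal.span {γ σ x} ≤ (Ideal.span {α x}).comap (ψ σ) := by
  rw [Ideal.span_singleton_le_iff_mem, Ideal.mem_comap, h.comp]
  exact Ideal.mem_span_singleton_self _

variable {T : Type*} [CommRing T] {C : Finset ι → Type*} [∀ σ, CommRing (C σ)]
    {xs : List A} {x : A} {α : A →+* T} {γ : ∀ σ, A →+* C σ} {ψ : ∀ σ, C σ →+* T}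

theorem Tow.quot_range (h : Tow (x :: xs) α γ ψ) (σ : Finset ι) :
    (Ideal.quotientMap (Ideal.span {α x}) (ψ σ) (h.le σ)).range = (ψ σ).range.map (Ideal.Quotient.mk (Ideal.span {α x})) := by
  ext t
  constructor
  · rintro ⟨c, rfl⟩
    obtain ⟨c, rfl⟩ := Ideal.Quotient.mk_surjective c
    exact ⟨ψ σ c, ⟨c, rfl⟩, by simp⟩
  · rintro ⟨_, ⟨c, rfl⟩, rfl⟩
    exact ⟨Ideal.Quotient.mk _ c, by simp⟩

theorem Tow.quot (h : Tow (x :: xs) α γ ψ) : Tow xs ((Ideal.Quotient.mk (Ideal.span {α x})).comp α)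
    (fun σ => (Ideal.Quotient.mk (Ideal.span {γ σ x})).comp (γ σ))
    (fun σ => Ideal.quotientMap (Ideal.span {α x}) (ψ σ) (h.le σ)) where
  comp σ a := by simp [h.comp]
  telT y hy := (h.telT y (List.mem_cons_of_mem _ hy)).quot (reg_of_wr_cons α x xs h.wrT)
  telC σ y hy := (h.telC σ y (List.mem_cons_of_mem _ hy)).quot (reg_of_wr_cons (γ σ) x xs (h.wrC σ))
  wrT := wr_quot_cons α x xs h.wrT
  wrC σ := wr_quot_cons (γ σ) x xs (h.wrC σ)
  inj σ c hc := by
    obtain ⟨c, rfl⟩ := Ideal.Quotient.mk_surjective c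
    rw [mem_ofList_quot]
    rw [Ideal.quotientMap_mk, mem_ofList_quot] at hc
    exact h.inj σ c hc
  mono := by
    intro σ τ hst
    simp only [h.quot_range]
    exact (Subring.gc_map_comap _).monotone_l (h.mono hst)
end tow

universe u v w z
theorem Tow.inj0 {ι : Type u} {A : Type v} [CommRing A] (xs : List A) : ∀ {T : Type w} [CommRing T] {C : Finset ι → Type z} [∀ σ, CommRing (C σ)]
    {α : A →+* T} {γ : ∀ σ, A →+* C σ} {ψ : ∀ σ, C σ →+* T}, Tow xs α γ ψ → ∀ σ c, ψ σ c = 0 → c = 0 := by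
  induction xs with
  | nil =>
    intro T _ C _ α γ ψ h σ c hc
    have := h.inj σ c (by simp [hc])
    simpa using this
  | cons x xs ih =>
    intro T _ C _ α γ ψ h σ c hc
    have key : ∀ c, ψ σ c = 0 → ∃ c', c = γ σ x * c' ∧ ψ σ c' = 0 := by
      intro c hc
      have := ih h.quot σ (Ideal.Quotient.mk _ c) (by simp [hc])
      rw [Ideal.Quotient.eq_zero_iff_mem, Ideal.mem_span_singleton] at this
      obtain ⟨c', rfl⟩ := this
      refine ⟨c', rfl, reg_of_wr_cons α x xs h.wrT _ ?_⟩
      rw [← h.comp σ, ← map_mul, hc]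
    refine (h.telC σ x List.mem_cons_self).haus (reg_of_wr_cons (γ σ) x xs (h.wrC σ)) c fun n => ?_
    suffices ∃ u, c = γ σ x ^ n • u ∧ ψ σ u = 0 from ⟨this.choose, this.choose_spec.1⟩
    induction n with
    | zero => exact ⟨c, by simp, hc⟩
    | succ n ihn =>
      obtain ⟨u, hu, hu0⟩ := ihn
      obtain ⟨u', rfl, hu'⟩ := key u hu0
      exact ⟨u', by rw [hu]; simp only [smul_eq_mul]; ring, hu'⟩

section
variable {ι : Type u} {A : Type v} [CommRing A] {T : Type w} [CommRing T] {C : Finset ι → Type z} [∀ σ, CommRing (C σ)]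
    {xs : List A} {x : A} {α : A →+* T} {γ : ∀ σ, A →+* C σ} {ψ : ∀ σ, C σ →+* T}

theorem Tow.step (h : Tow (x :: xs) α γ ψ) {T1 : Type*} [CommRing T1] (π : T →+* T1) (hπ : Function.Surjective π)
    (hk : RingHom.ker π = Ideal.span {α x}) :
    Step π (α x) (fun σ => (ψ σ).range) (fun σ => (ψ σ).range.map π) where
  surj := hπ
  ker t ht := by
    have : t ∈ RingHom.ker π := ht
    rw [hk, Ideal.mem_span_singleton] at this
    exact this
  pix := by
    have : α x ∈ RingHom.ker π := hk ▸ Ideal.mem_span_singleton_self _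
    exact this
  reg := reg_of_wr_cons α x xs h.wrT
  haus := (h.telT x List.mem_cons_self).haus (reg_of_wr_cons α x xs h.wrT)
  sum b _ := by
    obtain ⟨s, hs⟩ := (h.telT x List.mem_cons_self).1 b
    exact ⟨s 0, trivial, fun n => ⟨s n, Tel.sum_eq hs n⟩⟩
  mono := h.mono
  map σ := rfl
  sat σ t := by
    rintro ⟨c, hc⟩
    have := Tow.inj0 xs h.quot σ (Ideal.Quotient.mk _ c) (by
      rw [Ideal.quotientMap_mk, Ideal.Quotient.eq_zero_iff_mem, Ideal.mem_span_singleton]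
      exact ⟨t, hc⟩)
    rw [Ideal.Quotient.eq_zero_iff_mem, Ideal.mem_span_singleton] at this
    obtain ⟨c', rfl⟩ := this
    refine ⟨c', ?_⟩
    rw [map_mul, h.comp] at hc
    apply sub_eq_zero.1
    apply reg_of_wr_cons α x xs h.wrT
    rw [mul_sub, hc, sub_self]
  scl σ b hb := by
    choose c hc using hb
    obtain ⟨s, hs⟩ := (h.telC σ x List.mem_cons_self).1 c
    refine ⟨ψ σ (s 0), ⟨_, rfl⟩, fun n => ⟨ψ σ (s n), ?_⟩⟩
    rw [Tel.sum_eq hs n]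
    simp [h.comp, hc]
  xmem := ⟨γ ∅ x, h.comp ∅ x⟩
end

/-- The triviality property. -/
def HT {ι T : Type*} [Fintype ι] [DecidableEq ι] [CommRing T] (S : Finset ι → Subring T) : Prop :=
  ∀ (hS : Monotone S) (v : ι → Tˣ), Inv S v hS → Triv S v

theorem Step.ht {ι T' T : Type*} [Fintype ι] [DecidableEq ι] [CommRing T'] [CommRing T]
    {π : T' →+* T} {x : T'} {S' : Finset ι → Subring T'} {S : Finset ι → Subring T} (h : Step π x S' S) (H : HT S') : HT S := by
  intro hS v hI
  obtain ⟨v', hI', h'⟩ := h.main hS v hI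
  exact h' (H _ _ hI')

theorem tower {ι : Type u} {A : Type v} [CommRing A] [Fintype ι] [DecidableEq ι] (xs : List A) : ∀ (x : A) {T : Type w} [CommRing T] {C : Finset ι → Type z} [∀ σ, CommRing (C σ)]
    {α : A →+* T} {γ : ∀ σ, A →+* C σ} {ψ : ∀ σ, C σ →+* T}, Tow (x :: xs) α γ ψ → HT (fun σ => (ψ σ).range) →
    ∀ {K : Type w} [CommRing K] (π : T →+* K), Function.Surjective π → RingHom.ker π = Ideal.ofList ((x :: xs).map α) →
      HT (fun σ => (ψ σ).range.map π) := by
  induction xs with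
  | nil =>
    intro x T _ C _ α γ ψ h H K _ π hπ hk
    exact (h.step π hπ (by simpa using hk)).ht H
  | cons y ys ih =>
    intro x T _ C _ α γ ψ h H K _ π hπ hk
    have H1 := (h.step (Ideal.Quotient.mk (Ideal.span {α x})) Ideal.Quotient.mk_surjective Ideal.mk_ker).ht H
    have hle : ∀ a ∈ Ideal.span {α x}, π a = 0 := by
      intro a ha
      change a ∈ RingHom.ker π
      rw [hk, List.map_cons, Ideal.ofList_cons]
      exact Ideal.mem_sup_left ha
    have := ih y h.quot (by simpa only [h.quot_range] using H1) (Ideal.Quotient.lift _ π hle)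
      (Ideal.Quotient.lift_surjective_of_surjective _ _ hπ) (by
        ext t
        obtain ⟨t, rfl⟩ := Ideal.Quotient.mk_surjective t
        rw [mem_ofList_quot, ← hk, RingHom.mem_ker, RingHom.mem_ker, Ideal.Quotient.lift_mk])
    simp only [h.quot_range, Subring.map_map] at this
    exact this
end GrothUFD

namespace GrothUFD
open Finset IsLocalRing RingTheory.Sequence

section cmap
variable {B B' B'' : Type*} [CommRing B] [CommRing B'] [CommRing B'']

theorem pow_le_comap' (φ : B →+* B') {I : Ideal B} {I' : Ideal B'} (h : I ≤ I'.comap φ) (n : ℕ) :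
    I ^ n ≤ (I' ^ n).comap φ :=
  (Ideal.pow_right_mono h n).trans (Ideal.le_comap_pow φ n)

theorem cmap_compat (φ : B →+* B') {I : Ideal B} {I' : Ideal B'} (h : I ≤ I'.comap φ) {m n : ℕ} (hmn : m ≤ n) :
    (Ideal.Quotient.factorPow I' hmn).comp ((Ideal.quotientMap (I' ^ n) φ (pow_le_comap' φ h n)).comp
    (AdicCompletion.evalₐ I n : AdicCompletion I B →+* B ⧸ I ^ n)) = (Ideal.quotientMap (I' ^ m) φ (pow_le_comap' φ h m)).comp
    (AdicCompletion.evalₐ I m : AdicCompletion I B →+* B ⧸ I ^ m) := by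
  ext c
  obtain ⟨c, rfl⟩ := AdicCompletion.mk_surjective _ _ c
  simp only [RingHom.comp_apply, RingHom.coe_coe, AdicCompletion.evalₐ_mk, Ideal.quotientMap_mk]
  have : Ideal.Quotient.mk (I ^ m) (c m) = Ideal.Quotient.mk (I ^ m) (c n) := by
    exact AdicCompletion.Ideal.mk_eq_mk I hmn c |>.symm
  have h2 := congrArg (Ideal.quotientMap (I' ^ m) φ (pow_le_comap' φ h m)) this
  rw [Ideal.quotientMap_mk, Ideal.quotientMap_mk] at h2
  rw [h2]
  rfl

/-- functoriality of completion. -/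
noncomputable def cmap (φ : B →+* B') {I : Ideal B} {I' : Ideal B'} (h : I ≤ I'.comap φ) :
    AdicCompletion I B →+* AdicCompletion I' B' :=
  AdicCompletion.liftRingHom I' (fun n => (Ideal.quotientMap (I' ^ n) φ (pow_le_comap' φ h n)).comp
    (AdicCompletion.evalₐ I n : AdicCompletion I B →+* B ⧸ I ^ n)) (fun hmn => cmap_compat φ h hmn)

theorem evalₐ_cmap (φ : B →+* B') {I : Ideal B} {I' : Ideal B'} (h : I ≤ I'.comap φ) (n : ℕ) (c : AdicCompletion I B) :
    AdicCompletion.evalₐ I' n (cmap φ h c) = Ideal.quotientMap (I' ^ n) φ (pow_le_comap' φ h n) (AdicCompletion.evalₐ I n c) :=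
  AdicCompletion.evalₐ_liftRingHom I' (fun n => (Ideal.quotientMap (I' ^ n) φ (pow_le_comap' φ h n)).comp
    (AdicCompletion.evalₐ I n : AdicCompletion I B →+* B ⧸ I ^ n)) (fun hmn => cmap_compat φ h hmn) n c

theorem evalOneₐ_cmap (φ : B →+* B') {I : Ideal B} {I' : Ideal B'} (h : I ≤ I'.comap φ) (c : AdicCompletion I B) :
    AdicCompletion.evalOneₐ I' (cmap φ h c) = Ideal.quotientMap I' φ h (AdicCompletion.evalOneₐ I c) := by
  rw [← AdicCompletion.factorₐ_evalₐ_one, ← AdicCompletion.factorₐ_evalₐ_one, evalₐ_cmap]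
  obtain ⟨b, hb⟩ := Ideal.Quotient.mk_surjective (AdicCompletion.evalₐ I 1 c)
  rw [← hb]; rfl

theorem cmap_algebraMap (φ : B →+* B') {I : Ideal B} {I' : Ideal B'} (h : I ≤ I'.comap φ) (b : B) :
    cmap φ h (algebraMap B _ b) = algebraMap B' _ (φ b) := by
  apply AdicCompletion.ext_evalₐ
  intro n
  rw [evalₐ_cmap]
  simp only [AlgHom.commutes]
  rfl

theorem cmap_cmap (φ : B →+* B') (φ' : B' →+* B'') (φ'' : B →+* B'') {I : Ideal B} {I' : Ideal B'} {I'' : Ideal B''}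
    (h : I ≤ I'.comap φ) (h' : I' ≤ I''.comap φ') (h'' : I ≤ I''.comap φ'') (e : ∀ b, φ' (φ b) = φ'' b) (c : AdicCompletion I B) :
    cmap φ' h' (cmap φ h c) = cmap φ'' h'' c := by
  apply AdicCompletion.ext_evalₐ
  intro n
  rw [evalₐ_cmap, evalₐ_cmap, evalₐ_cmap]
  obtain ⟨b, hb⟩ := Ideal.Quotient.mk_surjective (AdicCompletion.evalₐ I n c)
  rw [← hb]
  simp [e]
end cmap

section comp
variable {A B : Type*} [CommRing A] [CommRing B] [Algebra A B] [IsNoetherianRing B]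

theorem comp_tel {xs : List A} {I : Ideal B} (hI : I = Ideal.ofList (xs.map (algebraMap A B))) {x : A} (hx : x ∈ xs) :
    Tel (AdicCompletion I B) (((algebraMap B (AdicCompletion I B)).comp (algebraMap A B)) x) := by
  have := AdicCompletion.isAdicComplete (M := B) (I.fg_of_isNoetherianRing)
  exact tel_of_complete I (x := algebraMap A B x) (by
    rw [hI]; exact Ideal.subset_span (List.mem_map_of_mem hx))

theorem comp_wr [Module.Flat A B] {I : Ideal B} {l : List A} (hl : WR ⊥ l) :
    WR ⊥ (l.map ((algebraMap B (AdicCompletion I B)).comp (algebraMap A B))) := by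
  rw [wr_bot_iff] at hl ⊢
  have h1 : IsWeaklyRegular B (l.map (algebraMap A B)) := hl.of_flat
  have h2 : IsWeaklyRegular (AdicCompletion I B) ((l.map (algebraMap A B)).map (algebraMap B (AdicCompletion I B))) := h1.of_flat
  rw [List.map_map] at h2
  exact h2

theorem comp_ker {xs : List A} {I : Ideal B} (hI : I = Ideal.ofList (xs.map (algebraMap A B))) :
    RingHom.ker (AdicCompletion.evalOneₐ I).toRingHom =
      Ideal.ofList (xs.map ((algebraMap B (AdicCompletion I B)).comp (algebraMap A B))) := by
  rw [AdicCompletion.ker_evalOneₐ_eq_map I I.fg_of_isNoetherianRing]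
  conv_lhs => rw [congrArg (Ideal.map _) hI]
  rw [ofList_map, List.map_map]; rfl

theorem comp_unit [IsLocalRing B] {I : Ideal B} (hI : I ≤ maximalIdeal B) (x : AdicCompletion I B)
    (hx : x ∉ (maximalIdeal B).map (algebraMap B (AdicCompletion I B))) : IsUnit x := by
  have hfg := I.fg_of_isNoetherianRing
  obtain ⟨b, hb⟩ := Ideal.Quotient.mk_surjective (AdicCompletion.evalOneₐ I x)
  have hker : x - algebraMap B _ b ∈ I.map (algebraMap B (AdicCompletion I B)) := by
    rw [← AdicCompletion.ker_evalOneₐ_eq_map I hfg]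
    change AdicCompletion.evalOneₐ I (x - algebraMap B _ b) = 0
    rw [map_sub, ← hb, AlgHom.commutes]; exact sub_self _
  have hbu : IsUnit b := by
    by_contra hbu
    apply hx
    have h1 : algebraMap B _ b ∈ (maximalIdeal B).map (algebraMap B (AdicCompletion I B)) :=
      Ideal.mem_map_of_mem _ ((mem_maximalIdeal b).2 hbu)
    have := Ideal.add_mem _ (Ideal.map_mono hI hker) h1
    rwa [sub_add_cancel] at this
  have := AdicCompletion.isAdicComplete_self I hfg
  have hj := IsAdicComplete.le_jacobson_bot _ hker
  have := hbu.map (algebraMap B (AdicCompletion I B))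
  obtain ⟨u, hu⟩ := this
  rw [Ideal.mem_jacobson_bot] at hj
  have h2 := hj ((u⁻¹ : _ˣ) : AdicCompletion I B)
  have h3 : x = ((x - algebraMap B _ b) * ((u⁻¹ : _ˣ) : AdicCompletion I B) + 1) * u := by
    rw [add_mul, mul_assoc, Units.inv_mul, hu]; ring
  rw [h3]
  exact h2.mul u.isUnit

theorem comp_max [IsLocalRing B] {I : Ideal B} (hI : I ≤ maximalIdeal B) :
    ∃ _ : IsLocalRing (AdicCompletion I B), maximalIdeal (AdicCompletion I B) = (maximalIdeal B).map (algebraMap B (AdicCompletion I B)) := by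
  have hM := AdicCompletion.isMaximal_map_of_le I (maximalIdeal B) hI I.fg_of_isNoetherianRing
  have hloc : IsLocalRing (AdicCompletion I B) := by
    refine IsLocalRing.of_unique_max_ideal ⟨_, hM, fun J hJ => hJ.eq_of_le hM.ne_top fun x hx => ?_⟩
    by_contra h
    exact hJ.ne_top (Ideal.eq_top_of_isUnit_mem _ hx (comp_unit hI x h))
  exact ⟨hloc, (IsLocalRing.eq_maximalIdeal hM).symm⟩
end comp

universe u
theorem ht_of_equiv {ι : Type*} [Fintype ι] [DecidableEq ι] {T : Type u} [CommRing T] {D : Type*} [CommRing D] [IsLocalRing D]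
    (S : Finset ι → Subring T) (f : D →+* T) (hf : Function.Injective f) (hS0 : S ∅ = f.range) (rs : List D)
    (hm : Ideal.ofList rs = maximalIdeal D) (hrs : WR ⊥ rs) : HT S := by
  intro hS v hI
  let e : D ≃+* S ∅ := RingEquiv.ofBijective (f.codRestrict (S ∅) (fun d => by rw [hS0]; exact ⟨d, rfl⟩)) (by
    constructor
    · intro a b h; exact hf (congrArg Subtype.val h)
    · rintro ⟨t, ht⟩
      have := ht
      rw [hS0] at this
      obtain ⟨d, hd⟩ := this
      exact ⟨d, Subtype.ext hd⟩)
  haveI : IsLocalRing (S ∅) := e.isLocalRing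
  refine top_triv S hS v hI (rs.map e) ?_ ?_
  · have := ofList_map (e : D →+* S ∅) rs
    rw [← map_ringEquiv_maximalIdeal e, ← hm]
    exact this.symm
  · rw [← wr_bot_iff]
    have h1 := wr_comap (e : D →+* S ∅) e.surjective rs ⊥
    rw [← RingHom.ker_eq_comap_bot, (RingHom.injective_iff_ker_eq_bot (e : D →+* S ∅)).1 e.injective] at h1
    exact h1.1 hrs
end GrothUFD

namespace GrothUFD
open Finset IsLocalRing RingTheory.Sequence
universe u

section msub
variable {A : Type u} [CommRing A]

/-- divisors of powers of `f`. -/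
def Msub (f : A) : Submonoid A where
  carrier := {m | ∃ N : ℕ, m ∣ f ^ N}
  one_mem' := ⟨0, one_dvd _⟩
  mul_mem' := by
    rintro a b ⟨N, h⟩ ⟨N', h'⟩
    exact ⟨N + N', by rw [pow_add]; exact mul_dvd_mul h h'⟩

theorem Msub_mono {f f' : A} (h : f ∣ f') : Msub f ≤ Msub f' := by
  rintro m ⟨N, hN⟩
  exact ⟨N, hN.trans (pow_dvd_pow_of_dvd h N)⟩

theorem Msub_notMem {J : Ideal A} [J.IsPrime] {f : A} (hf : f ∉ J) {m : A} (hm : m ∈ Msub f) : m ∉ J := by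
  obtain ⟨N, c, h⟩ := hm
  intro hmJ
  exact hf (Ideal.IsPrime.mem_of_pow_mem ‹_› N (by rw [h]; exact J.mul_mem_right _ hmJ))

/-- map to the local ring. -/
noncomputable def locJ (J : Ideal A) [J.IsPrime] {f : A} (hf : f ∉ J) : Localization (Msub f) →+* Localization.AtPrime J :=
  IsLocalization.lift (M := Msub f) (g := algebraMap A (Localization.AtPrime J))
    (fun y => IsLocalization.map_units (M := J.primeCompl) (Localization.AtPrime J) ⟨(y : A), Msub_notMem hf y.2⟩)

theorem locJ_alg (J : Ideal A) [J.IsPrime] {f : A} (hf : f ∉ J) (a : A) :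
    locJ J hf (algebraMap A _ a) = algebraMap A _ a := IsLocalization.lift_eq _ _

/-- transition maps. -/
noncomputable def locT {f f' : A} (h : f ∣ f') : Localization (Msub f) →+* Localization (Msub f') :=
  IsLocalization.lift (M := Msub f) (g := algebraMap A (Localization (Msub f')))
    (fun y => IsLocalization.map_units (M := Msub f') (Localization (Msub f')) ⟨(y : A), Msub_mono h y.2⟩)

theorem locT_alg {f f' : A} (h : f ∣ f') (a : A) :
    locT h (algebraMap A _ a) = algebraMap A _ a := IsLocalization.lift_eq _ _

theorem locJ_locT (J : Ideal A) [J.IsPrime] {f f' : A} (hf : f ∉ J) (hf' : f' ∉ J) (h : f ∣ f') (b : Localization (Msub f)) :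
    locJ J hf' (locT h b) = locJ J hf b := by
  have : (locJ J hf').comp (locT h) = locJ J hf := by
    apply IsLocalization.ringHom_ext (Msub f)
    ext a
    simp [locT_alg, locJ_alg]
  exact congrArg (fun F => F b) this

theorem locJ_mem (J : Ideal A) [J.IsPrime] {f : A} (hf : f ∉ J) (b : Localization (Msub f))
    (hb : locJ J hf b ∈ maximalIdeal (Localization.AtPrime J)) : b ∈ J.map (algebraMap A (Localization (Msub f))) := by
  obtain ⟨⟨a, m⟩, h⟩ := IsLocalization.surj (Msub f) b
  have h1 := congrArg (locJ J hf) h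
  simp only [map_mul, locJ_alg] at h1
  have h2 : a ∈ J := by
    rw [← IsLocalization.AtPrime.to_map_mem_maximal_iff (Localization.AtPrime J) J, ← h1]
    exact Ideal.mul_mem_right _ _ hb
  rw [← Ideal.mul_unit_mem_iff_mem _ (IsLocalization.map_units (Localization (Msub f)) m), h]
  exact Ideal.mem_map_of_mem _ h2

theorem locJ_le (J : Ideal A) [J.IsPrime] {f : A} (hf : f ∉ J) :
    J.map (algebraMap A (Localization (Msub f))) ≤ (maximalIdeal (Localization.AtPrime J)).comap (locJ J hf) := by
  rw [Ideal.map_le_iff_le_comap]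
  intro a ha
  simp only [Ideal.mem_comap, locJ_alg]
  exact (IsLocalization.AtPrime.to_map_mem_maximal_iff (Localization.AtPrime J) J a).2 ha

theorem locT_le (J : Ideal A) {f f' : A} (h : f ∣ f') :
    J.map (algebraMap A (Localization (Msub f))) ≤ (J.map (algebraMap A (Localization (Msub f')))).comap (locT h) := by
  rw [Ideal.map_le_iff_le_comap]
  intro a ha
  simp only [Ideal.mem_comap, locT_alg]
  exact Ideal.mem_map_of_mem _ ha

theorem alg_res (J : Ideal A) [J.IsPrime] (a : A) :
    residue (Localization.AtPrime J) (algebraMap A _ a) = algebraMap (A ⧸ J) J.ResidueField (Ideal.Quotient.mk J a) := by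
  rfl

theorem range_locS (J : Ideal A) [J.IsPrime] {ι : Type*} [Fintype ι] [DecidableEq ι] (G : ι → A) (σ : Finset ι)
    (hf : (∏ i ∈ σ, G i) ∉ J) (t : J.ResidueField) :
    t ∈ locS J.ResidueField (fun i => Ideal.Quotient.mk J (G i)) σ ↔
      ∃ b, t = residue (Localization.AtPrime J) (locJ J hf b) := by
  have hp : ∀ m : ℕ, algebraMap (A ⧸ J) J.ResidueField ((∏ i ∈ σ, Ideal.Quotient.mk J (G i)) ^ m) =
      residue (Localization.AtPrime J) (algebraMap A _ ((∏ i ∈ σ, G i) ^ m)) := by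
    intro m
    rw [alg_res, ← map_prod, ← map_pow]
  constructor
  · rintro ⟨m, a, h⟩
    obtain ⟨a, rfl⟩ := Ideal.Quotient.mk_surjective a
    let y : Msub (∏ i ∈ σ, G i) := ⟨(∏ i ∈ σ, G i) ^ m, m, dvd_rfl⟩
    refine ⟨IsLocalization.mk' (M := Msub (∏ i ∈ σ, G i)) _ a y, ?_⟩
    have h0 : residue (Localization.AtPrime J) (algebraMap A _ ((∏ i ∈ σ, G i) ^ m)) ≠ 0 := by
      rw [Ne, residue_eq_zero_iff, IsLocalization.AtPrime.to_map_mem_maximal_iff (Localization.AtPrime J) J]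
      exact fun h => hf (Ideal.IsPrime.mem_of_pow_mem ‹_› _ h)
    apply mul_left_cancel₀ h0
    rw [hp] at h
    rw [h, ← alg_res, ← map_mul, ← locJ_alg J hf a, ← locJ_alg J hf ((∏ i ∈ σ, G i) ^ m), ← map_mul (locJ J hf)]
    congr 2
    exact (IsLocalization.mk'_spec' _ a y).symm
  · rintro ⟨b, rfl⟩
    obtain ⟨⟨a, m, N, c, hc⟩, h⟩ := IsLocalization.surj (Msub (∏ i ∈ σ, G i)) b
    have h1 := congrArg (locJ J hf) h
    simp only [map_mul, locJ_alg] at h1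
    refine ⟨N, Ideal.Quotient.mk J (a * c), ?_⟩
    rw [hp, ← alg_res, ← map_mul (residue _), hc, map_mul (algebraMap A (Localization.AtPrime J)),
      map_mul (algebraMap A (Localization.AtPrime J)), ← h1]
    congr 1; ring
end msub

section
variable {A : Type u} [CommRing A] [IsNoetherianRing A] {ι : Type} [Fintype ι] [DecidableEq ι]

theorem prod_notMem {J : Ideal A} [J.IsPrime] {G : ι → A} (hG : ∀ i, G i ∉ J) (σ : Finset ι) : ∏ i ∈ σ, G i ∉ J := by
  intro h
  obtain ⟨i, -, hi⟩ := (Ideal.IsPrime.prod_mem_iff).1 h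
  exact hG i hi

/-- completed localizations. -/
abbrev CC (J : Ideal A) (G : ι → A) (σ : Finset ι) : Type u :=
  AdicCompletion (J.map (algebraMap A (Localization (Msub (∏ i ∈ σ, G i))))) (Localization (Msub (∏ i ∈ σ, G i)))

/-- completed local ring. -/
abbrev TT (J : Ideal A) [J.IsPrime] : Type u :=
  AdicCompletion (maximalIdeal (Localization.AtPrime J)) (Localization.AtPrime J)

/-- the comparison map. -/
noncomputable abbrev psi (J : Ideal A) [J.IsPrime] {G : ι → A} (hG : ∀ i, G i ∉ J) (σ : Finset ι) : CC J G σ →+* TT J :=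
  cmap (locJ J (prod_notMem hG σ)) (locJ_le J (prod_notMem hG σ))

theorem tow_main (xs : List A) (J : Ideal A) [J.IsPrime] (hJ : J = Ideal.ofList xs) (hxs : WR ⊥ xs) {G : ι → A} (hG : ∀ i, G i ∉ J) :
    Tow xs ((algebraMap (Localization.AtPrime J) (TT J)).comp (algebraMap A (Localization.AtPrime J)))
      (fun σ => (algebraMap (Localization (Msub (∏ i ∈ σ, G i))) (CC J G σ)).comp (algebraMap A (Localization (Msub (∏ i ∈ σ, G i)))))
      (psi J hG) := by
  have hn : ∀ σ : Finset ι, IsNoetherianRing (Localization (Msub (∏ i ∈ σ, G i))) := fun σ =>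
    IsLocalization.isNoetherianRing (Msub (∏ i ∈ σ, G i)) _ inferInstance
  have hfl : ∀ σ : Finset ι, Module.Flat A (Localization (Msub (∏ i ∈ σ, G i))) := fun σ =>
    IsLocalization.flat _ (Msub (∏ i ∈ σ, G i))
  have hnJ : IsNoetherianRing (Localization.AtPrime J) := IsLocalization.isNoetherianRing J.primeCompl _ inferInstance
  have hflJ : Module.Flat A (Localization.AtPrime J) := IsLocalization.flat _ J.primeCompl
  have hI : ∀ σ : Finset ι, J.map (algebraMap A (Localization (Msub (∏ i ∈ σ, G i)))) =
      Ideal.ofList (xs.map (algebraMap A (Localization (Msub (∏ i ∈ σ, G i))))) := fun σ => by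
    rw [congrArg (Ideal.map (algebraMap A (Localization (Msub (∏ i ∈ σ, G i))))) hJ, ofList_map]
  have hIJ : maximalIdeal (Localization.AtPrime J) = Ideal.ofList (xs.map (algebraMap A (Localization.AtPrime J))) := by
    rw [← Localization.AtPrime.map_eq_maximalIdeal, congrArg (Ideal.map (algebraMap A (Localization.AtPrime J))) hJ, ofList_map]
  refine ⟨?_, ?_, ?_, ?_, ?_, ?_, ?_⟩
  · intro σ a
    simp only [RingHom.comp_apply]
    rw [cmap_algebraMap, locJ_alg]
  · intro x hx
    exact comp_tel hIJ hx
  · intro σ x hx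
    exact comp_tel (hI σ) hx
  · exact comp_wr hxs
  · intro σ; exact comp_wr hxs
  · intro σ c hc
    rw [← comp_ker hIJ] at hc
    rw [← comp_ker (hI σ)]
    change AdicCompletion.evalOneₐ _ _ = 0 at hc
    change AdicCompletion.evalOneₐ _ _ = 0
    rw [evalOneₐ_cmap] at hc
    obtain ⟨b, hb⟩ := Ideal.Quotient.mk_surjective (AdicCompletion.evalOneₐ _ c)
    rw [← hb] at hc ⊢
    rw [Ideal.quotientMap_mk, Ideal.Quotient.eq_zero_iff_mem] at hc
    rw [Ideal.Quotient.eq_zero_iff_mem]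
    exact locJ_mem J _ b hc
  · rintro σ τ hst _ ⟨c, rfl⟩
    have hd : (∏ i ∈ σ, G i) ∣ ∏ i ∈ τ, G i := Finset.prod_dvd_prod_of_subset _ _ _ hst
    exact ⟨cmap (locT hd) (locT_le J hd) c, cmap_cmap _ _ _ _ _ _ (fun b => locJ_locT J _ _ hd b) c⟩

theorem ht_top [IsLocalRing A] (J : Ideal A) [J.IsPrime] {G : ι → A} (hG : ∀ i, G i ∉ J)
    (hinj : Function.Injective (psi J hG ∅))
    (rs : List A) (hm : Ideal.ofList rs = maximalIdeal A) (hrs : WR ⊥ rs) : HT (fun σ => (psi J hG σ).range) := by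
  have hn : IsNoetherianRing (Localization (Msub (∏ i ∈ (∅ : Finset ι), G i))) :=
    IsLocalization.isNoetherianRing (Msub (∏ i ∈ (∅ : Finset ι), G i)) _ inferInstance
  have hfl : Module.Flat A (Localization (Msub (∏ i ∈ (∅ : Finset ι), G i))) :=
    IsLocalization.flat _ (Msub (∏ i ∈ (∅ : Finset ι), G i))
  have hu : Msub (∏ i ∈ (∅ : Finset ι), G i) ≤ IsUnit.submonoid A := by
    rintro m ⟨N, h⟩
    rw [prod_empty, one_pow] at h
    exact isUnit_of_dvd_one h
  let e : A ≃+* Localization (Msub (∏ i ∈ (∅ : Finset ι), G i)) := (IsLocalization.atUnits A (Msub (∏ i ∈ (∅ : Finset ι), G i)) hu).toRingEquiv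
  have he : ∀ a, e a = algebraMap A _ a := fun a => (IsLocalization.atUnits A (Msub (∏ i ∈ (∅ : Finset ι), G i)) hu).commutes a
  have hloc : IsLocalRing (Localization (Msub (∏ i ∈ (∅ : Finset ι), G i))) := e.isLocalRing
  have he' : (e : A →+* Localization (Msub (∏ i ∈ (∅ : Finset ι), G i))) = algebraMap A _ := RingHom.ext he
  have hmx : maximalIdeal (Localization (Msub (∏ i ∈ (∅ : Finset ι), G i))) = (maximalIdeal A).map (algebraMap A _) := by
    rw [← map_ringEquiv_maximalIdeal e, ← he']; rfl
  obtain ⟨hl, hmax⟩ := comp_max (I := J.map (algebraMap A (Localization (Msub (∏ i ∈ (∅ : Finset ι), G i))))) (by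
    rw [hmx]; exact Ideal.map_mono (le_maximalIdeal (Ideal.IsPrime.ne_top ‹_›)))
  refine ht_of_equiv (fun σ => (psi J hG σ).range) (psi J hG ∅) hinj rfl (rs.map ((algebraMap _ (CC J G ∅)).comp (algebraMap A _))) ?_ (comp_wr hrs)
  rw [hmax, hmx, ← hm, ofList_map, ofList_map, List.map_map]; rfl

theorem ht_main [IsLocalRing A] (xs : List A) (J : Ideal A) [J.IsPrime] (hJ : J = Ideal.ofList xs) (hxs : WR ⊥ xs) {G : ι → A} (hG : ∀ i, G i ∉ J)
    (rs : List A) (hm : Ideal.ofList rs = maximalIdeal A) (hrs : WR ⊥ rs) :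
    HT (locS J.ResidueField (fun i => Ideal.Quotient.mk J (G i))) := by
  match xs, hJ, hxs with
  | [], hJ, _ =>
    refine ht_of_equiv _ ((algebraMap (A ⧸ J) J.ResidueField).comp (Ideal.Quotient.mk J)) ?_ ?_ rs hm hrs
    · rw [Ideal.ofList_nil] at hJ
      rw [RingHom.coe_comp]
      refine Function.Injective.comp (IsFractionRing.injective (A ⧸ J) J.ResidueField) ?_
      rw [RingHom.injective_iff_ker_eq_bot, Ideal.mk_ker, hJ]
    · ext t
      rw [mem_locS_empty]
      constructor
      · rintro ⟨a, rfl⟩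
        obtain ⟨a, rfl⟩ := Ideal.Quotient.mk_surjective a
        exact ⟨a, rfl⟩
      · rintro ⟨a, rfl⟩
        exact ⟨Ideal.Quotient.mk J a, rfl⟩
  | x :: xs, hJ, hxs =>
    have hT := tow_main (x :: xs) J hJ hxs hG
    have htop := ht_top J hG ((injective_iff_map_eq_zero _).2 (Tow.inj0 _ hT ∅)) rs hm hrs
    have hnJ : IsNoetherianRing (Localization.AtPrime J) := IsLocalization.isNoetherianRing J.primeCompl _ inferInstance
    have hIJ : maximalIdeal (Localization.AtPrime J) = Ideal.ofList ((x :: xs).map (algebraMap A (Localization.AtPrime J))) := by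
      rw [← Localization.AtPrime.map_eq_maximalIdeal, congrArg (Ideal.map (algebraMap A (Localization.AtPrime J))) hJ, ofList_map]
    have := tower xs x hT htop (K := J.ResidueField) (AdicCompletion.evalOneₐ (maximalIdeal (Localization.AtPrime J))).toRingHom
      (AdicCompletion.evalOneₐ_surjective _) (comp_ker hIJ)
    convert this using 1
    funext σ
    ext t
    rw [range_locS J G σ (prod_notMem hG σ)]
    have key : ∀ c : CC J G σ, ∀ b, Ideal.Quotient.mk _ b = AdicCompletion.evalOneₐ _ c →
        AdicCompletion.evalOneₐ (maximalIdeal (Localization.AtPrime J)) (psi J hG σ c) =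
          residue (Localization.AtPrime J) (locJ J (prod_notMem hG σ) b) := by
      intro c b hb
      rw [evalOneₐ_cmap, ← hb, Ideal.quotientMap_mk]; rfl
    constructor
    · rintro ⟨b, rfl⟩
      exact ⟨_, ⟨algebraMap _ _ b, rfl⟩, key _ b (by rw [AlgHom.commutes]; rfl)⟩
    · rintro ⟨_, ⟨c, rfl⟩, rfl⟩
      obtain ⟨b, hb⟩ := Ideal.Quotient.mk_surjective (AdicCompletion.evalOneₐ _ c)
      exact ⟨b, key c b hb⟩
end
end GrothUFD

namespace GrothUFD
open Finset IsLocalRing RingTheory.Sequence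
universe u

theorem exists_small {R : Type*} [CommRing R] [IsDomain R] [IsNoetherianRing R] (I : Ideal R) (hI : I.IsPrime) (hI0 : I ≠ ⊥) :
    ∃ p : Ideal R, ∃ hp : p.IsPrime, p ≤ I ∧ p ≠ ⊥ ∧ (∀ q : Ideal R, q.IsPrime → q ≠ ⊥ → q ≤ p → q = p) ∧
      Order.height (⟨p, hp⟩ : PrimeSpectrum R) ≤ 3 := by
  obtain ⟨a, haI, ha0⟩ := Submodule.exists_mem_ne_zero_of_ne_bot hI0
  obtain ⟨p, hp, hpI⟩ := Ideal.exists_minimalPrimes_le (I := Ideal.span {a}) (J := I) (by rwa [Ideal.span_singleton_le_iff_mem])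
  have hpp : p.IsPrime := hp.1.1
  have hap : a ∈ p := (Ideal.span_singleton_le_iff_mem _).1 hp.1.2
  have hh : p.height ≤ 1 := Ideal.height_le_one_of_isPrincipal_of_mem_minimalPrimes (Ideal.span {a}) p hp
  refine ⟨p, hpp, hpI, fun h => ha0 (by rw [h] at hap; exact hap), ?_, ?_⟩
  · intro q hq hq0 hqp
    by_contra hne
    have h1 : q.height < 1 := Ideal.height_le_iff.1 hh q hq (lt_of_le_of_ne hqp hne)
    have h2 : q.height ≤ 0 := by
      rw [ENat.lt_one_iff_eq_zero] at h1; exact h1.le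
    have h3 := Ideal.height_le_iff.1 h2 ⊥ Ideal.isPrime_bot (bot_lt_iff_ne_bot.2 hq0)
    exact absurd h3 (by simp)
  · rw [← PrimeSpectrum.height_eq_orderHeight]
    exact hh.trans (by norm_num)

theorem main (A : Type u) [CommRing A] [IsLocalRing A] [IsNoetherianRing A]
    (hreg : ∃ s : Finset A, Ideal.span (s : Set A) = IsLocalRing.maximalIdeal A ∧
      (s.card : WithBot ℕ∞) = ringKrullDim A)
    (xs : List A) (hxs : ∀ x ∈ xs, x ∈ IsLocalRing.maximalIdeal A)
    (hxreg : RingTheory.Sequence.IsRegular A xs)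
    [IsDomain (A ⧸ Ideal.ofList xs)]
    (hUFD : ∀ (P : Ideal (A ⧸ Ideal.ofList xs)) (hP : P.IsPrime),
      Order.height (⟨P, hP⟩ : PrimeSpectrum (A ⧸ Ideal.ofList xs)) ≤ 3 →
      UniqueFactorizationMonoid (Localization.AtPrime P)) :
    UniqueFactorizationMonoid (A ⧸ Ideal.ofList xs) := by
  obtain ⟨s, hs, hd⟩ := hreg
  have hrm : Ideal.ofList s.toList = maximalIdeal A := by
    rw [← hs, Ideal.ofList]; congr 1; ext a; simp
  have hrs : WR (⊥ : Ideal A) s.toList := reg_wr s.card A s.toList (by simp) hrm hd.le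
  have hwx : WR (⊥ : Ideal A) xs := (wr_bot_iff xs).2 hxreg.toIsWeaklyRegular
  have hJp : (Ideal.ofList xs).IsPrime := (Ideal.Quotient.isDomain_iff_prime _).1 inferInstance
  have hRl : IsLocalRing (A ⧸ Ideal.ofList xs) := IsLocalRing.of_surjective' _ Ideal.Quotient.mk_surjective
  have hdim := ringKrullDim_add_length_eq_ringKrullDim_of_isRegular xs hxreg
  rw [← hd] at hdim
  have hfin : ∃ e : ℕ, ringKrullDim (A ⧸ Ideal.ofList xs) = e := by
    have h1 : ringKrullDim (A ⧸ Ideal.ofList xs) ≠ ⊥ := ringKrullDim_ne_bot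
    have h2 : ringKrullDim (A ⧸ Ideal.ofList xs) ≠ ⊤ := ringKrullDim_ne_top
    obtain ⟨n, hn⟩ := WithBot.ne_bot_iff_exists.1 h1
    obtain ⟨m, rfl⟩ := ENat.ne_top_iff_exists.1 (fun h : n = ⊤ => h2 (by rw [← hn, h]; rfl))
    exact ⟨m, hn.symm⟩
  obtain ⟨e, he⟩ := hfin
  have hcard : e + xs.length = s.card := by rw [he] at hdim; exact_mod_cast hdim
  have hD0 : Dep (e + xs.length) (⊥ : Ideal A) := by
    rw [hcard, ← Finset.length_toList]
    exact dep_of_wr _ (fun x hx => by rw [← hrm]; exact Ideal.subset_span hx) _ hrs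
  have hD1 := dep_quot xs hxs e ⊥ hwx hD0
  rw [bot_sup_eq] at hD1
  have hD : Dep e (⊥ : Ideal (A ⧸ Ideal.ofList xs)) := by
    apply dep_comap (Ideal.Quotient.mk (Ideal.ofList xs)) Ideal.Quotient.mk_surjective
    rwa [← RingHom.ker_eq_comap_bot, Ideal.mk_ker]
  rw [UniqueFactorizationMonoid.iff_exists_prime_mem_of_isPrime]
  intro I hI0 hI
  obtain ⟨p, hp, hpI, hp0, hmin, hp3⟩ := exists_small I hI hI0
  have hprin : ∃ a, p = Ideal.span {a} := by
    by_contra hnp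
    obtain ⟨g, h, hg, hh, hh0, hgp, hg0⟩ := choose_gh he.le hD hUFD p hp hp0 hmin hp3 hnp
    apply hnp
    choose G hG using fun i => Ideal.Quotient.mk_surjective (g i)
    have hgG : g = fun i => Ideal.Quotient.mk (Ideal.ofList xs) (G i) := funext fun i => (hG i).symm
    have hGJ : ∀ i, G i ∉ Ideal.ofList xs := by
      intro i hi
      have : g i = 0 := by rw [← hG, Ideal.Quotient.eq_zero_iff_mem]; exact hi
      exact hg.nz i this
    have H := ht_main xs (Ideal.ofList xs) rfl hwx hGJ s.toList hrm hrs
    rw [← hgG] at H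
    exact base_main (T := (Ideal.ofList xs).ResidueField) hg p hh hh0 hgp hg0 (fun v hv => H _ v hv)
  obtain ⟨a, rfl⟩ := hprin
  refine ⟨a, hpI (Ideal.mem_span_singleton_self a), ?_⟩
  rwa [← Ideal.span_singleton_prime (fun h => hp0 (by rw [h]; simp))]
end GrothUFD



/-- Let `(A,𝔫)` be a regular local ring (the maximal ideal is generated
by as many elements as the Krull dimension), let `x₁,…,x_c` be an `A`-regular sequence of
elements of `𝔫`, and let `R = A/(x₁,…,x_c)`. Assume `R` is an integral domain and that
for every prime ideal `P` of `R` of height at most `3` (height taken as the height of `P`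
in the prime spectrum of `R`) the localization `R_P` is a unique factorization domain.
Then `R` is a unique factorization domain. -/
theorem stmt19 (A : Type u) [CommRing A] [IsLocalRing A] [IsNoetherianRing A]
    (hreg : ∃ s : Finset A, Ideal.span (s : Set A) = IsLocalRing.maximalIdeal A ∧
      (s.card : WithBot ℕ∞) = ringKrullDim A)
    (xs : List A) (hxs : ∀ x ∈ xs, x ∈ IsLocalRing.maximalIdeal A)
    (hxreg : RingTheory.Sequence.IsRegular A xs)
    [IsDomain (A ⧸ Ideal.span {a : A | a ∈ xs})]
    (hUFD : ∀ (P : Ideal (A ⧸ Ideal.span {a : A | a ∈ xs})) (hP : P.IsPrime),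
      Order.height (⟨P, hP⟩ : PrimeSpectrum (A ⧸ Ideal.span {a : A | a ∈ xs})) ≤ 3 →
      UniqueFactorizationMonoid (Localization.AtPrime P)) :
    UniqueFactorizationMonoid (A ⧸ Ideal.span {a : A | a ∈ xs}) := by
  exact GrothUFD.main A hreg xs hxs hxreg hUFD
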